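/- Let n ≥ 3 and let u ∈ C²(ℝⁿ) be convex with u(0) = min_{ℝⁿ} u = 0, satisfying det D²u(x) = ψ(x) for all x ∈ ℝⁿ, where ψ : ℝⁿ → ℝ is continuous, ψ > 0 everywhere, and ψ^{1/n} − 1 ∈ Lⁿ(ℝⁿ) (i.e. ∫_{ℝⁿ} |ψ(x)^{1/n} − 1|ⁿ dx < ∞). Then there exist an invertible linear map T : ℝⁿ → ℝⁿ with det T = 1 and constants C > 0, ε > 0 such that |u(Tx) − ½|x|²| ≤ C|x|^{2−ε} for all |x| ≥ 1. -/

import Mathlib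

open MeasureTheory

/-- The Hessian matrix `(∂ᵢ∂ⱼ u(x))` of a function on Euclidean space. -/
noncomputable def hess {n : ℕ} (u : EuclideanSpace ℝ (Fin n) → ℝ)
    (x : EuclideanSpace ℝ (Fin n)) : Matrix (Fin n) (Fin n) ℝ :=
  Matrix.of fun i j =>
    iteratedFDeriv ℝ 2 u x ![EuclideanSpace.single i 1, EuclideanSpace.single j 1]

set_option linter.all false
set_option maxHeartbeats 1000000
namespace MAR
noncomputable section
open EuclideanSpace (single inner_single_left basisFun norm_sq_eq norm_eq)
open Matrix (of_apply transpose_apply det_mul det_transpose conjTranspose_apply mulVec diagonal diagonal_apply det_diagonal det_smul det_one)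
open Finset (mul_sum sum_mul sum_congr sum_comm sum_nonneg card_univ sum_le_sum sum_add_distrib sum_const sum_div smul_sum sum_sub_distrib sum_neg_distrib sum_le_card_nsmul range mem_range sum_eq_single)
open Real (rpow_natCast rpow_mul mul_self_sqrt norm_of_nonneg exp add_one_le_exp exp_nat_mul exp_pos norm_eq_abs rpow_pos_of_pos rpow_inv_natCast_pow exp_le_one_iff sq_sqrt sqrt_nonneg log)
open Fintype (card_fin)
open Set (Icc left_mem_Icc right_mem_Icc Ioi indicator_nonneg inter_subset_right mem_setOf_eq indicator_of_mem)
open LinearMap (det_toMatrix toMatrix_apply equivOfDetNeZero)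
open ENNReal (ofReal ofReal_mul ofReal_toReal ofReal_le_ofReal ofReal_add ofReal_ne_top ofReal_le_ofReal_iff toReal_ofReal ofReal_one)
open Metric (closedBall isBounded_closedBall mem_closedBall_self isOpen_ball ball_subset_closedBall ball_subset_ball isClosed_closedBall mem_closedBall)
open Filter (Eventually eventually_ge_atTop)
open ContinuousLinearMap (integral_apply comp_id smulRightL comp_apply)
open Function (uncurry Injective update)
abbrev E (n : ℕ) := EuclideanSpace ℝ (Fin n)
abbrev BL (n : ℕ) := E n →L[ℝ] E n →L[ℝ] ℝ
def ee {n : ℕ} (i : Fin n) : E n := single i 1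
def D2 {n : ℕ} (w : E n → ℝ) (x : E n) : BL n := fderiv ℝ (fderiv ℝ w) x
def frM {n : ℕ} (b : Fin n → E n) : Matrix (Fin n) (Fin n) ℝ := Matrix.of fun i j => b i j
def UF {n : ℕ} (b : Fin n → E n) : Prop := (frM b).det ^ 2 = 1
def mat {n : ℕ} (Q : BL n) : Matrix (Fin n) (Fin n) ℝ :=
  Matrix.of fun i j => Q (ee i) (ee j)
def tr {n : ℕ} (Q : BL n) (b : Fin n → E n) : ℝ := ∑ i, Q (b i) (b i)
def Sym {n : ℕ} (Q : BL n) : Prop := ∀ a b, Q a b = Q b a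
def Psd {n : ℕ} (Q : BL n) : Prop := ∀ a, 0 ≤ Q a a
local notation "pvt" => by positivity
local notation "fpr" => by fun_prop
local notation "lnr" => by linarith
local notation "nnm" => by norm_num
local notation "CD" => ContDiff ℝ 2
local notation "MB" => Metric.ball
local notation "mml" => mul_le_mul_of_nonneg_left
local notation "mmr" => mul_le_mul_of_nonneg_right
local notation "iCB" => isCompact_closedBall
local notation "nnn" => Real.norm_of_nonneg
local notation "mcB" => mem_closedBall_iff_norm
local notation "ris" => real_inner_self_eq_norm_sq
local notation "dmm" => div_mul_eq_mul_div
local notation "evF" => Filter.Eventually.of_forall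
local notation "oRl" => ENNReal.ofReal_le_ofReal
local notation:max "zE" n:max => (0 : E n)
local notation "Fu" n:max => E n → ℝ
local notation "Fr" n:max => Fin n → E n
local notation "gcg" => by gcongr
local notation "rng" => by ring
local notation "smp" => by simp
local notation "omg" => by omega
local notation "ldi" => le_div_iff₀
local notation "dli" => div_le_iff₀
local notation "ppl" => pow_le_pow_left₀
local notation "ppr" => pow_le_pow_right₀
local notation "sem" => smul_eq_mul
local notation "plo" => pow_le_one₀
local notation "imc" => inv_mul_cancel₀
local notation "sma" => _root_.smul_apply
local notation "sba" => _root_.sub_apply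
local notation "mlol" => mul_le_of_le_one_left
local notation "olp" => one_le_pow₀
local notation "mll" => min_le_left
local notation "mlr" => min_le_right
local notation "aop" => abs_of_pos
local notation "cIH" => Continuous.integrable_of_hasCompactSupport
local notation "fd" => fderiv ℝ
local notation "inr" => inner ℝ
local notation "iml" => inv_mul_le_iff₀
local notation "mcz" => mem_closedBall_zero_iff
local notation "mbz" => mem_ball_zero_iff
local notation "CLi" => ContinuousLinearMap.id
local notation "cco" => continuous_const
local notation "cSp" => Classical.choose_spec
variable {n : ℕ}
instance : ContinuousSMul ℝ (E n) := inferInstance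
instance : T2Space (E n) := inferInstance
instance : IsTopologicalAddGroup (E n) := inferInstance
instance : ContinuousAdd (E n) := inferInstance
instance : SecondCountableTopology (E n) := inferInstance
instance : ContinuousSMul ℝ (E n →L[ℝ] ℝ) := inferInstance
instance : T2Space (E n →L[ℝ] ℝ) := inferInstance
instance : IsTopologicalAddGroup (E n →L[ℝ] ℝ) := inferInstance
instance : ContinuousAdd (E n →L[ℝ] ℝ) := inferInstance
instance : SecondCountableTopology (E n →L[ℝ] ℝ) := inferInstance
instance : ContinuousSMul ℝ (BL n) := inferInstance
instance : T2Space (BL n) := inferInstance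
instance : IsTopologicalAddGroup (BL n) := inferInstance
instance : SecondCountableTopology (BL n) := inferInstance
variable {r δ R c M κ Θ C0 η c1 ϱ m σ ε d1 L τ α Λ t d3 N Lz I1 C2 C r1 d c3 a T P τ1 ν η' δ' β s0 l e' Y X R' Ce Cd C1 A : ℝ} {v g w ρ f u F y g' Z h e G χ ρ2 ρ1 V H : Fu n} {b B : Fr n} {Q : BL n} {x x1 p x' : E n} {S K : Set (E n)}
lemma exR (a : ℝ) : ∃ x, x = a := ⟨_, rfl⟩
lemma exF (a : Fu n) : ∃ x, x = a := ⟨_, rfl⟩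
lemma sum_ee (x : E n) : ∑ i, x i • (ee i : E n) = x := by
  ext j
  simp [ee, Finset.sum_apply, Pi.single_apply]
lemma fr_eq (b : Fr n) (i : Fin n) : b i = ∑ j, frM b i j • (ee j : E n) := by
  rw [← sum_ee (b i)]; simp [frM, sum_ee]
lemma frM_ee : frM (ee : Fr n) = 1 := by
  ext i j
  simp [frM, ee, Matrix.one_apply, eq_comm]
lemma UF_ee : UF (ee : Fr n) := by simp [UF, frM_ee]
lemma gram_eq (Q : BL n) (b : Fr n) :
    (Matrix.of fun i j => Q (b i) (b j)) = frM b * mat Q * (frM b).transpose := by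
  ext i j
  rw [of_apply]
  conv_lhs => rw [fr_eq b i, fr_eq b j]
  simp only [map_sum, map_smul, _root_.sum_apply, sma,
    sem, Matrix.mul_apply, mat, transpose_apply, of_apply]
  simp only [mul_sum, sum_mul]
  refine sum_congr rfl fun k _ => sum_congr rfl fun l _ => rng
lemma det_gram (Q : BL n) (b : Fr n) :
    (Matrix.of fun i j => Q (b i) (b j)).det = (frM b).det ^ 2 * (mat Q).det := by
  rw [gram_eq, det_mul, det_mul, det_transpose]; ring
lemma bl_sum (Q : BL n) (c : Fin n → ℝ) (b : Fr n) :
    Q (∑ i, c i • b i) (∑ i, c i • b i) = ∑ i, ∑ j, c i * (c j * Q (b i) (b j)) := by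
  simp only [map_sum, map_smul, _root_.sum_apply, sma,
    sem, mul_sum]
  rw [sum_comm]
  refine sum_congr rfl fun k _ => sum_congr rfl fun l _ => rng
lemma gram_psd (hs : Sym Q) (hp : Psd Q) (b : Fr n) :
    (Matrix.of fun i j => Q (b i) (b j)).PosSemidef := by
  rw [Matrix.posSemidef_iff_dotProduct_mulVec]
  refine ⟨?_, fun c => ?_⟩
  · ext i j; simp [conjTranspose_apply, hs (b j) (b i)]
  · have := hp (∑ i, c i • b i)
    rw [bl_sum] at this
    simpa [dotProduct, mulVec, mul_sum, mul_comm, mul_left_comm, mul_assoc] using this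
lemma amgm_real (hn : 0 < n) (a : Fin n → ℝ) (ha : ∀ i, 0 ≤ a i) :
    ∏ i, a i ≤ ((∑ i, a i) / n) ^ n := by
  have hn' : (0:ℝ) < n := by exact_mod_cast hn
  have h := Real.geom_mean_le_arith_mean_weighted Finset.univ (fun _ : Fin n => (1:ℝ)/n) a
    (fun _ _ => pvt) (by simp; field_simp) (fun i _ => ha i)
  have h2 : (∑ i, (1:ℝ)/n * a i) = (∑ i, a i) / n := by
    rw [← mul_sum]; ring
  rw [h2] at h
  have h3 := ppl (Finset.prod_nonneg fun i _ => Real.rpow_nonneg (ha i) _) h n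
  rw [← Finset.prod_pow] at h3
  refine le_trans (le_of_eq (Finset.prod_congr rfl fun i _ => ?_)) h3
  rw [← rpow_natCast, ← rpow_mul (ha i)]
  field_simp; simp
lemma det_le_tr {A : Matrix (Fin n) (Fin n) ℝ} (hn : 0 < n) (hA : A.PosSemidef) :
    A.det ≤ (A.trace / n) ^ n := by
  rw [hA.isHermitian.det_eq_prod_eigenvalues, hA.isHermitian.trace_eq_sum_eigenvalues]
  exact amgm_real hn _ hA.eigenvalues_nonneg
lemma det_nonneg_psd (hs : Sym Q) (hp : Psd Q) : 0 ≤ (mat Q).det :=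
  (gram_psd hs hp ee).det_nonneg
lemma tr_nonneg (hp : Psd Q) (b : Fr n) : 0 ≤ tr Q b :=
  sum_nonneg fun i _ => hp _
lemma det_le_frame (hn : 0 < n) (hs : Sym Q) (hp : Psd Q) (hb : UF b) :
    (mat Q).det ≤ (tr Q b / n) ^ n := by
  have h := det_le_tr hn (gram_psd hs hp b)
  rw [det_gram, hb, one_mul] at h
  simpa [Matrix.trace, tr] using h
lemma amgm_gen (hn : 0 < n) (hs : Sym Q) (hp : Psd Q) (b : Fr n) {g : ℝ} (hg : 0 ≤ d * g) (hb : d ^ n ≤ (frM b).det ^ 2) (hdet : g ^ n = (mat Q).det) : n * (d * g) ≤ tr Q b := by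
  have h := det_le_tr hn (gram_psd hs hp b)
  rw [det_gram] at h
  have hn' : (0:ℝ) < n := by exact_mod_cast hn
  have h1 : (d * g) ^ n ≤ (tr Q b / n) ^ n := by
    have h' : (frM b).det ^ 2 * (mat Q).det ≤ (tr Q b / n) ^ n := by
      simpa [Matrix.trace, tr] using h
    rw [mul_pow, hdet]
    exact le_trans (mmr hb (det_nonneg_psd hs hp)) h'
  have h2 := le_of_pow_le_pow_left₀ hn.ne' (div_nonneg (tr_nonneg hp b) hn'.le) h1
  rw [ldi hn'] at h2; linarith
lemma amgm (hn : 0 < n) (hs : Sym Q) (hp : Psd Q) (hb : UF b) {g : ℝ}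
    (hg : 0 ≤ g) (hdet : g ^ n = (mat Q).det) : n * g ≤ tr Q b := by
  have := amgm_gen hn hs hp b (g := g) (d := 1) (by simpa using hg) (by simp [hb.symm.le, show (frM b).det ^ 2 = 1 from hb]) hdet
  simpa using this
lemma bl_apply (Q : BL n) (x y : E n) : Q x y = (x : Fin n → ℝ) ⬝ᵥ (mat Q).mulVec y := by
  conv_lhs => rw [← sum_ee x, ← sum_ee y]
  simp only [map_sum, map_smul, _root_.sum_apply, sma, sem, dotProduct,
    mulVec, mat, of_apply, mul_sum]
  rw [sum_comm]
  refine sum_congr rfl fun k _ => sum_congr rfl fun l _ => rng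
lemma diag (hs : Sym Q) : ∃ (v : OrthonormalBasis (Fin n) ℝ (E n)) (l : Fin n → ℝ),
    ∀ i j, Q (v i) (v j) = if i = j then l i else 0 := by
  have hA : (mat Q).IsHermitian := by
    ext i j; simp [conjTranspose_apply, mat, hs (ee j) (ee i)]
  refine ⟨hA.eigenvectorBasis, hA.eigenvalues, fun i j => ?_⟩
  rw [bl_apply, hA.mulVec_eigenvectorBasis, dotProduct_smul]
  have := hA.eigenvectorBasis.inner_eq_ite i j
  rw [PiLp.inner_apply] at this
  simp only [dotProduct, sem]
  rw [show (∑ k, (hA.eigenvectorBasis i) k * (hA.eigenvectorBasis j) k) = if i = j then 1 else 0 from by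
    rw [← this]; refine sum_congr rfl fun k _ => by simp [mul_comm]]
  split_ifs with h <;> simp [h]
lemma UF_of_gram {f : ℝ} (hf : 0 < f) (hdet : (mat Q).det = f ^ n)
    (h : ∀ i j, Q (b i) (b j) = if i = j then f else 0) : UF b := by
  have h1 := det_gram Q b
  have : (Matrix.of fun i j => Q (b i) (b j)) = diagonal fun _ => f := by
    ext i j; rw [of_apply, h, diagonal_apply]
  rw [this, det_diagonal, hdet, Finset.prod_const, card_univ, card_fin] at h1
  exact mul_right_cancel₀ (pow_pos hf n).ne' (by linarith [h1] : (frM b).det ^ 2 * f ^ n = 1 * f ^ n)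
lemma frame (hs : Sym Q) (hp : ∀ x, x ≠ 0 → 0 < Q x x) {f : ℝ} (hf : 0 < f)
    (hdet : (mat Q).det = f ^ n) :
    ∃ b : Fr n, UF b ∧ ∀ i j, Q (b i) (b j) = if i = j then f else 0 := by
  obtain ⟨v, l, hv⟩ := diag hs
  have hl : ∀ i, 0 < l i := fun i => by
    have := hp (v i) (v.orthonormal.ne_zero i)
    simpa [hv] using this
  refine ⟨fun i => Real.sqrt (f / l i) • v i, ?_, ?_⟩
  · apply UF_of_gram hf hdet
    intro i j
    simp only [map_smul, sma, sem, hv]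
    split_ifs with h
    · subst h
      rw [← mul_assoc, mul_self_sqrt (by have := hl i; positivity)]
      field_simp [(hl i).ne']
    · simp
  · intro i j
    simp only [map_smul, sma, sem, hv]
    split_ifs with h
    · subst h
      rw [← mul_assoc, mul_self_sqrt (by have := hl i; positivity)]
      field_simp [(hl i).ne']
    · simp
lemma tr_frame {f : ℝ}
    (h : ∀ i j, Q (b i) (b j) = if i = j then f else 0) : tr Q b = n * f := by
  simp [tr, h]
lemma psd_sum_le (hs : Sym Q) (hp : Psd Q) (c : Fin n → ℝ) (b : Fr n) :
    Q (∑ i, c i • b i) (∑ i, c i • b i) ≤ n * ∑ i, c i ^ 2 * Q (b i) (b i) := by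
  rw [bl_sum]
  have h : ∀ i j, c i * (c j * Q (b i) (b j)) ≤
      (c i ^ 2 * Q (b i) (b i) + c j ^ 2 * Q (b j) (b j)) / 2 := fun i j => by
    have := hp (c i • b i - c j • b j)
    simp only [map_sub, map_smul, sba, sma, sem,
      hs (b j) (b i)] at this
    nlinarith
  calc _ ≤ ∑ i, ∑ j, (c i ^ 2 * Q (b i) (b i) + c j ^ 2 * Q (b j) (b j)) / 2 :=
        sum_le_sum fun i _ => sum_le_sum fun j _ => h i j
    _ = _ := by
        simp only [add_div, sum_add_distrib, sum_const, card_univ,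
          card_fin, nsmul_eq_mul, ← mul_sum, ← sum_div]
        ring
lemma inv_frame (hb : UF b) {K : ℝ} (hK : 1 ≤ K) (h : ∀ i j, |frM b i j| ≤ K) :
    ∃ c : Fin n → Fin n → ℝ, (∀ i j, |c i j| ≤ n.factorial * K ^ n) ∧
      ∀ j, (ee j : E n) = ∑ k, c j k • b k := by
  have hdet : |(frM b).det| = 1 := by
    have : |(frM b).det| ^ 2 = 1 := by rw [sq_abs]; exact hb
    nlinarith [abs_nonneg (frM b).det]
  have hu : IsUnit (frM b).det := by
    rw [isUnit_iff_ne_zero]; intro h0; rw [h0] at hdet; simp at hdet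
  refine ⟨fun i j => (frM b)⁻¹ i j, fun i j => ?_, fun j => ?_⟩
  · show |(frM b)⁻¹ i j| ≤ _
    rw [Matrix.inv_def, Matrix.smul_apply, sem, Ring.inverse_eq_inv', abs_mul, abs_inv, hdet, inv_one,
      one_mul, Matrix.adjugate_apply]
    have := Matrix.det_le (A := (frM b).updateRow j (Pi.single i 1)) (abv := AbsoluteValue.abs) (x := K) ?_
    · simpa using this
    · intro i' j'
      rw [Matrix.updateRow_apply]
      split_ifs
      · rw [Pi.single_apply]; split_ifs <;> simp <;> linarith
      · exact h _ _
  · have h1 : ∀ k, b k = ∑ l, frM b k l • (ee l : E n) := fr_eq b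
    have h2 := Matrix.nonsing_inv_mul _ hu
    calc (ee j : E n) = ∑ l, ((1 : Matrix (Fin n) (Fin n) ℝ) j l) • (ee l : E n) := by
          simp [Matrix.one_apply]
      _ = ∑ l, (∑ k, (frM b)⁻¹ j k * frM b k l) • (ee l : E n) := by
          rw [← h2]; simp [Matrix.mul_apply]
      _ = ∑ k, (frM b)⁻¹ j k • b k := by
          simp only [Finset.sum_smul]
          rw [sum_comm]
          refine sum_congr rfl fun k _ => ?_
          conv_rhs => rw [h1 k]
          rw [smul_sum]
          simp only [mul_smul]
def lap (w : Fu n) (x : E n) : ℝ := tr (D2 w x) ee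
lemma abs_coord_le (x : E n) (i : Fin n) : |x i| ≤ ‖x‖ := by
  simpa using PiLp.norm_apply_le x i
lemma tr_ee_le (hs : Sym Q) (hp : Psd Q) (hb : UF b) {K : ℝ} (hK : 1 ≤ K)
    (h : ∀ i, ‖b i‖ ≤ K) : tr Q ee ≤ (n ^ 2 * (n.factorial * K ^ n) ^ 2) * tr Q b := by
  obtain ⟨c, hc, hc'⟩ := inv_frame hb hK (fun i j => (abs_coord_le (b i) j).trans (h i))
  have h1 : ∀ j, Q (ee j) (ee j) ≤ n * ((n.factorial * K ^ n) ^ 2 * tr Q b) := fun j => by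
    rw [hc' j]
    refine (psd_sum_le hs hp _ _).trans (mml ?_ (Nat.cast_nonneg _))
    rw [tr, mul_sum]
    refine sum_le_sum fun i _ => mmr ?_ (hp _)
    rw [← sq_abs]
    exact ppl (abs_nonneg _) (hc _ _) 2
  calc tr Q ee ≤ ∑ j : Fin n, n * ((n.factorial * K ^ n) ^ 2 * tr Q b) := sum_le_sum fun j _ => h1 j
    _ = _ := by simp; ring
lemma psd_le_tr (hs : Sym Q) (hp : Psd Q) (x : E n) : Q x x ≤ n * tr Q ee * ‖x‖ ^ 2 := by
  have h := psd_sum_le hs hp (fun i => x i) ee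
  rw [sum_ee] at h
  refine h.trans ?_
  rw [mul_assoc]
  refine mml ?_ (Nat.cast_nonneg _)
  rw [tr, sum_mul]
  refine sum_le_sum fun i _ => ?_
  rw [mul_comm]
  refine mml ?_ (hp _)
  rw [← sq_abs]
  exact ppl (abs_nonneg _) (abs_coord_le _ _) 2
lemma mat_D2 (u : Fu n) (x : E n) : mat (D2 u x) = hess u x := by
  ext i j
  simp [mat, hess, D2, ee, iteratedFDeriv_two_apply]
lemma D2_symm (hw : CD w) (x : E n) : Sym (D2 w x) := by
  intro a b
  exact (hw.contDiffAt.isSymmSndFDerivAt smp) a b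
lemma cd1 (hw : CD w) : ContDiff ℝ 1 (fd w) :=
  hw.fderiv_right nnm
lemma hasF (hw : CD w) (x : E n) : HasFDerivAt w (fd w x) x :=
  (hw.differentiable nnm x).hasFDerivAt
lemma hasFF (hw : CD w) (x : E n) : HasFDerivAt (fd w) (D2 w x) x :=
  ((cd1 hw).differentiable nnm x).hasFDerivAt
lemma cont_D2 (hw : CD w) : Continuous (D2 w) :=
  (cd1 hw).continuous_fderiv nnm
lemma cont_F (hw : CD w) : Continuous (fd w) :=
  (cd1 hw).continuous
lemma D2_of {w' : E n → (E n →L[ℝ] ℝ)} (h : ∀ y, HasFDerivAt w (w' y) y) (h2 : HasFDerivAt w' Q x) : D2 w x = Q := by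
  have : fd w = w' := funext fun y => (h y).fderiv
  rw [D2, this]; exact h2.fderiv
lemma D2_add (hv : CD v) (hw : CD w) (x : E n) :
    D2 (fun y => v y + w y) x = D2 v x + D2 w x :=
  D2_of (fun y => (hasF hv y).add (hasF hw y)) ((hasFF hv x).add (hasFF hw x))
lemma D2_sub (hv : CD v) (hw : CD w) (x : E n) :
    D2 (fun y => v y - w y) x = D2 v x - D2 w x :=
  D2_of (fun y => (hasF hv y).sub (hasF hw y)) ((hasFF hv x).sub (hasFF hw x))
lemma D2_neg (hv : CD v) (x : E n) :
    D2 (fun y => - v y) x = - D2 v x :=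
  D2_of (fun y => (hasF hv y).neg) ((hasFF hv x).neg)
lemma D2_smul (hv : CD v) (c : ℝ) (x : E n) :
    D2 (fun y => c * v y) x = c • D2 v x :=
  D2_of (fun y => (hasF hv y).const_mul c) ((hasFF hv x).const_smul c)
lemma D2_const (c : ℝ) (x : E n) : D2 (fun _ => c) x = 0 :=
  D2_of (w' := fun _ => 0) (fun y => hasFDerivAt_const c y) (hasFDerivAt_const _ x)
lemma D2_lin (l : E n →L[ℝ] ℝ) (x : E n) : D2 (fun y => l y) x = 0 :=
  D2_of (w' := fun _ => l) (fun y => l.hasFDerivAt) (hasFDerivAt_const _ x)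
lemma D2_comp {φ : E n → E n} (hv : CD v) (hφ : CD φ) (x a b : E n) :
    D2 (fun y => v (φ y)) x a b = D2 v (φ x) (fd φ x a) (fd φ x b) +
      fd v (φ x) (fd (fd φ) x a b) := by
  have h1 : ∀ y, HasFDerivAt φ (fd φ y) y := fun y =>
    (hφ.differentiable nnm y).hasFDerivAt
  have h2 : HasFDerivAt (fd φ) (fd (fd φ) x) x :=
    ((hφ.fderiv_right (m := 1) nnm).differentiable nnm x).hasFDerivAt
  have := D2_of (fun y => (hasF hv (φ y)).comp y (h1 y)) (((hasFF hv (φ x)).comp x (h1 x)).clm_comp h2)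
  rw [show (fun y => v (φ y)) = v ∘ φ from rfl, this]
  simp
  ring
lemma D2_affine (hv : CD v) (T : E n →L[ℝ] E n) (c x a b : E n) :
    D2 (fun y => v (c + T y)) x a b = D2 v (c + T x) (T a) (T b) := by
  have h : ∀ y, HasFDerivAt (fun y => c + T y) T y := fun y => T.hasFDerivAt.const_add c
  have h1 : fd (fun y => c + T y) = fun _ => T := funext fun y => (h y).fderiv
  rw [D2_comp hv fpr, h1]
  simp
lemma D2_shift (hv : CD v) (c x : E n) :
    D2 (fun y => v (y + c)) x = D2 v (x + c) := by
  ext a b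
  have := D2_affine hv (CLi ℝ _) c x a b
  simpa [add_comm] using this
lemma D2_gcomp (hw : CD w) {g g' g'' : ℝ → ℝ}
    (hg : ∀ t, HasDerivAt g (g' t) t) (hg' : ∀ t, HasDerivAt g' (g'' t) t) (x a b : E n) :
    D2 (fun y => g (w y)) x a b = g'' (w x) * (fd w x a * fd w x b) + g' (w x) * D2 w x a b := by
  have h1 : ∀ y, HasFDerivAt (fun y => g (w y)) (g' (w y) • fd w y) y := fun y =>
    (hg (w y)).comp_hasFDerivAt y (hasF hw y)
  rw [D2_of h1 (((hg' (w x)).comp_hasFDerivAt x (hasF hw x)).smul (hasFF hw x))]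
  simp
  ring
lemma hasF_nsq (x : E n) : HasFDerivAt (fun y : E n => ‖y‖ ^ 2) ((2:ℝ) • innerSL ℝ x) x := by
  have := (hasStrictFDerivAt_norm_sq x).hasFDerivAt
  rw [two_smul]; rwa [two_nsmul] at this
lemma cd_nsq : CD (fun y : E n => ‖y‖ ^ 2) := contDiff_norm_sq ℝ
lemma D2_nsq (x a b : E n) : D2 (fun y : E n => ‖y‖ ^ 2) x a b = 2 * inr a b := by
  have h2 : HasFDerivAt (fun y : E n => (2:ℝ) • innerSL ℝ y) ((2:ℝ) • innerSL ℝ) x :=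
    ((innerSL ℝ).hasFDerivAt (x := x)).const_smul (2:ℝ)
  rw [D2_of hasF_nsq h2]
  simp
  rfl
lemma line1 (hw : CD w) (x a : E n) (t : ℝ) :
    HasDerivAt (fun t : ℝ => w (x + t • a)) (fd w (x + t • a) a) t := by
  have h : HasDerivAt (fun t : ℝ => x + t • a) a t := by
    simpa using ((hasDerivAt_id t).smul_const a).const_add x
  exact (hasF hw _).comp_hasDerivAt t h
lemma line2 (hw : CD w) (x a b : E n) (t : ℝ) :
    HasDerivAt (fun t : ℝ => fd w (x + t • a) b) (D2 w (x + t • a) a b) t := by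
  have h : HasDerivAt (fun t : ℝ => x + t • a) a t := by
    simpa using ((hasDerivAt_id t).smul_const a).const_add x
  have := ((hasFF hw _).comp_hasDerivAt t h).clm_apply (hasDerivAt_const t b)
  simpa using this
lemma grad_mono (hw : CD w) {s : Set (E n)} (hs : Convex ℝ s)
    (h : ∀ z ∈ s, Psd (D2 w z)) {y : E n} (hx : x ∈ s) (hy : y ∈ s) :
    fd w x (y - x) ≤ fd w y (y - x) := by
  have hm : MonotoneOn (fun t : ℝ => fd w (x + t • (y - x)) (y - x)) (Icc 0 1) := by
    apply monotoneOn_of_deriv_nonneg (convex_Icc 0 1)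
    · exact fun t _ => (line2 hw x (y - x) (y - x) t).continuousAt.continuousWithinAt
    · exact fun t _ => (line2 hw x (y - x) (y - x) t).differentiableAt.differentiableWithinAt
    · intro t ht
      rw [interior_Icc] at ht
      rw [(line2 hw x (y - x) (y - x) t).deriv]
      exact h _ (hs.add_smul_sub_mem hx hy ⟨ht.1.le, ht.2.le⟩) _
  have := hm (left_mem_Icc.2 zero_le_one) (right_mem_Icc.2 zero_le_one) zero_le_one
  simpa using this
lemma grad_ineq (hw : CD w) {s : Set (E n)} (hs : Convex ℝ s)
    (h : ∀ z ∈ s, Psd (D2 w z)) {y : E n} (hx : x ∈ s) (hy : y ∈ s) :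
    w x + fd w x (y - x) ≤ w y := by
  have hm : MonotoneOn (fun t : ℝ => w (x + t • (y - x)) - t * fd w x (y - x)) (Icc 0 1) := by
    have hd : ∀ t, HasDerivAt (fun t : ℝ => w (x + t • (y - x)) - t * fd w x (y - x))
      (fd w (x + t • (y - x)) (y - x) - 1 * fd w x (y - x)) t := fun t =>
      (line1 hw x (y - x) t).sub ((hasDerivAt_id t).mul_const _)
    apply monotoneOn_of_deriv_nonneg (convex_Icc 0 1)
    · exact fun t _ => (hd t).continuousAt.continuousWithinAt
    · exact fun t _ => (hd t).differentiableAt.differentiableWithinAt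
    · intro t ht
      rw [interior_Icc] at ht
      rw [(hd t).deriv]
      have h1 := grad_mono hw hs h hx (hs.add_smul_sub_mem hx hy ⟨ht.1.le, ht.2.le⟩)
      simp only [add_sub_cancel_left, map_smul, sem] at h1
      have := le_of_mul_le_mul_left h1 ht.1
      linarith
  have := hm (left_mem_Icc.2 zero_le_one) (right_mem_Icc.2 zero_le_one) zero_le_one
  simp only [zero_smul, add_zero, zero_mul, sub_zero, one_smul, add_sub_cancel, one_mul] at this
  linarith
lemma psd_of_convex (hw : CD w) (hc : ConvexOn ℝ Set.univ w) (x : E n) :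
    Psd (D2 w x) := by
  intro a
  have hconv : ConvexOn ℝ Set.univ (fun t : ℝ => w (x + t • a)) := by
    refine ⟨convex_univ, fun s _ t _ p q hp hq hpq => ?_⟩
    have := hc.2 (Set.mem_univ (x + s • a)) (Set.mem_univ (x + t • a)) hp hq hpq
    refine le_trans (le_of_eq ?_) this
    have h1 : x + (p • s + q • t) • a = (p + q) • x + (p • s + q • t) • a := by rw [hpq, one_smul]
    show w (x + (p • s + q • t) • a) = _
    rw [h1]; congr 1; simp only [sem]; module
  have hm : Monotone (fun t : ℝ => fd w (x + t • a) a) := by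
    have := hconv.monotoneOn_derivWithin (fun t _ => (line1 hw x a t).differentiableAt.differentiableWithinAt)
    intro s t hst
    have h := this (Set.mem_univ s) (Set.mem_univ t) hst
    simp only [derivWithin_univ] at h
    rwa [(line1 hw x a s).deriv, (line1 hw x a t).deriv] at h
  have h0 := line2 hw x a a 0
  have h1 : 0 ≤ deriv (fun t : ℝ => fd w (x + t • a) a) 0 := hm.deriv_nonneg
  rw [h0.deriv] at h1
  simpa using h1
lemma nsd_of_localmax (hw : CD w) (h : IsLocalMax w x) (a : E n) :
    D2 w x a a ≤ 0 := by
  by_contra hc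
  push Not at hc
  have h0 : fd w x = 0 := h.fderiv_eq_zero
  have h1 : IsLocalMax (fun t : ℝ => w (x + t • a)) 0 := by
    have hcont : Filter.Tendsto (fun t : ℝ => x + t • a) (nhds 0) (nhds x) := by
      have : Continuous (fun t : ℝ => x + t • a) := fpr
      simpa using this.tendsto 0
    have := hcont.eventually h
    simpa [IsLocalMax, IsMaxFilter] using this
  have hd : deriv (fun t : ℝ => w (x + t • a)) = fun t => fd w (x + t • a) a :=
    funext fun t => (line1 hw x a t).deriv
  have h2 := line2 hw x a a 0
  simp only [zero_smul, add_zero] at h2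
  have h3 : ∀ᶠ t in nhdsWithin (0:ℝ) (Ioi 0), 0 < fd w (x + t • a) a := by
    have := (hasDerivAt_iff_tendsto_slope.1 h2).eventually (lt_mem_nhds hc)
    have h4 : nhdsWithin (0:ℝ) (Ioi 0) ≤ nhdsWithin 0 {0}ᶜ := nhdsWithin_mono _ (fun t ht => (ne_of_gt ht))
    filter_upwards [h4 this, self_mem_nhdsWithin] with t ht ht'
    simp only [slope, vsub_eq_sub, sub_zero, zero_smul, add_zero, h0, _root_.zero_apply, sem] at ht
    exact (pos_iff_pos_of_mul_pos ht).1 (inv_pos.2 ht')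
  obtain ⟨ε, hε, h5⟩ := (mem_nhdsGT_iff_exists_Ioo_subset).1 h3
  have h6 : StrictMonoOn (fun t : ℝ => w (x + t • a)) (Set.Ico 0 ε) := by
    apply strictMonoOn_of_deriv_pos (convex_Ico 0 ε)
    · exact fun t _ => (line1 hw x a t).continuousAt.continuousWithinAt
    · intro t ht
      rw [interior_Ico] at ht
      rw [hd]; exact h5 ht
  have h7 : ∀ᶠ t in nhdsWithin (0:ℝ) (Ioi 0), w (x + t • a) ≤ w (x + (0:ℝ) • a) :=
    nhdsWithin_le_nhds h1
  have h8 : ∀ᶠ t in nhdsWithin (0:ℝ) (Ioi 0), t ∈ Set.Ioo 0 ε := Ioo_mem_nhdsGT hε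
  obtain ⟨t, ht, ht'⟩ := (h7.and h8).exists
  have := h6 ⟨le_rfl, hε⟩ ⟨ht'.1.le, ht'.2⟩ ht'.1
  exact absurd ht (not_le.2 this)
def gr (w : Fu n) (x : E n) : E n := ∑ i, fd w x (ee i) • ee i
lemma gr_inner (w : Fu n) (x y : E n) : inr (gr w x) y = fd w x y := by
  conv_rhs => rw [← sum_ee y]
  simp only [gr, sum_inner, map_sum, map_smul, sem, real_inner_smul_left]
  refine sum_congr rfl fun i _ => ?_
  rw [show inr (ee i : E n) y = y i by simp [ee, inner_single_left]]
  ring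
lemma gr_norm (w : Fu n) (x : E n) : ‖gr w x‖ = ‖fd w x‖ := by
  have : fd w x = innerSL ℝ (gr w x) := by
    ext y; simp [gr_inner]
  rw [this, innerSL_apply_norm]
def grD (w : Fu n) (x : E n) : E n →L[ℝ] E n :=
  ∑ i, ((ContinuousLinearMap.apply ℝ ℝ (ee i : E n)).comp (D2 w x)).smulRight (ee i : E n)
lemma hasF_gr (hw : CD w) (x : E n) : HasFDerivAt (gr w) (grD w x) x := by
  have : gr w = fun x => ∑ i, fd w x (ee i) • ee i := rfl
  rw [this]
  unfold grD
  apply HasFDerivAt.fun_sum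
  intro i _
  have := ((ContinuousLinearMap.apply ℝ ℝ (ee i : E n)).hasFDerivAt.comp x (hasFF hw x)).smul_const (ee i : E n)
  exact this
lemma grD_det (hw : CD w) (x : E n) : (grD w x).det = (mat (D2 w x)).det := by
  rw [ContinuousLinearMap.det, ← det_toMatrix (basisFun (Fin n) ℝ).toBasis]
  congr 1
  ext i j
  rw [toMatrix_apply]
  simp [grD, mat, ee, D2_symm hw x (single j 1) _, Finset.sum_apply, Pi.single_apply]
lemma cont_gr (hw : CD w) : Continuous (gr w) :=
  continuous_iff_continuousAt.2 fun x => (hasF_gr hw x).continuousAt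
lemma cont_mat_det (hw : CD w) : Continuous fun x => (mat (D2 w x)).det := by
  have := cont_D2 hw
  apply Continuous.matrix_det
  refine continuous_matrix fun i j => ?_
  simp only [mat, of_apply]
  fun_prop
def vB (n : ℕ) : ℝ := (volume (MB zE n 1)).toReal
lemma vB_pos (n : ℕ) : 0 < vB n := ENNReal.toReal_pos (Metric.measure_ball_pos _ _ one_pos).ne' measure_ball_lt_top.ne
lemma vol_ball (x : E n) (hr' : 0 < r) : volume (MB x r) = ofReal (r ^ n * vB n) := by
  rw [Measure.addHaar_ball_of_pos _ _ hr', ofReal_mul pvt, vB, ofReal_toReal measure_ball_lt_top.ne]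
  simp
def cset (w : Fu n) (K : Set (E n)) (a c : ℝ) : Set (E n) :=
  {x ∈ K | a ≤ w x ∧ ‖fd w x‖ ≤ c ∧ ∀ z, D2 w x z z ≤ 0}
lemma abp_cover (hw : CD w) (hK : IsCompact K)
    (hx1 : x1 ∈ K) (hm : 0 < m) (hR : 0 < R) (hwm : m ≤ w x1)
    (hKR : ∀ x ∈ K, ‖x - x1‖ ≤ R) (hint : ∀ x ∈ K, 0 < w x → x ∈ interior K) :
    MB 0 (m / (2 * R)) ⊆ gr w '' cset w K (m / 2) (m / (2 * R)) := by
  intro p hp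
  rw [mbz] at hp
  let W : Fu n := fun x => w x - innerSL ℝ p x
  have hW : CD W := hw.sub (innerSL ℝ p).contDiff
  obtain ⟨x0, hx0, hmax⟩ := hK.exists_isMaxOn ⟨x1, hx1⟩ hW.continuous.continuousOn
  have h1 : W x1 ≤ W x0 := hmax hx1
  have h2 : w x0 ≥ m / 2 := by
    have h3 : |inr p (x0 - x1)| ≤ m / (2 * R) * R :=
      (abs_real_inner_le_norm _ _).trans (mul_le_mul hp.le (hKR _ hx0) (norm_nonneg _) pvt)
    have h4 : m / (2 * R) * R = m / 2 := by field_simp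
    rw [h4] at h3
    have := (abs_le.1 h3).1
    rw [inner_sub_right] at this
    simp only [W, innerSL_apply_apply] at h1
    linarith
  have h5 : IsLocalMax W x0 := by
    have := hint x0 hx0 lnr
    exact hmax.isLocalMax (mem_interior_iff_mem_nhds.1 this)
  have h6 := h5.fderiv_eq_zero
  have h7 : fd W x0 = fd w x0 - innerSL ℝ p :=
    ((hasF hw x0).sub (innerSL ℝ p).hasFDerivAt).fderiv
  have h8 : fd w x0 = innerSL ℝ p := by rw [h7] at h6; exact sub_eq_zero.1 h6
  refine ⟨x0, ⟨hx0, h2, ?_, fun z => ?_⟩, ?_⟩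
  · rw [h8, innerSL_apply_norm]; exact hp.le
  · have := nsd_of_localmax hW h5 z
    rw [D2_sub hw (innerSL ℝ p).contDiff, D2_lin] at this
    simpa using this
  · refine ext_inner_right ℝ fun y => ?_
    rw [gr_inner, h8]; rfl
lemma cset_meas (hw : CD w) (hK : IsCompact K) (a c : ℝ) :
    IsClosed (cset w K a c) := by
  have h1 := cont_D2 hw
  have h2 := cont_F hw
  have h3 := hw.continuous
  have : cset w K a c = K ∩ ({x | a ≤ w x} ∩ ({x | ‖fd w x‖ ≤ c} ∩ ⋂ z, {x | D2 w x z z ≤ 0})) := by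
    ext x; simp [cset]; tauto
  rw [this]
  refine hK.isClosed.inter ((isClosed_le cco h3).inter ((isClosed_le fpr cco).inter ?_))
  exact isClosed_iInter fun z => isClosed_le fpr cco
lemma mat_neg (Q : BL n) : mat (-Q) = - mat Q := by ext i j; simp [mat]
lemma abp (hn : 0 < n) (hw : CD w) (hK : IsCompact K)
    (hx1 : x1 ∈ K) (hm : 0 < m) (hR : 0 < R) (hwm : m ≤ w x1)
    (hKR : ∀ x ∈ K, ‖x - x1‖ ≤ R) (hint : ∀ x ∈ K, 0 < w x → x ∈ interior K)
    (hS : MeasurableSet S) (hC1 : 0 ≤ C1) (hδ : 0 ≤ δ)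
    (he0 : ∀ x ∈ K, 0 ≤ e x)
    (he : ∫⁻ x in K, ofReal (e x ^ n) ≤ ofReal (δ ^ n))
    (hh : ∀ x ∈ cset w K (m / 2) (m / (2 * R)), ∃ b : Fr n, UF b ∧
      -(S.indicator (fun _ => C1) x + e x) ≤ tr (D2 w x) b) :
    (m / (2 * R)) ^ n * vB n ≤ 2 ^ n * (C1 ^ n * (volume (S ∩ K)).toReal + δ ^ n) := by
  have hcov := abp_cover hw hK hx1 hm hR hwm hKR hint
  set Γ := cset w K (m / 2) (m / (2 * R)) with hΓ
  have hΓm : MeasurableSet Γ := (cset_meas hw hK _ _).measurableSet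
  have hΓK : Γ ⊆ K := fun x hx => hx.1
  have h1 : volume (MB zE n (m / (2 * R))) ≤ ∫⁻ x in Γ, ofReal |(grD w x).det| :=
    (measure_mono hcov).trans (addHaar_image_le_lintegral_abs_det_fderiv volume hΓm
      (fun x _ => (hasF_gr hw x).hasFDerivWithinAt))
  have hdet : ∀ x ∈ Γ, |(grD w x).det| ≤ 2 ^ n * (S.indicator (fun _ => C1 ^ n) x + e x ^ n) := by
    intro x hx
    obtain ⟨b, hb, htr⟩ := hh x hx
    have hex := he0 x (hΓK hx)
    have hs : Sym (-D2 w x) := fun a b => by simp [D2_symm hw x a b]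
    have hp : Psd (-D2 w x) := fun a => by simpa using hx.2.2.2 a
    have h2 := det_le_frame hn hs hp hb
    have h3 : tr (-D2 w x) b = - tr (D2 w x) b := by simp [tr]
    have h0 := det_nonneg_psd hs hp
    have h4 : |(grD w x).det| = (mat (-D2 w x)).det := by
      rw [grD_det hw, ← abs_of_nonneg h0, mat_neg, Matrix.det_neg, abs_mul]; simp
    rw [h4]
    have hn' : (1:ℝ) ≤ n := by exact_mod_cast hn
    have htr0 := tr_nonneg hp b
    have h5 : tr (-D2 w x) b / n ≤ S.indicator (fun _ => C1) x + e x := by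
      refine (div_le_self htr0 hn').trans ?_
      rw [h3]; linarith
    refine h2.trans ((ppl pvt h5 n).trans ?_)
    have h6 : (S.indicator (fun _ => C1 ^ n) x : ℝ) = (S.indicator (fun _ => C1) x) ^ n := by
      by_cases hxS : x ∈ S <;> simp [hxS, hn.ne']
    rw [h6]
    have h7 : 0 ≤ S.indicator (fun _ => C1) x := indicator_nonneg (fun _ _ => hC1) x
    refine (add_pow_le h7 hex n).trans ?_
    exact mmr (ppr nnm (Nat.sub_le _ _)) pvt
  have hKfin : volume (S ∩ K) ≠ ⊤ := ((measure_mono inter_subset_right).trans_lt hK.measure_lt_top).ne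
  have h2 : ∫⁻ x in Γ, ofReal |(grD w x).det| ≤
      ofReal (2 ^ n * (C1 ^ n * (volume (S ∩ K)).toReal + δ ^ n)) := by
    calc _ ≤ ∫⁻ x in Γ, ofReal (2 ^ n) * (S.indicator (fun _ => ofReal (C1 ^ n)) x + ofReal (e x ^ n)) := by
          refine setLIntegral_mono' hΓm fun x hx => ?_
          refine (oRl (hdet x hx)).trans ?_
          have hex := he0 x (hΓK hx)
          rw [ofReal_mul pvt, ofReal_add (indicator_nonneg (fun _ _ => pvt) x) pvt]
          gcongr
          by_cases hxS : x ∈ S <;> simp [hxS]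
      _ ≤ ∫⁻ x in K, ofReal (2 ^ n) * (S.indicator (fun _ => ofReal (C1 ^ n)) x + ofReal (e x ^ n)) :=
          lintegral_mono_set hΓK
      _ = ofReal (2 ^ n) * (ofReal (C1 ^ n) * volume (S ∩ K) + ∫⁻ x in K, ofReal (e x ^ n)) := by
          rw [lintegral_const_mul' _ _ ofReal_ne_top, lintegral_add_left (measurable_const.indicator hS),
            lintegral_indicator_const hS, Measure.restrict_apply hS]
      _ ≤ ofReal (2 ^ n) * (ofReal (C1 ^ n) * volume (S ∩ K) + ofReal (δ ^ n)) := gcg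
      _ = _ := by
          rw [ofReal_mul pvt, ofReal_add pvt pvt,
            ofReal_mul pvt, ofReal_toReal hKfin]
  have h3 := h1.trans h2
  rw [vol_ball _ pvt] at h3
  exact (ofReal_le_ofReal_iff pvt).1 h3
lemma par_set {H V : Type*} [NormedAddCommGroup H] [NormedSpace ℝ H] [ProperSpace H]
    [NormedAddCommGroup V] [NormedSpace ℝ V] [CompleteSpace V]
    (hK : IsCompact K) {F : H → E n → V} {F' : H → E n → H →L[ℝ] V}
    (hF : Continuous F.uncurry) (hF' : Continuous F'.uncurry)
    (h : ∀ x k, HasFDerivAt (fun x => F x k) (F' x k) x) (x : H) :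
    HasFDerivAt (fun x => ∫ k in K, F x k) (∫ k in K, F' x k) x := by
  obtain ⟨C, hC⟩ := ((iCB x 1).prod hK).bddAbove_image hF'.norm.continuousOn
  refine hasFDerivAt_integral_of_dominated_of_fderiv_le (F := F) (F' := F') (bound := fun _ => C)
    (s := closedBall x 1)
    (Metric.closedBall_mem_nhds x one_pos) ?_ ?_ ?_ ?_ ?_ ?_
  · refine evF fun y => Continuous.aestronglyMeasurable ?_
    exact hF.comp (Continuous.prodMk_right y)
  · exact ((hF.comp (Continuous.prodMk_right x)).continuousOn).integrableOn_compact hK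
  · exact Continuous.aestronglyMeasurable (hF'.comp (Continuous.prodMk_right x))
  · rw [ae_restrict_iff' hK.measurableSet]
    exact evF fun k hk y hy => hC ⟨(y, k), ⟨hy, hk⟩, rfl⟩
  · exact (continuous_const.continuousOn).integrableOn_compact hK
  · exact evF fun k y _ => h y k
structure Ker (ρ : Fu n) : Prop where
  cont : Continuous ρ
  nonneg : ∀ k, 0 ≤ ρ k
  supp : ∀ k, 1 ≤ ‖k‖ → ρ k = 0
  even : ∀ k, ρ (-k) = ρ k
def IB (ρ : Fu n) (g : Fu n) : ℝ := ∫ k, ρ k * g k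
lemma Ker.compactSupp (h : Ker ρ) : HasCompactSupport ρ :=
  HasCompactSupport.intro (iCB 0 1) fun k hk => h.supp k (by
    simp at hk; exact hk.le)
lemma Ker.int (h : Ker ρ) (hg : Continuous g) :
    Integrable (fun k => ρ k * g k) :=
  (h.cont.mul hg).integrable_of_hasCompactSupport h.compactSupp.mul_right
lemma Ker.int' (h : Ker ρ) {V : Type*} [NormedAddCommGroup V] [NormedSpace ℝ V] {g : E n → V} (hg : Continuous g) :
    Integrable (fun k => ρ k • g k) :=
  (h.cont.smul hg).integrable_of_hasCompactSupport h.compactSupp.smul_right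
lemma IB_mono (h : Ker ρ) (hg : Continuous g) (hg' : Continuous g')
    (hle : ∀ k, ‖k‖ < 1 → g k ≤ g' k) : IB ρ g ≤ IB ρ g' := by
  refine integral_mono (h.int hg) (h.int hg') fun k => ?_
  by_cases hk : ‖k‖ < 1
  · exact mml (hle k hk) (h.nonneg k)
  · simp [h.supp k (not_lt.1 hk)]
lemma IB_nonneg (h : Ker ρ) (hle : ∀ k, ‖k‖ < 1 → 0 ≤ g k) : 0 ≤ IB ρ g := by
  refine integral_nonneg fun k => ?_
  by_cases hk : ‖k‖ < 1
  · exact mul_nonneg (h.nonneg k) (hle k hk)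
  · simp [h.supp k (not_lt.1 hk)]
lemma IB_add (h : Ker ρ) (hg : Continuous g) (hg' : Continuous g') :
    IB ρ (fun k => g k + g' k) = IB ρ g + IB ρ g' := by
  simp only [IB, mul_add]; exact integral_add (h.int hg) (h.int hg')
lemma IB_sub (h : Ker ρ) (hg : Continuous g) (hg' : Continuous g') :
    IB ρ (fun k => g k - g' k) = IB ρ g - IB ρ g' := by
  simp only [IB, mul_sub]; exact integral_sub (h.int hg) (h.int hg')
lemma IB_mul (ρ : Fu n) (c : ℝ) (g : Fu n) : IB ρ (fun k => c * g k) = c * IB ρ g := by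
  simp only [IB]; rw [← integral_const_mul]; congr 1; ext k; ring
lemma IB_const (ρ : Fu n) (c : ℝ) : IB ρ (fun k => c) = c * IB ρ (fun _ => 1) := by
  rw [← IB_mul]; simp
lemma IB_sum (h : Ker ρ) {ι : Type*} (s : Finset ι) {g : ι → Fu n} (hg : ∀ i, Continuous (g i)) :
    IB ρ (fun k => ∑ i ∈ s, g i k) = ∑ i ∈ s, IB ρ (g i) := by
  simp only [IB, mul_sum]; exact integral_finset_sum _ fun i _ => h.int (hg i)
lemma IB_odd (h : Ker ρ) (hg : ∀ k, g (-k) = - g k) : IB ρ g = 0 := by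
  have h1 : IB ρ g = - IB ρ g := by
    conv_lhs => rw [IB, ← integral_neg_eq_self]
    rw [IB, ← integral_neg]; congr 1; ext k; rw [h.even, hg]; ring
  linarith
lemma IB_eq_set (h : Ker ρ) {V : Type*} [NormedAddCommGroup V] [NormedSpace ℝ V] (g : E n → V) :
    ∫ k, ρ k • g k = ∫ k in closedBall 0 1, ρ k • g k := by
  symm
  apply setIntegral_eq_integral_of_forall_compl_eq_zero
  intro k hk
  rw [h.supp k, zero_smul]
  simp at hk; exact hk.le
lemma IB_cont (h : Ker ρ) {X : Type*} [TopologicalSpace X] [FirstCountableTopology X] [LocallyCompactSpace X]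
    {F : X → Fu n} (hF : Continuous F.uncurry) :
    Continuous (fun x => IB ρ (F x)) := by
  have : (fun x => IB ρ (F x)) = fun x => ∫ k in closedBall 0 1, ρ k • F x k := by
    ext x; rw [← IB_eq_set h]; rfl
  rw [this]
  exact continuous_parametric_integral_of_continuous ((h.cont.comp continuous_snd).smul hF) (iCB 0 1)
lemma IB_hasF (h : Ker ρ) {H : Type*} [NormedAddCommGroup H] [NormedSpace ℝ H] [ProperSpace H]
    {V : Type*} [NormedAddCommGroup V] [NormedSpace ℝ V] [CompleteSpace V]
    {F : H → E n → V} {F' : H → E n → H →L[ℝ] V}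
    (hF : Continuous F.uncurry) (hF' : Continuous F'.uncurry)
    (hd : ∀ x k, HasFDerivAt (fun x => F x k) (F' x k) x) (x : H) :
    HasFDerivAt (fun x => ∫ k, ρ k • F x k) (∫ k, ρ k • F' x k) x := by
  simp only [IB_eq_set h]
  exact par_set (iCB 0 1) ((h.cont.comp continuous_snd).smul hF)
    ((h.cont.comp continuous_snd).smul hF') (fun x k => (hd x k).const_smul (ρ k)) x
lemma int_app (h : Ker ρ) {V : Type*} [NormedAddCommGroup V] [NormedSpace ℝ V] [CompleteSpace V]
    {G : E n → E n →L[ℝ] V} (hG : Continuous G) (a : E n) : (∫ k, ρ k • G k) a = ∫ k, ρ k • G k a := by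
  have := integral_apply (h.int' hG) a
  simpa using this
structure C2fam (F : E n → Fu n) (F1 : E n → E n → E n →L[ℝ] ℝ) (F2 : E n → E n → BL n) : Prop where
  c0 : Continuous F.uncurry
  c1 : Continuous F1.uncurry
  c2 : Continuous F2.uncurry
  d1 : ∀ x k, HasFDerivAt (fun x => F x k) (F1 x k) x
  d2 : ∀ x k, HasFDerivAt (fun x => F1 x k) (F2 x k) x
lemma IB_C2 (h : Ker ρ) {F : E n → Fu n} {F1 : E n → E n → E n →L[ℝ] ℝ} {F2 : E n → E n → BL n}
    (hF : C2fam F F1 F2) :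
    CD (fun x => IB ρ (F x)) ∧
    (∀ x a, fd (fun x => IB ρ (F x)) x a = IB ρ (fun k => F1 x k a)) ∧
    (∀ x a b, D2 (fun x => IB ρ (F x)) x a b = IB ρ (fun k => F2 x k a b)) := by
  have h1 : ∀ x, HasFDerivAt (fun x => IB ρ (F x)) (∫ k, ρ k • F1 x k) x := fun x =>
    IB_hasF h hF.c0 hF.c1 hF.d1 x
  have h2 : ∀ x, HasFDerivAt (fun x => ∫ k, ρ k • F1 x k) (∫ k, ρ k • F2 x k) x := fun x =>
    IB_hasF h hF.c1 hF.c2 hF.d2 x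
  have e1 : fd (fun x => IB ρ (F x)) = fun x => ∫ k, ρ k • F1 x k := funext fun x => (h1 x).fderiv
  have e2 : fd (fun x => ∫ k, ρ k • F1 x k) = fun x => ∫ k, ρ k • F2 x k := funext fun x => (h2 x).fderiv
  have c2 : Continuous (fun x => ∫ k, ρ k • F2 x k) := by
    simp only [IB_eq_set h]
    exact continuous_parametric_integral_of_continuous ((h.cont.comp continuous_snd).smul hF.c2) (iCB 0 1)
  refine ⟨?_, fun x a => ?_, fun x a b => ?_⟩
  · rw [show (2 : WithTop ℕ∞) = 1 + 1 by norm_num, contDiff_succ_iff_fderiv]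
    refine ⟨fun x => (h1 x).differentiableAt, by simp, ?_⟩
    rw [e1, contDiff_one_iff_fderiv]
    refine ⟨fun x => (h2 x).differentiableAt, ?_⟩
    rw [e2]; exact c2
  · rw [e1]
    have := integral_apply (h.int' (hF.c1.comp (Continuous.prodMk_right x))) a
    simpa [IB] using this
  · rw [D2, e1, e2]
    have h3 : (∫ k, ρ k • F2 x k) a = ∫ k, ρ k • F2 x k a :=
      int_app h (hF.c2.comp (Continuous.prodMk_right x)) a
    rw [h3]
    have c3 : Continuous fun k => F2 x k a := by
      have := hF.c2.comp (Continuous.prodMk_right x)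
      exact this.clm_apply cco
    have := integral_apply (h.int' c3) b
    simpa [IB] using this
lemma C2fam_shift (hv : CD v) (r : ℝ) :
    C2fam (fun x k => v (x + r • k)) (fun x k => fd v (x + r • k)) (fun x k => D2 v (x + r • k)) := by
  have h0 := hv.continuous
  have h1 := cont_F hv
  have h2 := cont_D2 hv
  have hs : ∀ x k : E n, HasFDerivAt (fun x : E n => x + r • k) (CLi ℝ (E n)) x :=
    fun x k => (hasFDerivAt_id x).add_const _
  refine ⟨by unfold uncurry; fun_prop, by unfold uncurry; fun_prop, by unfold uncurry; fun_prop, fun x k => ?_, fun x k => ?_⟩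
  · have := (hasF hv (x + r • k)).comp x (hs x k)
    rw [comp_id] at this; exact this
  · have := (hasFF hv (x + r • k)).comp x (hs x k)
    rw [comp_id] at this; exact this
def Av (ρ : Fu n) (r : ℝ) (v : Fu n) (x : E n) : ℝ := IB ρ (fun k => v (x + r • k))
lemma Av_cd (h : Ker ρ) (hv : CD v) (r : ℝ) : CD (Av ρ r v) :=
  (IB_C2 h (C2fam_shift hv r)).1
lemma Av_F (h : Ker ρ) (hv : CD v) (r : ℝ) (x a : E n) :
    fd (Av ρ r v) x a = IB ρ (fun k => fd v (x + r • k) a) :=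
  (IB_C2 h (C2fam_shift hv r)).2.1 x a
lemma Av_D2 (h : Ker ρ) (hv : CD v) (r : ℝ) (x a b : E n) :
    D2 (Av ρ r v) x a b = IB ρ (fun k => D2 v (x + r • k) a b) :=
  (IB_C2 h (C2fam_shift hv r)).2.2 x a b
lemma Av_tr (h : Ker ρ) (hv : CD v) (r : ℝ) (x : E n) (b : Fr n) :
    tr (D2 (Av ρ r v) x) b = IB ρ (fun k => tr (D2 v (x + r • k)) b) := by
  have h2 := cont_D2 hv
  simp only [tr, Av_D2 h hv]
  rw [IB_sum h]
  intro i; fun_prop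
lemma ibp (hχ : ContDiff ℝ 1 χ) (hc : HasCompactSupport χ) (hg : ContDiff ℝ 1 g) (a : E n) :
    ∫ x, χ x * fd g x a = - ∫ x, fd χ x a * g x := by
  have h1 := hχ.continuous_fderiv nnm
  have h2 := hg.continuous_fderiv nnm
  have h3 := hχ.continuous
  have h4 := hg.continuous
  apply integral_mul_fderiv_eq_neg_fderiv_mul_of_integrable
  · refine cIH fpr ?_
    exact (hc.fderiv_apply ℝ a).mul_right
  · refine cIH fpr hc.mul_right
  · refine cIH fpr hc.mul_right
  · exact fun x _ => hχ.differentiable nnm x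
  · exact fun x _ => hg.differentiable nnm x
def glu2 (x : ℝ) : ℝ := 2 * (x⁻¹ ^ 2 * expNegInvGlue x)
def W0 (k : E n) : ℝ := expNegInvGlue (1 - ‖k‖ ^ 2)
def om0 (k : E n) : ℝ := glu2 (1 - ‖k‖ ^ 2)
lemma glu_deriv (x : ℝ) : HasDerivAt expNegInvGlue (glu2 x / 2) x := by
  have := expNegInvGlue.hasDerivAt_polynomial_eval_inv_mul 1 x
  simp at this
  rw [glu2]; convert this using 1; ring
lemma glu2_cd : ContDiff ℝ (⊤ : ℕ∞) glu2 := by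
  have := expNegInvGlue.contDiff_polynomial_eval_inv_mul (n := (⊤:ℕ∞)) (Polynomial.X ^ 2)
  simp at this
  exact contDiff_const.mul (by simpa using this)
lemma glu2_nonneg (x : ℝ) : 0 ≤ glu2 x := by
  unfold glu2; have := expNegInvGlue.nonneg x; positivity
lemma om0_cd : ContDiff ℝ (⊤ : ℕ∞) (om0 : Fu n) :=
  glu2_cd.comp (contDiff_const.sub (contDiff_norm_sq ℝ))
lemma W0_cd : ContDiff ℝ (⊤ : ℕ∞) (W0 : Fu n) :=
  (expNegInvGlue.contDiff).comp (contDiff_const.sub (contDiff_norm_sq ℝ))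
lemma ker_W0 : Ker (W0 : Fu n) := by
  refine ⟨W0_cd.continuous, fun k => expNegInvGlue.nonneg _, fun k hk => ?_, fun k => by simp [W0]⟩
  apply expNegInvGlue.zero_of_nonpos; nlinarith
lemma ker_om0 : Ker (om0 : Fu n) := by
  refine ⟨om0_cd.continuous, fun k => glu2_nonneg _, fun k hk => ?_, fun k => by simp [om0]⟩
  rw [om0, glu2, expNegInvGlue.zero_of_nonpos (by nlinarith)]; simp
lemma W0_F (k a : E n) : fd W0 k a = - (om0 k * inr k a) := by
  have h : HasFDerivAt (fun k : E n => 1 - ‖k‖ ^ 2) (-((2:ℝ) • innerSL ℝ k)) k := (hasF_nsq k).const_sub 1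
  have := ((glu_deriv (1 - ‖k‖ ^ 2)).comp_hasFDerivAt k h).fderiv
  have h2 : (W0 : Fu n) = expNegInvGlue ∘ fun k => 1 - ‖k‖ ^ 2 := rfl
  rw [h2, this]
  simp [om0]
  ring
lemma W0_le (k : E n) : W0 k ≤ om0 k / 2 := by
  by_cases hk : ‖k‖ < 1
  · have h1 : 0 < 1 - ‖k‖ ^ 2 := by nlinarith [norm_nonneg k]
    have h2 : 1 - ‖k‖ ^ 2 ≤ 1 := by nlinarith [norm_nonneg k]
    have h3 : 1 ≤ (1 - ‖k‖ ^ 2)⁻¹ := (one_le_inv₀ h1).2 h2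
    have h4 := expNegInvGlue.nonneg (1 - ‖k‖ ^ 2)
    rw [W0, om0, glu2]
    nlinarith [mmr (olp h3 : 1 ≤ (1 - ‖k‖ ^ 2)⁻¹ ^ 2) h4]
  · rw [ker_W0.supp k (not_lt.1 hk), ker_om0.supp k (not_lt.1 hk)]; simp
lemma W0_int_pos : 0 < ∫ k : E n, W0 k := by
  refine (ker_W0.cont).integral_pos_of_hasCompactSupport_nonneg_nonzero ker_W0.compactSupp ker_W0.nonneg (x := 0) ?_
  have : 0 < W0 zE n := by rw [W0]; exact expNegInvGlue.pos_of_pos smp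
  exact this.ne'
lemma om0_int_pos : 0 < ∫ k : E n, om0 k := by
  have h1 : ∫ k : E n, W0 k ≤ ∫ k : E n, om0 k / 2 := by
    refine integral_mono ?_ ?_ W0_le
    · exact ker_W0.cont.integrable_of_hasCompactSupport ker_W0.compactSupp
    · exact (ker_om0.cont.integrable_of_hasCompactSupport ker_om0.compactSupp).div_const 2
  rw [integral_div] at h1
  have := W0_int_pos (n := n)
  linarith
lemma Ker.smul (h : Ker ρ) (hc : 0 ≤ c) : Ker (fun k => c * ρ k) :=
  ⟨continuous_const.mul h.cont, fun k => mul_nonneg hc (h.nonneg k), fun k hk => by rw [h.supp k hk, mul_zero],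
    fun k => by rw [h.even]⟩
lemma IB_smul (c : ℝ) (ρ g : Fu n) : IB (fun k => c * ρ k) g = c * IB ρ g := by
  simp only [IB]; rw [← integral_const_mul]; congr 1; ext k; ring
def om (k : E n) : ℝ := (∫ k : E n, om0 k)⁻¹ * om0 k
def Wm (k : E n) : ℝ := (∫ k : E n, om0 k)⁻¹ * W0 k
def Wn (k : E n) : ℝ := (∫ k : E n, W0 k)⁻¹ * W0 k
def cW (n : ℕ) : ℝ := (∫ k : E n, om0 k)⁻¹ * ∫ k : E n, W0 k
lemma ker_om : Ker (om : Fu n) := ker_om0.smul (inv_nonneg.2 om0_int_pos.le)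
lemma ker_Wm : Ker (Wm : Fu n) := ker_W0.smul (inv_nonneg.2 om0_int_pos.le)
lemma ker_Wn : Ker (Wn : Fu n) := ker_W0.smul (inv_nonneg.2 W0_int_pos.le)
lemma cW_pos (n : ℕ) : 0 < cW n := mul_pos (inv_pos.2 om0_int_pos) W0_int_pos
lemma om_cd : ContDiff ℝ (⊤ : ℕ∞) (om : Fu n) := contDiff_const.mul om0_cd
lemma om_one : IB (om : Fu n) (fun _ => 1) = 1 := by
  have h := IB_smul ((∫ k : E n, om0 k)⁻¹) (om0 : Fu n) (fun _ => 1)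
  have h2 : IB (om0 : Fu n) (fun _ => 1) = ∫ k : E n, om0 k := by simp [IB]
  rw [h2, imc om0_int_pos.ne'] at h
  exact h
lemma Wn_one : IB (Wn : Fu n) (fun _ => 1) = 1 := by
  have h := IB_smul ((∫ k : E n, W0 k)⁻¹) (W0 : Fu n) (fun _ => 1)
  have h2 : IB (W0 : Fu n) (fun _ => 1) = ∫ k : E n, W0 k := by simp [IB]
  rw [h2, imc W0_int_pos.ne'] at h
  exact h
lemma Wm_eq (k : E n) : Wm k = cW n * Wn k := by
  rw [Wm, cW, Wn, mul_assoc, ← mul_assoc (∫ k : E n, W0 k), mul_inv_cancel₀ W0_int_pos.ne', one_mul]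
lemma IB_Wm (g : Fu n) : IB Wm g = cW n * IB Wn g := by
  rw [← IB_smul]; simp only [IB, Wm_eq]
lemma Wm_le (k : E n) : Wm k ≤ om k / 2 := by
  rw [Wm, om, mul_div_assoc]
  exact mml (W0_le k) (inv_nonneg.2 om0_int_pos.le)
lemma IB_c (c : ℝ) : IB (om : Fu n) (fun _ => c) = c := by rw [IB_const, om_one, mul_one]
lemma IB_cn (c : ℝ) : IB (Wn : Fu n) (fun _ => c) = c := by rw [IB_const, Wn_one, mul_one]
lemma IB_Wm_le (hg : Continuous g) (h0 : ∀ k, ‖k‖ < 1 → 0 ≤ g k) : IB Wm g ≤ IB om g / 2 := by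
  rw [IB, IB, ← integral_div]
  refine integral_mono (ker_Wm.int hg) ((ker_om.int hg).div_const 2) fun k => ?_
  by_cases hk : ‖k‖ < 1
  · have := mmr (Wm_le k) (h0 k hk); simp only; linarith
  · simp [ker_Wm.supp k (not_lt.1 hk), ker_om.supp k (not_lt.1 hk)]
lemma Wm_cd : ContDiff ℝ (⊤ : ℕ∞) (Wm : Fu n) := contDiff_const.mul W0_cd
lemma Wm_F (k a : E n) : fd Wm k a = - (om k * inr k a) := by
  have h := ((W0_cd (n := n)).differentiable smp k).hasFDerivAt.const_mul ((∫ k : E n, om0 k)⁻¹)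
  have h2 : (Wm : Fu n) = fun k => (∫ k : E n, om0 k)⁻¹ * W0 k := rfl
  rw [h2, h.fderiv]
  simp [W0_F, om, mul_assoc]
lemma ibp_ker (hv : CD v) (x : E n) (r : ℝ) :
    IB om (fun k => fd v (x + r • k) k) = r * IB Wm (fun k => lap v (x + r • k)) := by
  have h2 := cont_F hv
  have h3 := cont_D2 hv
  have h1 : ∀ k : E n, fd v (x + r • k) k = ∑ i, inr k (ee i) * fd v (x + r • k) (ee i) := fun k => by
    have hk := congrArg (fd v (x + r • k)) (sum_ee k)
    rw [← hk]
    simp only [map_sum, map_smul, sem]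
    refine sum_congr rfl fun i _ => ?_
    congr 1
    rw [real_inner_comm]
    simp [ee, inner_single_left]
  simp only [h1]
  rw [IB_sum ker_om _ (fun i => fpr)]
  simp only [lap, tr]
  rw [IB_sum ker_Wm _ (fun i => fpr), mul_sum]
  refine sum_congr rfl fun i _ => ?_
  have hs : ∀ k : E n, HasFDerivAt (fun k : E n => x + r • k) (r • CLi ℝ (E n)) k :=
    fun k => ((hasFDerivAt_id k).const_smul r).const_add x
  have hd : ∀ k, HasFDerivAt (fun k => fd v (x + r • k) (ee i))
      ((ContinuousLinearMap.apply ℝ ℝ (ee i : E n)).comp ((D2 v (x + r • k)).comp (r • CLi ℝ (E n)))) k :=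
    fun k => (ContinuousLinearMap.apply ℝ ℝ (ee i : E n)).hasFDerivAt.comp k ((hasFF hv _).comp k (hs k))
  have hcd : ContDiff ℝ 1 (fun k => fd v (x + r • k) (ee i)) := by
    have := cd1 hv
    fun_prop
  have := ibp (Wm_cd.of_le smp) ker_Wm.compactSupp hcd (ee i)
  simp only [Wm_F, (hd _).fderiv] at this
  rw [IB, IB, ← integral_const_mul]
  calc _ = - ∫ k, -(om k * inr k (ee i)) * fd v (x + r • k) (ee i) := by
        rw [← integral_neg]; congr 1; ext k; ring
    _ = _ := by
        rw [← this]; congr 1; ext k; simp; ring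
lemma om_bdd : ∃ C : ℝ, 0 < C ∧ ∀ k : E n, om k ≤ C := by
  obtain ⟨C, hC⟩ := (ker_om (n := n)).cont.bounded_above_of_compact_support ker_om.compactSupp
  exact ⟨max C 1, by positivity, fun k => (le_abs_self _).trans ((hC k).trans (le_max_left _ _))⟩
structure Err (f : Fu n) (δ : ℝ) : Prop where
  cont : Continuous f
  int : Integrable (fun x => |f x - 1| ^ n)
  le : ∫ x, |f x - 1| ^ n ≤ δ ^ n
lemma young (hn : 0 < n) (ha : 0 < a) (ht : 0 ≤ t) : t ≤ a + (a⁻¹) ^ (n - 1) * t ^ n := by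
  rcases le_total t a with h | h
  · have : 0 ≤ (a⁻¹) ^ (n - 1) * t ^ n := pvt
    linarith
  · have h1 : t ^ n = t ^ (n - 1) * t := by rw [← pow_succ, Nat.sub_add_cancel hn]
    have h2 : 1 ≤ (a⁻¹ * t) ^ (n - 1) := olp (by rw [inv_mul_eq_div]; exact (one_le_div ha).2 h)
    rw [h1, ← mul_assoc, ← mul_pow]
    nlinarith
lemma avg_err : ∃ C : ℝ, 0 < C ∧ ∀ (f : Fu n) (δ : ℝ) (x : E n) (r : ℝ), 0 < n → Err f δ → 0 < δ → 0 < r →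
    IB om (fun k => |f (x + r • k) - 1|) ≤ C * δ / r := by
  obtain ⟨C, hC, hk⟩ := om_bdd (n := n)
  refine ⟨1 + C, by positivity, fun f δ x r hn hf hδ hr => ?_⟩
  have hfc := hf.cont
  have h1 : IB om (fun k => |f (x + r • k) - 1|) ≤ IB om (fun k => δ / r + ((δ / r)⁻¹) ^ (n - 1) * |f (x + r • k) - 1| ^ n) :=
    IB_mono ker_om fpr fpr fun k _ => young hn pvt (abs_nonneg _)
  rw [IB_add ker_om fpr fpr, IB_c, IB_mul] at h1
  have hi : Integrable (fun k => |f (x + r • k) - 1| ^ n) := by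
    have := (hf.int.comp_add_left x).comp_smul hr.ne'
    exact this
  have h2 : IB om (fun k => |f (x + r • k) - 1| ^ n) ≤ C * ((r ^ n)⁻¹ * δ ^ n) := by
    calc _ ≤ ∫ k, C * |f (x + r • k) - 1| ^ n := by
          refine integral_mono (ker_om.int fpr) (hi.const_mul C) fun k => ?_
          exact mmr (hk k) pvt
      _ = C * ((r ^ n)⁻¹ * ∫ y, |f y - 1| ^ n) := by
          rw [integral_const_mul]
          have := Measure.integral_comp_smul (μ := (volume : Measure (E n))) (fun y => |f (x + y) - 1| ^ n) r
          rw [this, integral_add_left_eq_self (fun y => |f y - 1| ^ n) x]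
          simp only [finrank_euclideanSpace, card_fin, sem, abs_inv, abs_pow, aop hr]
      _ ≤ _ := by gcongr; exact hf.le
  have h3 : ((δ / r)⁻¹) ^ (n - 1) * (C * ((r ^ n)⁻¹ * δ ^ n)) = C * (δ / r) := by
    have e1 : δ ^ n = δ ^ (n - 1) * δ := by rw [← pow_succ, Nat.sub_add_cancel hn]
    have e2 : r ^ n = r ^ (n - 1) * r := by rw [← pow_succ, Nat.sub_add_cancel hn]
    rw [e1, e2, inv_div, div_pow]; field_simp
  calc _ ≤ _ := h1
    _ ≤ δ / r + ((δ / r)⁻¹) ^ (n - 1) * (C * ((r ^ n)⁻¹ * δ ^ n)) := gcg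
    _ = _ := by rw [h3]; ring
lemma C2fam_of {F : E n → Fu n} (hF : CD F.uncurry) :
    C2fam F (fun x k => fd (fun x => F x k) x) (fun x k => D2 (fun x => F x k) x) := by
  have hk : ∀ k, CD (fun x => F x k) := fun k =>
    hF.comp (contDiff_id.prodMk contDiff_const)
  have h1 : ContDiff ℝ 1 (fun p : E n × E n => fd (fun x => F x p.2) p.1) := by
    apply ContDiff.fderiv (n := 1) (m := 2) (f := fun (p : E n × E n) x => F x p.2) (g := fun p => p.1)
    · exact hF.comp (f := fun q : (E n × E n) × E n => (q.2, q.1.2)) fpr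
    · fun_prop
    · norm_num
  have h2 : ContDiff ℝ 0 (fun p : E n × E n => fd (fun x => fd (fun x => F x p.2) x) p.1) := by
    apply ContDiff.fderiv (n := 0) (m := 1) (f := fun (p : E n × E n) x => fd (fun x => F x p.2) x) (g := fun p => p.1)
    · exact h1.comp (f := fun q : (E n × E n) × E n => (q.2, q.1.2)) fpr
    · fun_prop
    · norm_num
  exact ⟨hF.continuous, h1.continuous, h2.continuous, fun x k => hasF (hk k) x, fun x k => hasFF (hk k) x⟩
structure NData (c1 C0 δ : ℝ) (v f : Fu n) : Prop where
  cd : CD v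
  pos : ∀ x a, a ≠ 0 → 0 < D2 v x a a
  v0 : v 0 = 0
  nonneg : ∀ x, 0 ≤ v x
  sub : ∀ x, v x ≤ 1 → ‖x‖ ≤ C0
  sup : ∀ x y, v x ≤ 3/4 → ‖y - x‖ ≤ c1 → v y ≤ 1
  det : ∀ x, (mat (D2 v x)).det = f x ^ n
  fpos : ∀ x, 0 < f x
  err : Err f δ
lemma psd_of_pos (h : ∀ a, a ≠ 0 → 0 < Q a a) : Psd Q := fun a => by
  rcases eq_or_ne a 0 with rfl | ha
  · simp
  · exact (h a ha).le
lemma NData.psd (h : NData c1 C0 δ v f) (x : E n) : Psd (D2 v x) :=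
  psd_of_pos (h.pos x)
lemma supp_plane (hv : CD v) (hp : ∀ x, Psd (D2 v x)) (x y : E n) :
    v x + fd v x (y - x) ≤ v y :=
  grad_ineq hv convex_univ (fun z _ => hp z) (Set.mem_univ x) (Set.mem_univ y)
lemma lap_nonneg (hp : ∀ x, Psd (D2 v x)) (x : E n) : 0 ≤ lap v x := tr_nonneg (hp x) _
lemma cont_lap (hv : CD v) : Continuous (lap v) := by
  have := cont_D2 hv
  unfold lap tr
  fun_prop
lemma Av_ge (hρ : Ker ρ) (h1 : IB ρ (fun _ => 1) = 1) (hv : CD v) (hp : ∀ x, Psd (D2 v x)) (x : E n) (r : ℝ) :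
    v x ≤ Av ρ r v x := by
  have hc := hv.continuous
  have h2 : IB ρ (fun k => v x + fd v x (r • k)) ≤ Av ρ r v x :=
    IB_mono hρ fpr fpr fun k _ => by
      have := supp_plane hv hp x (x + r • k); simpa using this
  rw [IB_add hρ fpr fpr, IB_const, h1, IB_odd hρ (fun k => smp)] at h2
  linarith
lemma Av_step (hv : CD v) (hp : ∀ x, Psd (D2 v x)) (x : E n) (r R : ℝ) :
    (R - r) * (r * IB Wm (fun k => lap v (x + r • k))) ≤ Av om R v x - Av om r v x := by
  have hc := hv.continuous
  have hF := cont_F hv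
  have h2 : IB om (fun k => v (x + r • k) + (R - r) * fd v (x + r • k) k) ≤ Av om R v x :=
    IB_mono ker_om fpr fpr fun k _ => by
      have := supp_plane hv hp (x + r • k) (x + R • k)
      rw [show x + R • k - (x + r • k) = (R - r) • k by module] at this
      simpa using this
  rw [IB_add ker_om fpr fpr, IB_mul, ibp_ker hv] at h2
  have : IB om (fun k => v (x + r • k)) = Av om r v x := rfl
  linarith
lemma Av_mono (hv : CD v) (hp : ∀ x, Psd (D2 v x)) (x : E n) (hr : 0 ≤ r)
    (h : r ≤ R) : Av om r v x ≤ Av om R v x := by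
  have := Av_step hv hp x r R
  have h2 : 0 ≤ IB Wm (fun k => lap v (x + r • k)) := IB_nonneg ker_Wm fun k _ => lap_nonneg hp _
  have : 0 ≤ (R - r) * (r * IB Wm (fun k => lap v (x + r • k))) :=
    mul_nonneg lnr (mul_nonneg hr h2)
  linarith
lemma grad_bd (hv : CD v) (hp : ∀ x, Psd (D2 v x)) (hnn : ∀ x, 0 ≤ v x) (hr : 0 < r)
    (h : ∀ y, ‖y - x‖ ≤ r → v y ≤ M) : ‖fd v x‖ ≤ M / r := by
  rw [← gr_norm]
  by_cases h0 : gr v x = 0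
  · rw [h0, norm_zero]
    have := (hnn x).trans (h x (by simpa using hr.le)); positivity
  have hn0 : 0 < ‖gr v x‖ := norm_pos_iff.2 h0
  have h1 := supp_plane hv hp x (x + (r / ‖gr v x‖) • gr v x)
  have h2 := h (x + (r / ‖gr v x‖) • gr v x) (by
    rw [add_sub_cancel_left, norm_smul, norm_div, norm_norm, nnn hr.le, div_mul_cancel₀ _ hn0.ne'])
  rw [add_sub_cancel_left, map_smul, ← gr_inner, ris, sem] at h1
  have h3 := hnn x
  rw [ldi hr]
  have : r / ‖gr v x‖ * ‖gr v x‖ ^ 2 = r * ‖gr v x‖ := by field_simp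
  nlinarith
lemma det_rank1 (b : Fr n) (l : E n →L[ℝ] ℝ) (k : E n) :
    (frM (fun i => b i + l (b i) • k)).det = (frM b).det * (1 + l k) := by
  have h1 : frM (fun i => b i + l (b i) • k) = frM b * (1 + Matrix.vecMulVec (fun i => l (ee i)) (fun j => k j)) := by
    ext i j
    have h := congrArg l (sum_ee (b i))
    simp only [map_sum, map_smul, sem] at h
    rw [Matrix.mul_add, Matrix.mul_one]
    simp only [frM, Matrix.add_apply, of_apply, Matrix.mul_apply,
      Matrix.vecMulVec_apply, PiLp.add_apply, PiLp.smul_apply, sem]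
    rw [← h, sum_mul]
    congr 1
    refine sum_congr rfl fun m _ => rng
  rw [h1, det_mul, Matrix.vecMulVec_eq Unit, Matrix.det_one_add_replicateCol_mul_replicateRow]
  congr 2
  have h := congrArg l (sum_ee k)
  simp only [map_sum, map_smul, sem] at h
  rw [← h]; simp [dotProduct]
lemma dpow (hn : 3 ≤ n) {s : ℝ} (hs : |s| ≤ 1/2) :
    (0 ≤ 1 + 2 / n * s - 4 / n * s ^ 2) ∧ (1 + 2 / n * s - 4 / n * s ^ 2) ^ n ≤ (1 + s) ^ 2 ∧
    1 + 2 / n * s - 4 / n * s ^ 2 ≤ 2 := by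
  have hn' : (3:ℝ) ≤ n := by exact_mod_cast hn
  obtain ⟨h1, h2⟩ := abs_le.1 hs
  have e : 1 + 2 / n * s - 4 / n * s ^ 2 = 1 + (2 * s - 4 * s ^ 2) / n := rng
  have hd : 0 ≤ 1 + 2 / n * s - 4 / n * s ^ 2 := by
    rw [e]
    have : -1 ≤ (2 * s - 4 * s ^ 2) / n := by rw [ldi lnr]; nlinarith
    linarith
  refine ⟨hd, ?_, ?_⟩
  · have h3 : 1 + 2 / n * s - 4 / n * s ^ 2 ≤ exp ((2 * s - 4 * s ^ 2) / n) := by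
      rw [e]; have := add_one_le_exp ((2 * s - 4 * s ^ 2) / n); linarith
    refine (ppl hd h3 n).trans ?_
    rw [← exp_nat_mul, mul_div_cancel₀ _ (by linarith : (n:ℝ) ≠ 0)]
    have h4 : exp (s - 2 * s ^ 2) ≤ 1 + s := by
      rw [← Real.le_log_iff_exp_le lnr]
      have := Real.one_sub_inv_le_log_of_pos (show 0 < 1 + s by linarith)
      refine le_trans ?_ this
      have : 1 - (1 + s)⁻¹ = s / (1 + s) := by field_simp [(by linarith : (1 + s) ≠ 0)]; ring
      rw [this, ldi lnr]
      nlinarith [sq_nonneg s]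
    have h5 : exp (2 * s - 4 * s ^ 2) = exp (s - 2 * s ^ 2) ^ 2 := by
      rw [← exp_nat_mul]; congr 1; push_cast; ring
    rw [h5]
    exact ppl (exp_pos _).le h4 2
  · rw [e]
    have : (2 * s - 4 * s ^ 2) / n ≤ 1 := by rw [dli lnr]; nlinarith
    linarith
def zt (C0 : ℝ) (v : Fu n) (x : E n) : ℝ := 1/2 - v x + 1 / (4 * C0 ^ 2) * ‖x‖ ^ 2
def GG (κ C0 : ℝ) (v : Fu n) (x : E n) : ℝ := Av om (κ * zt C0 v x) v x - v x
lemma zt_cd (C0 : ℝ) (hv : CD v) : CD (zt C0 v) :=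
  (contDiff_const.sub hv).add (contDiff_const.mul cd_nsq)
lemma zt_D2 (C0 : ℝ) (hv : CD v) (x a b : E n) :
    D2 (zt C0 v) x a b = - D2 v x a b + 1 / (2 * C0 ^ 2) * inr a b := by
  have : zt C0 v = fun x => (1/2 - v x) + 1 / (4 * C0 ^ 2) * ‖x‖ ^ 2 := rfl
  rw [this, D2_add (contDiff_const.sub hv) (contDiff_const.mul cd_nsq), D2_sub contDiff_const hv, D2_const, D2_smul cd_nsq]
  simp [D2_nsq]; ring
lemma zt_F (C0 : ℝ) (hv : CD v) (x a : E n) :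
    fd (zt C0 v) x a = - fd v x a + 1 / (2 * C0 ^ 2) * inr x a := by
  have : HasFDerivAt (zt C0 v) (-fd v x + (1 / (4 * C0 ^ 2)) • ((2:ℝ) • innerSL ℝ x)) x :=
    ((hasF hv x).const_sub (1/2)).add ((hasF_nsq x).const_mul _)
  rw [this.fderiv]; simp; ring
lemma GG_cd (κ C0 : ℝ) (hv : CD v) : CD (GG κ C0 v) ∧
    ∀ x a, D2 (GG κ C0 v) x a a = IB om (fun k => D2 v (x + (κ * zt C0 v x) • k)
      (a + (κ * fd (zt C0 v) x a) • k) (a + (κ * fd (zt C0 v) x a) • k) +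
      (κ * D2 (zt C0 v) x a a) * fd v (x + (κ * zt C0 v x) • k) k) - D2 v x a a := by
  have hz := zt_cd C0 hv
  have hF : CD (uncurry fun x k : E n => v (x + (κ * zt C0 v x) • k)) := by
    refine hv.comp (f := fun p : E n × E n => p.1 + (κ * zt C0 v p.1) • p.2) ?_
    exact contDiff_fst.add ((contDiff_const.mul (hz.comp contDiff_fst)).smul contDiff_snd)
  have h := IB_C2 (ker_om (n := n)) (C2fam_of hF)
  refine ⟨h.1.sub hv, fun x a => ?_⟩
  have e : GG κ C0 v = fun x => IB om (fun k => v (x + (κ * zt C0 v x) • k)) - v x := rfl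
  rw [e, D2_sub h.1 hv, sba, sba, h.2.2]
  congr 2
  ext k
  have hφ : CD (fun x => x + (κ * zt C0 v x) • k) :=
    contDiff_id.add ((contDiff_const.mul hz).smul contDiff_const)
  have h1 : ∀ y, HasFDerivAt (fun x => x + (κ * zt C0 v x) • k)
      (CLi ℝ (E n) + (κ • fd (zt C0 v) y).smulRight k) y := fun y =>
    (hasFDerivAt_id y).add (((hasF hz y).const_mul κ).smul_const k)
  have h2 : fd (fun x => x + (κ * zt C0 v x) • k) = fun y =>
      (CLi ℝ (E n) + (κ • fd (zt C0 v) y).smulRight k) := funext fun y => (h1 y).fderiv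
  have h3 : HasFDerivAt (fd (fun x => x + (κ * zt C0 v x) • k))
      ((smulRightL ℝ (E n) (E n)).flip k ∘L (κ • D2 (zt C0 v) x)) x := by
    rw [h2]
    have := ((smulRightL ℝ (E n) (E n)).flip k).hasFDerivAt.comp x ((hasFF hz x).const_smul κ)
    exact this.const_add _
  rw [D2_comp hv hφ, h3.fderiv, h2]
  simp [mul_assoc]
structure P3c (n : ℕ) (c1 C0 κ C2 c3 : ℝ) : Prop where
  hc1 : 0 < c1
  hc1' : c1 ≤ 1
  hC0 : 1 ≤ C0
  hκ : 0 < κ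
  hk1 : κ ≤ c1 / 2
  hk2 : κ * (3 / c1) ≤ 1/2
  hk3 : n ^ 2 * (κ * (3 / c1)) ^ 2 ≤ 1/4
  hk4 : n * κ ^ 2 ≤ c3 / 2
  hc3 : 0 < c3
  hC2 : 8 * (3 / c1) ^ 2 ≤ C2
  hC2' : 4 * n ≤ C2 * c3
  h3 : ∀ (Q : BL n) (b : Fr n), Sym Q → Psd Q → UF b → (1 / (2 * C0 ^ 2)) * ∑ i, ‖b i‖ ^ 2 ≤ 1 + 2 * n →
    4 * c3 * tr Q ee ≤ tr Q b
section
variable {c1 C0 κ C2 c3 δ : ℝ} {v f : Fu n} {x : E n}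
lemma p3_le (hp : P3c n c1 C0 κ C2 c3) (hN : NData c1 C0 δ v f) (hx : v x ≤ 1) (hz : 0 ≤ zt C0 v x) :
    v x ≤ 3/4 ∧ zt C0 v x ≤ 3/4 := by
  have h1 := hN.sub x hx
  have h0 := hN.nonneg x
  have hC := hp.hC0
  have : 1 / (4 * C0 ^ 2) * ‖x‖ ^ 2 ≤ 1/4 := by
    rw [dmm, dli pvt]
    nlinarith [norm_nonneg x, ppl (norm_nonneg x) h1 2]
  unfold zt at *
  constructor <;> linarith
lemma p3_g (hp : P3c n c1 C0 κ C2 c3) (hN : NData c1 C0 δ v f) (hx : v x ≤ 3/4) {y : E n} (hy : ‖y - x‖ ≤ c1 / 2) :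
    ‖fd v y‖ ≤ 2 / c1 := by
  have h := grad_bd hN.cd hN.psd hN.nonneg (x := y) (r := c1 / 2) (M := 1) (by linarith [hp.hc1]) (fun z hz =>
    hN.sup x z hx (by
      have : z - x = (z - y) + (y - x) := by abel
      rw [this]; exact (norm_add_le _ _).trans lnr))
  refine h.trans (le_of_eq ?_)
  rw [one_div_div]
lemma p3_Z (hp : P3c n c1 C0 κ C2 c3) (hN : NData c1 C0 δ v f) (hx : v x ≤ 3/4) (a : E n) :
    |fd (zt C0 v) x a| ≤ 3 / c1 * ‖a‖ := by
  have h1 := p3_g hp hN hx (y := x) (by simpa using by linarith [hp.hc1])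
  have hC := hp.hC0
  have hc := hp.hc1
  rw [zt_F _ hN.cd]
  have h2 : |fd v x a| ≤ 2 / c1 * ‖a‖ := ((fd v x).le_opNorm a).trans gcg
  have h3 := abs_real_inner_le_norm x a
  have h4 := hN.sub x lnr
  have h5 : |1 / (2 * C0 ^ 2) * inr x a| ≤ 1 / c1 * ‖a‖ := by
    rw [abs_mul, aop pvt]
    calc 1 / (2 * C0 ^ 2) * |inr x a| ≤ 1 / (2 * C0 ^ 2) * (C0 * ‖a‖) := by gcongr; exact h3.trans gcg
      _ = 1 / (2 * C0) * ‖a‖ := by field_simp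
      _ ≤ _ := by
        gcongr
        linarith [hp.hc1']
  have e : 3 / c1 = 2 / c1 + 1 / c1 := rng
  rw [e, add_mul]
  refine (abs_add_le _ _).trans ?_
  rw [abs_neg]; linarith
lemma p3_G (hp : P3c n c1 C0 κ C2 c3) (hN : NData c1 C0 δ v f) (hx : v x ≤ 1) (hz : 0 ≤ zt C0 v x) :
    0 ≤ GG κ C0 v x ∧
    GG κ C0 v x ≤ zt C0 v x * (κ * IB om (fun k => fd v (x + (κ * zt C0 v x) • k) k)) ∧
    κ * IB om (fun k => fd v (x + (κ * zt C0 v x) • k) k) ≤ κ * (2 / c1) ∧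
    κ * IB om (fun k => fd v (x + (κ * zt C0 v x) • k) k) ≤ κ ^ 2 / 2 * IB om (fun k => lap v (x + (κ * zt C0 v x) • k)) := by
  obtain ⟨h1, h2⟩ := p3_le hp hN hx hz
  have hκ := hp.hκ
  have hF := cont_F hN.cd
  have hc := hN.cd.continuous
  have hl := cont_lap hN.cd
  have hcc := hp.hc1
  refine ⟨?_, ?_, ?_, ?_⟩
  · have := Av_ge ker_om om_one hN.cd hN.psd x (κ * zt C0 v x)
    unfold GG; linarith
  · have h2 : Av om (κ * zt C0 v x) v x ≤ IB om (fun k => v x + (κ * zt C0 v x) * fd v (x + (κ * zt C0 v x) • k) k) :=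
      IB_mono ker_om fpr fpr fun k _ => by
        have := supp_plane hN.cd hN.psd (x + (κ * zt C0 v x) • k) x
        simp at this
        simp; linarith
    rw [IB_add ker_om fpr fpr, IB_c, IB_mul] at h2
    unfold GG
    nlinarith
  · refine mml ?_ hκ.le
    have : IB om (fun k => fd v (x + (κ * zt C0 v x) • k) k) ≤ IB om (fun k : E n => 2 / c1) := by
      refine IB_mono ker_om fpr fpr fun k hk => ?_
      have h3 := p3_g hp hN h1 (y := x + (κ * zt C0 v x) • k) (by
        rw [add_sub_cancel_left, norm_smul, nnn pvt]
        have := hp.hk1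
        have : κ * zt C0 v x * ‖k‖ ≤ κ * 1 * 1 := by gcongr; linarith
        linarith)
      refine (le_abs_self _).trans (((fd v _).le_opNorm k).trans ?_)
      have : 0 < 2 / c1 := pvt
      nlinarith [norm_nonneg k, norm_nonneg (fd v (x + (κ * zt C0 v x) • k))]
    rwa [IB_c] at this
  · rw [ibp_ker hN.cd]
    have h3 := IB_Wm_le (g := fun k => lap v (x + (κ * zt C0 v x) • k)) fpr (fun k _ => lap_nonneg hN.psd _)
    have h4 : 0 ≤ IB Wm (fun k => lap v (x + (κ * zt C0 v x) • k)) := IB_nonneg ker_Wm (fun k _ => lap_nonneg hN.psd _)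
    calc _ = κ ^ 2 * zt C0 v x * IB Wm (fun k => lap v (x + (κ * zt C0 v x) • k)) := rng
      _ ≤ κ ^ 2 * 1 * IB Wm (fun k => lap v (x + (κ * zt C0 v x) • k)) := by gcongr; linarith
      _ ≤ _ := by nlinarith [sq_nonneg κ]
lemma p3_I1 (hn : 3 ≤ n) (hp : P3c n c1 C0 κ C2 c3) (hN : NData c1 C0 δ v f) (hx : v x ≤ 3/4) (hb : UF b)
    (y k : E n) (hk : ‖k‖ < 1) :
    n * f y * (1 + 2 / n * (κ * fd (zt C0 v) x k) - 4 / n * (κ * fd (zt C0 v) x k) ^ 2) ≤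
      ∑ i, D2 v y (b i + (κ * fd (zt C0 v) x (b i)) • k) (b i + (κ * fd (zt C0 v) x (b i)) • k) ∧
    |κ * fd (zt C0 v) x k| ≤ κ * (3 / c1) := by
  have h1 := p3_Z hp hN hx k
  have hκ := hp.hκ
  have hcc := hp.hc1
  have hs : |κ * fd (zt C0 v) x k| ≤ κ * (3 / c1) := by
    rw [abs_mul, aop hκ]
    gcongr
    refine h1.trans ?_
    have : 0 < 3 / c1 := pvt
    nlinarith
  refine ⟨?_, hs⟩
  have hd := dpow hn (hs.trans hp.hk2)
  have := amgm_gen omg (D2_symm hN.cd y) (hN.psd y) (fun i => b i + ((κ • fd (zt C0 v) x) (b i)) • k)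
    (g := f y) (mul_nonneg hd.1 (hN.fpos y).le) (by
      rw [det_rank1, mul_pow (frM b).det, show (frM b).det ^ 2 = 1 from hb, one_mul]
      exact hd.2.1) (hN.det y).symm
  simp only [tr, sma, sem] at this
  refine le_trans (le_of_eq ?_) this
  ring
lemma p3_I2 (hp : P3c n c1 C0 κ C2 c3) (hN : NData c1 C0 δ v f) (hx : v x ≤ 3/4) (hb : UF b)
    (hbb : (1 / (2 * C0 ^ 2)) * ∑ i, ‖b i‖ ^ 2 ≤ 1 + 2 * n) (y k : E n) (hk : ‖k‖ < 1) :
    c3 * lap v y ≤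
      ∑ i, D2 v y (b i + (κ * fd (zt C0 v) x (b i)) • k) (b i + (κ * fd (zt C0 v) x (b i)) • k) := by
  have hκ := hp.hκ
  have hcc := hp.hc1
  set A : E n →L[ℝ] E n := CLi ℝ (E n) + (κ • fd (zt C0 v) x).smulRight k with hA
  have hAa : ∀ a, A a = a + (κ * fd (zt C0 v) x a) • k := fun a => by simp [hA]
  set Q' : BL n := ((ContinuousLinearMap.compL ℝ (E n) (E n) ℝ).flip A) ∘L (D2 v y ∘L A) with hQ
  have hQ' : ∀ a c, Q' a c = D2 v y (A a) (A c) := fun a c => by simp [hQ]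
  have h1 := hp.h3 Q' b (fun a c => by rw [hQ', hQ', D2_symm hN.cd]) (fun a => by rw [hQ']; exact hN.psd y _) hb hbb
  have h2 : tr Q' b = ∑ i, D2 v y (b i + (κ * fd (zt C0 v) x (b i)) • k) (b i + (κ * fd (zt C0 v) x (b i)) • k) := by
    simp only [tr, hQ', hAa]
  rw [← h2]
  refine le_trans ?_ h1
  have h3 : lap v y / 4 ≤ tr Q' ee := by
    have h4 : ∀ i, D2 v y (ee i) (ee i) / 2 - (κ * (3 / c1)) ^ 2 * (n * lap v y) ≤ Q' (ee i) (ee i) := by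
      intro i
      rw [hQ', hAa]
      set s := κ * fd (zt C0 v) x (ee i) with hs
      have h5 : |s| ≤ κ * (3 / c1) := by
        rw [hs, abs_mul, aop hκ]; gcongr
        have := p3_Z hp hN hx (ee i)
        simpa [ee] using this
      have h6 := hN.psd y (ee i + (2 * s) • k)
      have h7 : D2 v y k k ≤ n * lap v y := by
        refine (psd_le_tr (D2_symm hN.cd y) (hN.psd y) k).trans ?_
        have : 0 ≤ n * lap v y := by have := lap_nonneg hN.psd y; positivity
        change n * lap v y * ‖k‖ ^ 2 ≤ _
        have : ‖k‖ ^ 2 ≤ 1 := by nlinarith [norm_nonneg k]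
        nlinarith
      have h8 : s ^ 2 ≤ (κ * (3 / c1)) ^ 2 := sq_le_sq' (by linarith [(abs_le.1 h5).1]) (abs_le.1 h5).2
      have h9 := hN.psd y k
      simp only [map_add, map_smul, _root_.add_apply, sma, sem, D2_symm hN.cd y k (ee i)] at h6 ⊢
      have : s ^ 2 * D2 v y k k ≤ (κ * (3 / c1)) ^ 2 * (n * lap v y) := gcg
      nlinarith
    have h5 := sum_le_sum fun i (_ : i ∈ Finset.univ) => h4 i
    rw [sum_sub_distrib, ← sum_div] at h5
    change lap v y / 2 - _ ≤ tr Q' ee at h5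
    simp only [sum_const, card_univ, card_fin, nsmul_eq_mul] at h5
    have h6 := hp.hk3
    have := lap_nonneg hN.psd y
    nlinarith
  have := hp.hc3
  nlinarith
end
section
variable {c1 C0 κ C2 c3 δ : ℝ} {v f : Fu n} {x : E n}
lemma p3_scalar {G z : ℝ} (hm : 0 < m) (hz : 0 < z) (hz1 : z ≤ 1) (hG : 0 ≤ G) (hw : 0 < G ^ 2 - m ^ 2 * z)
    (h : G ≤ z * d1) : 0 < G ∧ m ≤ d1 ∧ 0 ≤ m ^ 2 / (2 * G) ∧ m ^ 2 / (2 * G) ≤ d1 / 2 := by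
  have hG0 : 0 < G := by
    rcases hG.eq_or_lt with h | h
    · rw [← h] at hw; have : 0 < m ^ 2 * z := pvt
      nlinarith
    · exact h
  have h1 : m ^ 2 * z ≤ (z * d1) ^ 2 := by nlinarith
  have hd : 0 < d1 := by by_contra hc; push Not at hc; nlinarith
  have h2 : m ^ 2 ≤ z * d1 ^ 2 := by
    have : z * m ^ 2 ≤ z * (z * d1 ^ 2) := by nlinarith
    exact le_of_mul_le_mul_left this hz
  have h3 : m ^ 2 ≤ d1 ^ 2 := by nlinarith [sq_nonneg d1]
  refine ⟨hG0, (sq_le_sq₀ hm.le hd.le).1 h3, by positivity, ?_⟩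
  rw [dli pvt]
  have : m ^ 2 * z ≤ G * (d1 * z) := by nlinarith
  have := le_of_mul_le_mul_right (show m ^ 2 * z ≤ G * d1 * z by linarith) hz
  linarith
lemma scA {f B S : ℝ} (hN : 3 ≤ N) (hf : 2 < f) (hI : 0 ≤ I1) (hd : 0 ≤ d3) (hd1 : d3 ≤ 1) (hB : 0 ≤ N * B)
    (hL : Lz = -(N * f) + S) (hS : 0 ≤ S) : -(4 * N * |f - 1| + 2 * N * B) ≤ I1 - N * f + d3 * Lz := by
  rw [aop lnr]
  have h0 : 0 ≤ N * f := pvt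
  have : -(N * f) ≤ d3 * Lz := by
    have := mml (show -(N * f) ≤ Lz by linarith) hd
    nlinarith
  nlinarith
lemma scB {z G : ℝ} (hz : 0 < z) (hκ : 0 < κ) (hc : 0 < c) (hm : m = C2 * κ ^ 2) (hw : 0 < G ^ 2 - m ^ 2 * z) (hG : 0 < G)
    (h1 : G ≤ z * d1) (h2 : d1 ≤ κ * (2 / c)) : (C2 * κ * c / 2) ^ 2 ≤ z := by
  have h3 : G ≤ z * (κ * (2 / c)) := h1.trans gcg
  have h4 : G ^ 2 ≤ (z * (κ * (2 / c))) ^ 2 := gcg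
  have q2 : m ^ 2 ≤ z * (κ * (2 / c)) ^ 2 := by
    refine le_of_mul_le_mul_right (a := z) ?_ hz
    nlinarith
  have q3 : m = (C2 * κ * c / 2) * (κ * (2 / c)) := by rw [hm]; field_simp
  rw [q3, mul_pow] at q2
  exact le_of_mul_le_mul_right q2 pvt
lemma scB2 {f B : ℝ} (hN : 0 ≤ N) (h3 : N + 2 * 0 - (A + 2 * N * T) ≤ I1) (hT : T ≤ B)
    (hA : A ≤ m / 2) (hm : m ≤ d1) (hd : d1 / 2 ≤ d3) (hL : 1 ≤ Lz) (hm0 : 0 < m) :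
    -(4 * N * |f - 1| + 2 * N * B) ≤ I1 - N * f + d3 * Lz := by
  have h8 := le_abs_self (f - 1)
  have h9 : m / 2 ≤ d3 * Lz := by nlinarith
  have h10 := mml hT hN
  have h11 : N * (f - 1) ≤ N * |f - 1| := gcg
  have : 0 ≤ N * |f - 1| := pvt
  linarith
lemma scC {f B S : ℝ} (hN : 3 ≤ N) (hf : f ≤ 2) (hB : 0 ≤ N * B) (hc3 : 0 < c3) (h3 : c3 * L ≤ I1)
    (hm : m = C2 * κ ^ 2) (hκ : 0 < κ) (hd : d1 / 2 ≤ d3) (hd' : d3 ≤ d1) (hm1 : m ≤ d1) (hm0 : 0 < m) (hd1 : d1 ≤ κ ^ 2 / 2 * L)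
    (hL : Lz = -(N * f) + S) (hS : 0 ≤ S) (k4 : N * κ ^ 2 ≤ c3 / 2) (k5 : 4 * N ≤ C2 * c3) :
    -(4 * N * |f - 1| + 2 * N * B) ≤ I1 - N * f + d3 * Lz := by
  have h4 : 2 * C2 ≤ L := by
    have : κ ^ 2 * C2 ≤ κ ^ 2 * (L / 2) := lnr
    have := le_of_mul_le_mul_left this pvt
    linarith
  have hNf : N * f ≤ 2 * N := by nlinarith
  have hLp : 0 ≤ L := by
    have : 0 < κ ^ 2 / 2 * L := lnr
    exact (pos_of_mul_pos_right this pvt).le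
  have h5 : -(N * κ ^ 2 * L) ≤ d3 * Lz := by
    have h0 : 0 ≤ d3 := lnr
    have a1 : d3 * -(2 * N) ≤ d3 * Lz := mml lnr h0
    have a2 : N * d3 ≤ N * (κ ^ 2 / 2 * L) := mml lnr lnr
    linarith
  have h8 : N * κ ^ 2 * L ≤ c3 / 2 * L := mmr k4 hLp
  have h9 : c3 / 2 * (2 * C2) ≤ c3 / 2 * L := mml h4 lnr
  have h10 : 0 ≤ N * |f - 1| := pvt
  linarith
lemma p3_pt (hn : 3 ≤ n) (hp : P3c n c1 C0 κ C2 c3) (hN : NData c1 C0 δ v f) (hδ : 0 < δ) (hCe : 0 < Ce)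
    (he : ∀ (f : Fu n) (δ : ℝ) (x : E n) (r : ℝ), 0 < n → Err f δ → 0 < δ → 0 < r →
    IB om (fun k => |f (x + r • k) - 1|) ≤ Ce * δ / r)
    (hx : v x ≤ 1) (hz : 0 ≤ zt C0 v x) (hw : 0 < GG κ C0 v x ^ 2 - (C2 * κ ^ 2) ^ 2 * zt C0 v x) :
    ∃ b, UF b ∧ -(8 * n * |f x - 1| + 4 * n * Ce / (κ * (C2 * κ * c1 / 2) ^ 2) * δ) ≤
      tr (D2 (fun x => GG κ C0 v x ^ 2 - (C2 * κ ^ 2) ^ 2 * zt C0 v x) x) b := by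
  obtain ⟨h1, h2⟩ := p3_le hp hN hx hz
  have hκ := hp.hκ
  have hF := cont_F hN.cd
  have hc := hN.cd.continuous
  have hl := cont_lap hN.cd
  have hD := cont_D2 hN.cd
  have hfc := hN.err.cont
  have hcc := hp.hc1
  have hc3 := hp.hc3
  have hn' : (3:ℝ) ≤ n := by exact_mod_cast hn
  obtain ⟨g0, g1, g2, g3⟩ := p3_G hp hN hx hz
  have hC2 : 0 < C2 := lt_of_lt_of_le pvt hp.hC2
  obtain ⟨hGcd, hGD⟩ := GG_cd κ C0 hN.cd
  have hzc := zt_cd C0 hN.cd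
  obtain ⟨b, hb, hbb⟩ := frame (D2_symm hN.cd x) (hN.pos x) (hN.fpos x) (hN.det x)
  refine ⟨b, hb, ?_⟩
  set G := GG κ C0 v x with hGdef
  set z := zt C0 v x with hzdef
  set m := C2 * κ ^ 2 with hm
  set d1 := κ * IB om (fun k => fd v (x + (κ * z) • k) k) with hd1
  have hz0 : 0 < z := by
    rcases hz.eq_or_lt with h | h
    · have : G ≤ 0 := by rw [← h] at g1; linarith
      have : G = 0 := le_antisymm this g0
      rw [this, ← h] at hw; simp at hw
    · exact h
  obtain ⟨s1, s2, s3, s4⟩ := p3_scalar pvt hz0 lnr g0 hw g1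
  set I1 := IB om (fun k => ∑ i, D2 v (x + (κ * z) • k) (b i + (κ * fd (zt C0 v) x (b i)) • k)
    (b i + (κ * fd (zt C0 v) x (b i)) • k)) with hI1
  set Lz := tr (D2 (zt C0 v) x) b with hLz
  have hLz' : Lz = - (n * f x) + 1 / (2 * C0 ^ 2) * ∑ i, ‖b i‖ ^ 2 := by
    rw [hLz, tr]
    simp only [zt_D2 C0 hN.cd, sum_add_distrib, sum_neg_distrib, ← mul_sum, ris]
    have := tr_frame hbb
    rw [tr] at this; rw [this]
  have hGt : tr (D2 (GG κ C0 v) x) b = I1 + d1 * Lz - n * f x := by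
    rw [← tr_frame hbb, hLz]
    simp only [tr, hGD, sum_sub_distrib]
    congr 1
    rw [← IB_sum ker_om _ (fun i => fpr)]
    simp only [sum_add_distrib]
    rw [IB_add ker_om fpr fpr]
    congr 1
    simp only [← sum_mul, ← mul_sum]
    rw [IB_mul, hd1]; ring
  have hmain : 2 * G * (I1 - n * f x + (d1 - m ^ 2 / (2 * G)) * Lz) ≤
      tr (D2 (fun x => GG κ C0 v x ^ 2 - (C2 * κ ^ 2) ^ 2 * zt C0 v x) x) b := by
    have e1 : ∀ a, D2 (fun x => GG κ C0 v x ^ 2 - (C2 * κ ^ 2) ^ 2 * zt C0 v x) x a a =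
        2 * (fd (GG κ C0 v) x a * fd (GG κ C0 v) x a) + 2 * G * D2 (GG κ C0 v) x a a - m ^ 2 * D2 (zt C0 v) x a a := by
      intro a
      rw [D2_sub (hGcd.pow 2) (contDiff_const.mul hzc), D2_smul hzc]
      rw [sba, sba, D2_gcomp hGcd (g := fun t => t ^ 2) (g' := fun t => 2 * t) (g'' := fun t => 2)
        (fun t => by simpa using hasDerivAt_pow 2 t) (fun t => by simpa using (hasDerivAt_id t).const_mul 2)]
      simp [hGdef, hm]
    have e2 : 2 * G * tr (D2 (GG κ C0 v) x) b - m ^ 2 * Lz ≤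
        tr (D2 (fun x => GG κ C0 v x ^ 2 - (C2 * κ ^ 2) ^ 2 * zt C0 v x) x) b := by
      rw [hLz]
      simp only [tr, e1, mul_sum]
      rw [← sum_sub_distrib]
      refine sum_le_sum fun i _ => ?_
      linarith [mul_self_nonneg (fd (GG κ C0 v) x (b i))]
    refine le_trans (le_of_eq ?_) e2
    rw [hGt]; field_simp; ring
  refine le_trans ?_ hmain
  have hd1' : d1 ≤ 1 := by
    refine g2.trans ?_
    have := hp.hk2
    have e : κ * (3 / c1) = κ * (2 / c1) * (3/2) := rng
    rw [e] at this
    linarith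
  have hG1 : G ≤ 1 := by linarith [mml hd1' hz0.le]
  set d3 := d1 - m ^ 2 / (2 * G) with hd3
  have hd3a : d1 / 2 ≤ d3 := lnr
  have hd3b : d3 ≤ d1 := lnr
  have hmp : 0 < m := pvt
  have hS : 0 ≤ 1 / (2 * C0 ^ 2) * ∑ i, ‖b i‖ ^ 2 := pvt
  have hfp := hN.fpos x
  have hI1n : 0 ≤ I1 := IB_nonneg ker_om fun k _ => sum_nonneg fun i _ => hN.psd _ _
  have hBpos : 0 < Ce / (κ * (C2 * κ * c1 / 2) ^ 2) * δ := pvt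
  have eB : 4 * n * Ce / (κ * (C2 * κ * c1 / 2) ^ 2) * δ = 4 * (n * (Ce / (κ * (C2 * κ * c1 / 2) ^ 2) * δ)) := rng
  rw [eB]
  set B := Ce / (κ * (C2 * κ * c1 / 2) ^ 2) * δ with hB
  suffices hs : -(4 * n * |f x - 1| + 2 * n * B) ≤ I1 - n * f x + d3 * Lz by
    have h0 : 0 ≤ 4 * n * |f x - 1| + 2 * n * B := pvt
    have q1 := mml hs (show 0 ≤ 2 * G by linarith)
    have q2 := mlol h0 hG1
    linarith
  have hnB : 0 ≤ n * B := pvt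
  have hna : 0 ≤ n * |f x - 1| := pvt
  by_cases hf2 : 2 < f x
  · exact scA hn' hf2 hI1n lnr lnr hnB hLz' hS
  push Not at hf2
  by_cases hL : 1 ≤ Lz
  · have h3 : IB om (fun k => n + 2 * (κ * fd (zt C0 v) x k) - (4 * (κ * (3 / c1)) ^ 2 + 2 * n * |f (x + (κ * z) • k) - 1|)) ≤ I1 := by
      refine IB_mono ker_om fpr fpr fun k hk => ?_
      obtain ⟨i1, i2⟩ := p3_I1 hn hp hN h1 hb (x + (κ * z) • k) k hk
      refine le_trans ?_ i1
      have hd := dpow hn (i2.trans hp.hk2)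
      set s := κ * fd (zt C0 v) x k with hs
      have i3 : s ^ 2 ≤ (κ * (3 / c1)) ^ 2 := sq_le_sq' (by linarith [(abs_le.1 i2).1]) (abs_le.1 i2).2
      set d := 1 + 2 / n * s - 4 / n * s ^ 2 with hdd
      have e1 : n + 2 * s - 4 * s ^ 2 = n * d := by rw [hdd]; field_simp
      set fy := f (x + (κ * z) • k)
      have i4 : -(2 * |fy - 1|) ≤ (fy - 1) * d := by
        have q1 : |(fy - 1) * d| ≤ |fy - 1| * 2 := by
          rw [abs_mul, abs_of_nonneg hd.1]; exact mml hd.2.2 (abs_nonneg _)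
        have := neg_abs_le ((fy - 1) * d)
        linarith
      have i5 : n * fy * d = n * d + n * ((fy - 1) * d) := rng
      rw [i5, ← e1]
      have i6 := mml i4 (show (0:ℝ) ≤ n by linarith)
      linarith
    rw [IB_sub ker_om fpr fpr, IB_add ker_om fpr fpr, IB_c,
      IB_add ker_om fpr fpr, IB_c, IB_mul om 2, IB_mul om (2 * (n:ℝ)), IB_odd ker_om (fun k => smp)] at h3
    have h4 := he f δ x (κ * z) omg hN.err hδ pvt
    have h5 : Ce * δ / (κ * z) ≤ B := by
      rw [hB, dmm]
      have := scB hz0 hκ hcc hm hw s1 g1 g2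
      gcongr
    have h6 := hp.hC2
    have h7 : 4 * (κ * (3 / c1)) ^ 2 ≤ m / 2 := by
      rw [hm, mul_pow]; linarith [mml h6 (sq_nonneg κ)]
    exact scB2 lnr h3 (h4.trans h5) h7 s2 hd3a hL hmp
  · push Not at hL
    have h3 : c3 * IB om (fun k => lap v (x + (κ * z) • k)) ≤ I1 := by
      rw [← IB_mul]
      refine IB_mono ker_om fpr fpr fun k hk => ?_
      exact p3_I2 hp hN h1 hb (by have := mml hf2 (show (0:ℝ) ≤ n by linarith); linarith) _ k hk
    set L := IB om (fun k => lap v (x + (κ * z) • k)) with hLd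
    exact scC hn' hf2 hnB hc3 h3 hm hκ hd3a hd3b s2 hmp g3 hLz' hS hp.hk4 hp.hC2'
lemma p3_par (hn : 3 ≤ n) (hc1 : 0 < c1) (hc1' : c1 ≤ 1) (hC0 : 1 ≤ C0) :
    ∃ C2 c3 κ0, 0 < κ0 ∧ 0 < C2 ∧ ∀ κ, 0 < κ → κ ≤ κ0 → P3c n c1 C0 κ C2 c3 := by
  set Kb := 1 + 2 * C0 ^ 2 * (1 + 2 * n) with hKb
  have hK : 1 ≤ Kb := by rw [hKb]; have : 0 ≤ 2 * C0 ^ 2 * (1 + 2 * n) := pvt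
                         linarith
  set M : ℝ := n ^ 2 * (n.factorial * Kb ^ n) ^ 2 with hM
  have hn' : (3:ℝ) ≤ n := by exact_mod_cast hn
  have hMp : 0 < M := by
    have : (0:ℝ) < n.factorial := by exact_mod_cast n.factorial_pos
    positivity
  set c3 := 1 / (4 * M) with hc3
  have hc3p : 0 < c3 := pvt
  set Z := 3 / c1 with hZ
  have hZp : 0 < Z := pvt
  refine ⟨8 * Z ^ 2 + 4 * n / c3, c3, min (min (c1 / 2) (1 / (2 * Z))) (min (1 / (2 * n * Z)) (min 1 (c3 / (2 * n)))), by positivity, by positivity, ?_⟩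
  intro κ hκ hk
  simp only [le_min_iff] at hk
  obtain ⟨⟨k1, k2⟩, k3, k4, k5⟩ := hk
  refine ⟨hc1, hc1', hC0, hκ, k1, ?_, ?_, ?_, hc3p, ?_, ?_, ?_⟩
  · rw [ldi pvt] at k2; change κ * Z ≤ _; linarith
  · rw [ldi pvt] at k3
    change n ^ 2 * (κ * Z) ^ 2 ≤ _
    have : n * (κ * Z) ≤ 1/2 := lnr
    have h0 : 0 ≤ n * (κ * Z) := pvt
    rw [← mul_pow]; exact (ppl h0 this 2).trans nnm
  · rw [ldi pvt] at k5
    have : n * κ ^ 2 ≤ n * κ := mml (by nlinarith) lnr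
    linarith
  · have : 0 ≤ 4 * n / c3 := pvt
    linarith
  · rw [add_mul, div_mul_cancel₀ _ hc3p.ne']
    have : 0 ≤ 8 * Z ^ 2 * c3 := pvt
    linarith
  · intro Q b hs hp hb hbb
    have h := tr_ee_le hs hp hb hK (fun i => by
      have h1 : ‖b i‖ ^ 2 ≤ ∑ i, ‖b i‖ ^ 2 := Finset.single_le_sum (f := fun i => ‖b i‖ ^ 2) (fun _ _ => sq_nonneg _) (Finset.mem_univ i)
      have h2 : ∑ i, ‖b i‖ ^ 2 ≤ 2 * C0 ^ 2 * (1 + 2 * n) := by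
        rw [dmm, one_mul, dli pvt] at hbb
        linarith
      have h3 : ‖b i‖ ^ 2 ≤ Kb ^ 2 := by nlinarith
      exact (sq_le_sq₀ (norm_nonneg _) lnr).1 h3)
    change tr Q ee ≤ M * tr Q b at h
    rw [hc3]
    have e : 4 * (1 / (4 * M)) * tr Q ee = tr Q ee / M := by field_simp
    rw [e, dli hMp]; linarith
end
lemma err_lint (hn : 0 < n) {B : ℝ} (hf : Err f δ) (hA : 0 ≤ A) (hB : 0 ≤ B) (hδ : 0 < δ) (hR : 0 < R) (hK : K ⊆ MB 0 R) :
    ∫⁻ x in K, ofReal ((A * |f x - 1| + B * δ) ^ n) ≤ ofReal (((1 + 2 ^ n * (A ^ n + B ^ n * (R ^ n * vB n))) * δ) ^ n) := by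
  have hv := vB_pos n
  have hint : IntegrableOn (fun x => 2 ^ n * (A ^ n * |f x - 1| ^ n + (B * δ) ^ n)) (MB zE n R) := by
    refine Integrable.const_mul (Integrable.add (hf.int.integrableOn.const_mul _) ?_) _
    exact (integrableOn_const (by rw [vol_ball 0 hR]; exact ofReal_ne_top))
  calc _ ≤ ∫⁻ x in MB zE n R, ofReal (2 ^ n * (A ^ n * |f x - 1| ^ n + (B * δ) ^ n)) := by
        refine (lintegral_mono_set hK).trans (lintegral_mono fun x => oRl ?_)
        have := add_pow_le (show 0 ≤ A * |f x - 1| by positivity) (show 0 ≤ B * δ by positivity) n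
        rw [mul_pow A] at this
        refine this.trans ?_
        gcongr
        · norm_num
        · omega
    _ = ofReal (∫ x in MB zE n R, 2 ^ n * (A ^ n * |f x - 1| ^ n + (B * δ) ^ n)) := by
        rw [ofReal_integral_eq_lintegral_ofReal hint]
        exact evF fun x => pvt
    _ ≤ _ := by
        apply oRl
        rw [integral_const_mul, integral_add (hf.int.integrableOn.const_mul _)
          (integrableOn_const (by rw [vol_ball 0 hR]; exact ofReal_ne_top)), integral_const_mul, setIntegral_const]
        have h1 : ∫ x in MB zE n R, |f x - 1| ^ n ≤ δ ^ n :=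
          (setIntegral_le_integral hf.int (evF fun x => pvt)).trans hf.le
        have h2 : volume.real (MB zE n R) = R ^ n * vB n := by
          rw [measureReal_def, vol_ball 0 hR, toReal_ofReal pvt]
        rw [h2, sem]
        set X := 1 + 2 ^ n * (A ^ n + B ^ n * (R ^ n * vB n)) with hX
        rw [mul_pow X]
        have h3 : 1 ≤ X := by
          have : 0 ≤ 2 ^ n * (A ^ n + B ^ n * (R ^ n * vB n)) := pvt
          linarith
        have h4 : X ≤ X ^ n := le_self_pow₀ h3 omg
        calc _ ≤ 2 ^ n * (A ^ n * δ ^ n + R ^ n * vB n * (B * δ) ^ n) := gcg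
          _ = 2 ^ n * (A ^ n + B ^ n * (R ^ n * vB n)) * δ ^ n := by rw [mul_pow]; ring
          _ ≤ X * δ ^ n := by gcongr; linarith
          _ ≤ _ := gcg
lemma small_pow (hn : 0 < n) (hA : 0 < A) (hc : 0 < c) : ∃ d0, 0 < d0 ∧ ∀ d, 0 < d → d ≤ d0 → (A * d) ^ n < c := by
  refine ⟨min (1 / A) (c / (2 * A)), by positivity, fun d hd h => ?_⟩
  rw [le_min_iff, ldi hA, ldi pvt] at h
  calc (A * d) ^ n ≤ A * d := pow_le_of_le_one pvt lnr omg
    _ < c := by nlinarith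
theorem P3 (hn : 3 ≤ n) (hc1 : 0 < c1) (hc1' : c1 ≤ 1) (hC0 : 1 ≤ C0) :
    ∃ Λ0 κ0 : ℝ, 0 < Λ0 ∧ 0 < κ0 ∧ ∀ κ, 0 < κ → κ ≤ κ0 → ∃ δ0, 0 < δ0 ∧ ∀ (δ : ℝ) (v f : Fu n), 0 < δ → δ ≤ δ0 →
      NData c1 C0 δ v f → ∀ x, v x ≤ 1/4 → Av om (κ / 4) v x - v x ≤ Λ0 * κ ^ 2 := by
  obtain ⟨C2, c3, κ0, hκ0, hC2, hpar⟩ := p3_par hn hc1 hc1' hC0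
  obtain ⟨Ce, hCe, he⟩ := avg_err (n := n)
  have hn0 : 0 < n := omg
  refine ⟨2 * C2, κ0, by positivity, hκ0, fun κ hκ hκ' => ?_⟩
  have hp := hpar κ hκ hκ'
  have hv := vB_pos n
  set m := C2 * κ ^ 2 with hm
  have hmp : 0 < m := pvt
  set B := 4 * n * Ce / (κ * (C2 * κ * c1 / 2) ^ 2) with hB
  have hBp : 0 ≤ B := pvt
  obtain ⟨d0, hd0, hd⟩ := small_pow hn0 (A := 2 * (1 + 2 ^ n * ((8 * n : ℝ) ^ n + B ^ n * ((2 * C0) ^ n * vB n)))) (c := (m ^ 2 / (2 * (2 * C0))) ^ n * vB n) pvt pvt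
  refine ⟨d0, hd0, fun δ v f hδ hδ0 hN x hx => ?_⟩
  have hzc := zt_cd C0 hN.cd
  obtain ⟨hGcd, hGD⟩ := GG_cd κ C0 hN.cd
  set K : Set (E n) := {x | v x ≤ 1 ∧ 0 ≤ zt C0 v x} with hK
  have hKc : IsCompact K := by
    refine Metric.isCompact_of_isClosed_isBounded ?_ ?_
    · exact (isClosed_le hN.cd.continuous cco).inter (isClosed_le cco hzc.continuous)
    · refine isBounded_closedBall.subset (s := K) (t := closedBall 0 C0) fun y hy => ?_
      simpa using hN.sub y hy.1
  have hz : 1/4 ≤ zt C0 v x := by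
    unfold zt; have : 0 ≤ 1 / (4 * C0 ^ 2) * ‖x‖ ^ 2 := pvt
    linarith
  have hxK : x ∈ K := ⟨by linarith, by linarith⟩
  have hz2 := (p3_le hp hN hxK.1 hxK.2).2
  have hmono := Av_mono hN.cd hN.psd x (r := κ / 4) (R := κ * zt C0 v x) pvt (by linarith [mml hz hκ.le])
  have hG0 := (p3_G hp hN hxK.1 hxK.2).1
  by_contra hcon
  push Not at hcon
  have hG : 2 * m < GG κ C0 v x := by unfold GG; rw [hm]; linarith
  have hbig := abp hn0 (w := fun x => GG κ C0 v x ^ 2 - (C2 * κ ^ 2) ^ 2 * zt C0 v x) ((hGcd.pow 2).sub (contDiff_const.mul hzc))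
    hKc hxK (m := m ^ 2) (R := 2 * C0) pvt pvt (by
      change m ^ 2 ≤ GG κ C0 v x ^ 2 - m ^ 2 * zt C0 v x
      linarith [ppl (by positivity : 0 ≤ 2 * m) hG.le 2, mml hz2 (sq_nonneg m), sq_nonneg m]) (fun y hy => by
        refine (norm_sub_le _ _).trans ?_
        linarith [hN.sub y hy.1, hN.sub x hxK.1]) (fun y hy hw => by
        have h1 := (p3_le hp hN hy.1 hy.2).1
        have h2 := p3_G hp hN hy.1 hy.2
        have h3 : 0 < zt C0 v y := by
          rcases hy.2.eq_or_lt with h | h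
          · have h4 := h2.2.1
            rw [← h] at h4
            have : GG κ C0 v y = 0 := le_antisymm lnr h2.1
            simp [this, ← h] at hw
          · exact h
        rw [mem_interior]
        refine ⟨{y | v y < 1} ∩ {y | 0 < zt C0 v y}, fun z hz => ⟨hz.1.le, hz.2.le⟩, ?_, ?_⟩
        · exact (isOpen_lt hN.cd.continuous cco).inter (isOpen_lt cco hzc.continuous)
        · exact ⟨show v y < 1 by linarith, h3⟩)
    (S := ∅) MeasurableSet.empty (C1 := 0) (δ := (1 + 2 ^ n * ((8 * n : ℝ) ^ n + B ^ n * ((2 * C0) ^ n * vB n))) * δ) le_rfl pvt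
    (e := fun x => 8 * n * |f x - 1| + B * δ) (fun y _ => pvt)
    (err_lint hn0 hN.err pvt hBp hδ pvt (fun y hy => by
      have := hN.sub y hy.1
      simp; linarith)) (fun y hy => by
        simp only [Set.indicator_empty, zero_add]
        refine p3_pt hn hp hN hδ hCe he hy.1.1 hy.1.2 (lt_of_lt_of_le ?_ hy.2.1)
        positivity)
  have := hd δ hδ hδ0
  simp only [Set.empty_inter, measure_empty, ENNReal.toReal_zero, mul_zero, zero_add] at hbig
  rw [← mul_pow] at hbig
  rw [mul_assoc] at this
  linarith
lemma Err.lint (h : Err f δ) (S : Set (E n)) :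
    ∫⁻ x in S, ofReal (|f x - 1| ^ n) ≤ ofReal (δ ^ n) := by
  refine (setLIntegral_le_lintegral _ _).trans ?_
  rw [← ofReal_integral_eq_lintegral_ofReal h.int (evF fun x => pvt)]
  exact oRl h.le
lemma gr_inj (hv : CD v) (hp : ∀ x a, a ≠ 0 → 0 < D2 v x a a) :
    Injective (gr v) := by
  intro x y hxy
  by_contra hne
  have h0 : y - x ≠ 0 := sub_ne_zero.2 (Ne.symm hne)
  have hm : StrictMono (fun t : ℝ => fd v (x + t • (y - x)) (y - x)) := by
    apply strictMono_of_deriv_pos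
    intro t
    rw [(line2 hv x (y - x) (y - x) t).deriv]
    exact hp _ _ h0
  have h1 := hm (zero_lt_one)
  simp only [zero_smul, add_zero, one_smul, add_sub_cancel, ← gr_inner, hxy, lt_self_iff_false] at h1
lemma area (hv : CD v) (hp : ∀ x a, a ≠ 0 → 0 < D2 v x a a)
    (hd : ∀ x, (mat (D2 v x)).det = f x ^ n) (hf : ∀ x, 0 < f x) (hS : MeasurableSet S) :
    ∫⁻ x in S, ofReal (f x ^ n) = volume (gr v '' S) := by
  rw [← lintegral_abs_det_fderiv_eq_addHaar_image volume hS (fun x _ => (hasF_gr hv x).hasFDerivWithinAt) (gr_inj hv hp).injOn]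
  refine lintegral_congr fun x => ?_
  rw [grD_det hv, hd, aop (pow_pos (hf x) n)]
lemma scal1 {f : ℝ} (hf : 0 < f) (n : ℕ) : f ^ n ≤ 2 ^ n * (1 + |f - 1| ^ n) := by
  have h1 : f ≤ 2 * max 1 |f - 1| := by
    have := le_abs_self (f - 1)
    rcases le_total 1 |f - 1| with h | h
    · rw [max_eq_right h]; linarith
    · rw [max_eq_left h]; linarith
  calc f ^ n ≤ (2 * max 1 |f - 1|) ^ n := gcg
    _ = 2 ^ n * (max 1 |f-1|) ^ n := by rw [mul_pow]
    _ ≤ _ := by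
      gcongr
      rcases le_total 1 |f - 1| with h | h
      · rw [max_eq_right h]; linarith
      · rw [max_eq_left h, one_pow]; have : 0 ≤ |f - 1| ^ n := pvt
        linarith
lemma scal2 {f : ℝ} (hf : 0 < f) (n : ℕ) : 1 ≤ 2 ^ n * (f ^ n + |f - 1| ^ n) := by
  have h2 : 0 ≤ |f - 1| ^ n := pvt
  have h3 : 0 ≤ f ^ n := pvt
  rcases le_total (1/2) f with h | h
  · have : (1:ℝ) ≤ (2 * f) ^ n := olp lnr
    rw [mul_pow] at this
    nlinarith [pow_pos (two_pos (α := ℝ)) n]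
  · have : (1:ℝ) ≤ (2 * |f - 1|) ^ n := olp (by rw [abs_of_nonpos] <;> linarith)
    rw [mul_pow] at this
    nlinarith [pow_pos (two_pos (α := ℝ)) n]
lemma vol_le (hv : CD v) (hp : ∀ x a, a ≠ 0 → 0 < D2 v x a a)
    (hd : ∀ x, (mat (D2 v x)).det = f x ^ n) (hf : ∀ x, 0 < f x) (he : Err f δ) (hS : MeasurableSet S) :
    volume (gr v '' S) ≤ ofReal (2 ^ n) * (volume S + ofReal (δ ^ n)) := by
  rw [← area hv hp hd hf hS]
  have hc := he.cont
  calc ∫⁻ x in S, ofReal (f x ^ n) ≤ ∫⁻ x in S, ofReal (2^n) * (1 + ofReal (|f x - 1| ^ n)) := by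
        refine lintegral_mono fun x => ?_
        rw [← ofReal_one, ← ofReal_add nnm pvt, ← ofReal_mul pvt]
        exact oRl (scal1 (hf x) n)
    _ = ofReal (2^n) * (volume S + ∫⁻ x in S, ofReal (|f x - 1| ^ n)) := by
        rw [lintegral_const_mul _ fpr, lintegral_add_left fpr]; simp
    _ ≤ _ := by gcongr; exact he.lint S
lemma vol_ge (hv : CD v) (hp : ∀ x a, a ≠ 0 → 0 < D2 v x a a)
    (hd : ∀ x, (mat (D2 v x)).det = f x ^ n) (hf : ∀ x, 0 < f x) (he : Err f δ) (hS : MeasurableSet S) :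
    volume S ≤ ofReal (2 ^ n) * (volume (gr v '' S) + ofReal (δ ^ n)) := by
  rw [← area hv hp hd hf hS]
  have hc := he.cont
  calc volume S = ∫⁻ x in S, 1 := smp
    _ ≤ ∫⁻ x in S, ofReal (2^n) * (ofReal (f x ^ n) + ofReal (|f x - 1| ^ n)) := by
        refine lintegral_mono fun x => ?_
        have := pow_pos (hf x) n
        rw [← ofReal_one, ← ofReal_add pvt pvt, ← ofReal_mul pvt]
        exact oRl (scal2 (hf x) n)
    _ = ofReal (2^n) * ((∫⁻ x in S, ofReal (f x ^ n)) + ∫⁻ x in S, ofReal (|f x - 1| ^ n)) := by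
        rw [lintegral_const_mul _ fpr, lintegral_add_left fpr]
    _ ≤ _ := by gcongr; exact he.lint S
lemma slope (hv : CD v) (hK : IsCompact K) (hKv : ∀ x, x ∈ K ↔ v x ≤ 1)
    (hx : v x < 1) (h : ∀ z ∈ K, inr p (z - x) < 1 - v x) : p ∈ gr v '' K := by
  have hc : ContinuousOn (fun z => v z - inr p z) K := by
    have := hv.continuous; fun_prop
  obtain ⟨z, hz, hmin⟩ := hK.exists_isMinOn ⟨x, (hKv x).2 hx.le⟩ hc
  refine ⟨z, hz, ?_⟩
  have h1 : v z - inr p z ≤ v x - inr p x := hmin ((hKv x).2 hx.le)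
  have h2 := h z hz
  rw [inner_sub_right] at h2
  have h3 : v z < 1 := lnr
  have hl : IsLocalMin (fun z => v z - inr p z) z := by
    have : ∀ᶠ y in nhds z, v y < 1 := hv.continuous.continuousAt.eventually_lt continuousAt_const h3
    filter_upwards [this] with y hy
    exact hmin ((hKv y).2 hy.le)
  have hd : HasFDerivAt (fun z => v z - inr p z) (fd v z - innerSL ℝ p) z :=
    (hasF hv z).sub (innerSL ℝ p).hasFDerivAt
  have h4 := hl.hasFDerivAt_eq_zero hd
  refine ext_inner_right ℝ fun y => ?_
  rw [gr_inner]
  have := DFunLike.congr_fun h4 y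
  simp at this
  linarith
lemma norm_le_coord (h : ∀ i, |x i| ≤ σ) : ‖x‖ ≤ n * σ := by
  conv_lhs => rw [← sum_ee x]
  refine (norm_sum_le _ _).trans ?_
  have : ∀ i ∈ Finset.univ, ‖x i • (ee i : E n)‖ ≤ σ := fun i _ => by
    rw [norm_smul]; simpa [ee] using h i
  refine (sum_le_card_nsmul _ _ _ this).trans ?_
  simp
lemma conv_comb (hv : CD v) (hp : ∀ x, Psd (D2 v x)) (v0 : v 0 = 0) (hσ : 0 < σ)
    (h1 : ∀ i, v (σ • ee i) ≤ 1) {y : E n} (hy : ∀ i, 0 ≤ y i) (hy' : ∑ i, y i ≤ σ) : v y ≤ 1 := by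
  have ha : ∀ i, (y i / σ) * (v y + fd v y (σ • ee i - y)) ≤ (y i / σ) * 1 := fun i => by
    have := div_nonneg (hy i) hσ.le
    gcongr
    exact (supp_plane hv hp y _).trans (h1 i)
  have hb := supp_plane hv hp y 0
  have hc := sum_le_sum (s := Finset.univ) fun i _ => ha i
  set S := ∑ i, y i / σ with hS
  have hS1 : S ≤ 1 := by rw [hS, ← sum_div]; exact (div_le_one hσ).2 hy'
  have e1 : ∑ i, (y i / σ) * (v y + fd v y (σ • ee i - y)) = S * (v y - fd v y y) + fd v y y := by
    have : ∀ i, (y i / σ) * (v y + fd v y (σ • ee i - y)) = (y i / σ) * (v y - fd v y y) + fd v y (y i • ee i) := fun i => by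
      rw [map_sub, map_smul, map_smul, sem, sem]; field_simp; ring
    rw [sum_congr rfl fun i _ => this i, sum_add_distrib, ← sum_mul, ← map_sum, sum_ee]
  rw [e1] at hc
  simp only [mul_one] at hc
  rw [zero_sub, map_neg, v0] at hb
  have := mml hb (sub_nonneg.2 hS1)
  nlinarith
lemma sig_bound (hn : 0 < n) : ∃ σ2 : ℝ, 1 ≤ σ2 ∧ ∀ (v f : Fu n) (δ σ : ℝ), CD v → (∀ x a, a ≠ 0 → 0 < D2 v x a a) →
    v 0 = 0 → (∀ x, 0 ≤ v x) → (∀ x, (mat (D2 v x)).det = f x ^ n) → (∀ x, 0 < f x) → Err f δ → 0 < δ → δ ≤ 1 → 0 < σ →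
    (∀ i, v (σ • ee i) ≤ 1) → σ ≤ σ2 := by
  have hn' : (0:ℝ) < n := by exact_mod_cast hn
  have hvB := vB_pos n
  set A : ℝ := 2 ^ n * ((8*n)^n * vB n + 1) with hA
  refine ⟨1 + (4*n)^n * A / vB n, by simp; positivity, ?_⟩
  intro v f δ σ hv hp v0 hnn hd hf he hδ hδ1 hσ h1
  by_cases hs1 : σ ≤ 1
  · have : 0 ≤ (4*n)^n * A / vB n := pvt
    linarith
  push Not at hs1
  have hpsd : ∀ x, Psd (D2 v x) := fun x => psd_of_pos (hp x)
  set z : E n := WithLp.toLp 2 fun _ => σ / (2*n) with hz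
  have hball : ∀ y, ‖y - z‖ ≤ σ/(2*n) → v y ≤ 1 := by
    intro y hy
    have hco : ∀ i, |y i - σ/(2*n)| ≤ σ/(2*n) := fun i => by
      have := PiLp.norm_apply_le (y - z) i
      simp [hz] at this
      simpa using this.trans hy
    apply conv_comb hv hpsd v0 hσ h1
    · intro i; have := abs_le.1 (hco i); linarith
    · have : ∀ i ∈ Finset.univ, y i ≤ σ/n := fun i _ => by
        have := abs_le.1 (hco i)
        have h2 : σ/n = σ/(2*n) + σ/(2*n) := by field_simp; norm_num
        linarith
      refine (sum_le_card_nsmul _ _ _ this).trans ?_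
      simp; rw [mul_div_cancel₀ _ hn'.ne']
  have hgr : gr v '' MB z (σ/(4*n)) ⊆ MB 0 (8*n) := by
    rintro _ ⟨x, hx, rfl⟩
    rw [mbz, gr_norm]
    rw [mem_ball_iff_norm] at hx
    have := grad_bd hv hpsd hnn (r := σ/(4*n)) (M := 1) (x := x) pvt (fun y hy => hball y (by
      have h3 : σ/(2*n) = σ/(4*n) + σ/(4*n) := by field_simp; norm_num
      calc ‖y - z‖ = ‖(y - x) + (x - z)‖ := by congr 1; abel
        _ ≤ _ := norm_add_le _ _
        _ ≤ _ := lnr))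
    refine lt_of_le_of_lt this ?_
    rw [one_div_div, div_lt_iff₀ hσ]
    nlinarith
  have h5 := vol_ge hv hp hd hf he (S := MB z (σ/(4*n))) measurableSet_ball
  have h6 := h5.trans (mul_le_mul_right (add_le_add_left (measure_mono hgr) _) _)
  rw [vol_ball _ pvt, vol_ball _ pvt, ← ofReal_add pvt pvt, ← ofReal_mul pvt,
    ofReal_le_ofReal_iff pvt] at h6
  have h7 : δ ^ n ≤ 1 := plo hδ.le hδ1
  have h8 : (σ/(4*n))^n * vB n ≤ A := h6.trans (by rw [hA]; gcongr)
  have h9 : σ ≤ σ ^ n := le_self_pow₀ hs1.le hn.ne'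
  rw [div_pow] at h8
  have : σ ^ n ≤ (4*n)^n * A / vB n := by
    rw [ldi hvB]
    rw [dmm, dli pvt] at h8
    linarith
  linarith
lemma dist_bound (hn : 0 < n) (hC0 : 1 ≤ C0) : ∃ c1 : ℝ, 0 < c1 ∧ c1 ≤ 1 ∧ ∀ (v f : Fu n) (δ : ℝ), CD v → (∀ x a, a ≠ 0 → 0 < D2 v x a a) →
    v 0 = 0 → (∀ x, 0 ≤ v x) → (∀ x, (mat (D2 v x)).det = f x ^ n) → (∀ x, 0 < f x) → Err f δ → 0 < δ → δ ≤ 1 →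
    (∀ x, v x ≤ 1 → ‖x‖ ≤ C0) → ∀ x y, v x ≤ 3/4 → ‖y - x‖ ≤ c1 → v y ≤ 1 := by
  have hvB := vB_pos n
  set B : ℝ := 2 ^ n * ((2*C0)^n * vB n + 1) with hB
  set ρ : ℝ := 1/(16*C0) with hρ
  have hρ0 : 0 < ρ := pvt
  obtain ⟨N, hN⟩ := exists_nat_gt (B / (ρ^n * vB n))
  rw [div_lt_iff₀ pvt] at hN
  have hN0 : (0:ℝ) < N := by
    by_contra h
    have : (N:ℝ) * (ρ^n * vB n) ≤ 0 := mul_nonpos_of_nonpos_of_nonneg (not_lt.1 h) pvt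
    have : 0 < B := pvt
    linarith
  refine ⟨min 1 (1/(32*ρ*N)), by positivity, mll _ _, ?_⟩
  intro v f δ hv hp v0 hnn hd hf he hδ hδ1 hsub x y0 hx hy
  by_contra hy0
  push Not at hy0
  have hpsd : ∀ x, Psd (D2 v x) := fun x => psd_of_pos (hp x)
  have hyd : ‖y0 - x‖ * (2*ρ*N) ≤ 1/16 := by
    have := hy.trans (mlr _ _)
    rw [ldi pvt] at this
    nlinarith
  set K : Set (E n) := {x | v x ≤ 1} with hK
  have hKc : IsCompact K := by
    apply (iCB zE n C0).of_isClosed_subset (isClosed_le hv.continuous cco)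
    intro z hz; simpa using hsub z hz
  have hg0 : 0 < ‖gr v y0‖ := by
    rw [norm_pos_iff]; intro h
    have h1 := supp_plane hv hpsd y0 0
    rw [← gr_inner, h, inner_zero_left, v0] at h1
    linarith
  set ν := (‖gr v y0‖⁻¹) • gr v y0 with hν
  have hν1 : ‖ν‖ = 1 := by rw [hν, norm_smul, norm_inv, norm_norm, imc hg0.ne']
  have hνK : ∀ z ∈ K, inr ν (z - x) ≤ ‖y0 - x‖ := by
    intro z hz
    have h1 := supp_plane hv hpsd y0 z
    have h2 : inr ν (z - y0) ≤ 0 := by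
      rw [hν, real_inner_smul_left, gr_inner]
      have : v z ≤ 1 := hz
      exact mul_nonpos_of_nonneg_of_nonpos pvt lnr
    have h3 := real_inner_le_norm ν (y0 - x)
    rw [hν1, one_mul] at h3
    have : z - x = (z - y0) + (y0 - x) := by abel
    rw [this, inner_add_right]; linarith
  have hsl : ∀ j < N, MB ((2*ρ*(j:ℝ)) • ν) ρ ⊆ gr v '' K := by
    intro j hj p hp'
    rw [mem_ball_iff_norm] at hp'
    apply slope hv hKc (fun _ => Iff.rfl) (x := x) lnr
    intro z hz
    have e : p = (2*ρ*(j:ℝ)) • ν + (p - (2*ρ*(j:ℝ)) • ν) := by abel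
    rw [e, inner_add_left, real_inner_smul_left]
    have h1 := mml (hνK z hz) (by positivity : 0 ≤ 2*ρ*(j:ℝ))
    have h2 := real_inner_le_norm (p - (2*ρ*(j:ℝ)) • ν) (z - x)
    have h3 : ‖z - x‖ ≤ 2*C0 := by
      have := norm_sub_le z x
      have := hsub z hz
      have := hsub x lnr
      linarith
    have h4 : ‖p - (2*ρ*(j:ℝ)) • ν‖ * ‖z - x‖ ≤ ρ * (2*C0) := gcg
    have h5 : ρ * (2*C0) = 1/8 := by rw [hρ]; field_simp; norm_num
    have h6 : (2*ρ*(j:ℝ)) * ‖y0 - x‖ ≤ 2*ρ*N * ‖y0 - x‖ := by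
      have : (j:ℝ) ≤ N := by exact_mod_cast hj.le
      gcongr
    linarith
  have hdisj : Set.PairwiseDisjoint (↑(range N)) (fun j : ℕ => MB ((2*ρ*(j:ℝ)) • ν) ρ) := by
    intro i _ j _ hij
    apply Metric.ball_disjoint_ball
    rw [dist_eq_norm, ← sub_smul, norm_smul, hν1, mul_one, ← mul_sub, norm_mul, nnn pvt, norm_eq_abs]
    have : (1:ℝ) ≤ |(i:ℝ) - j| := by
      have h : (1:ℤ) ≤ |(i:ℤ) - j| := Int.one_le_abs (sub_ne_zero.2 (by exact_mod_cast hij))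
      exact_mod_cast h
    nlinarith
  have h7 : ∑ j ∈ range N, volume (MB ((2*ρ*(j:ℝ)) • ν) ρ) ≤ volume (gr v '' K) := by
    rw [← measure_biUnion_finset hdisj fun _ _ => measurableSet_ball]
    apply measure_mono
    simp only [Set.iUnion_subset_iff, mem_range]
    exact hsl
  have h8 := h7.trans (vol_le hv hp hd hf he hKc.measurableSet)
  have h9 : volume K ≤ volume (MB zE n (2*C0)) := measure_mono fun z hz => by
    have := hsub z hz
    rw [mbz]; linarith
  have h10 := h8.trans (mul_le_mul_right (add_le_add_left h9 _) _)
  simp only [vol_ball _ hρ0, sum_const, Finset.card_range] at h10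
  rw [vol_ball _ pvt, ← ofReal_add pvt pvt, ← ofReal_mul pvt,
    ← ENNReal.ofReal_nsmul,
    ofReal_le_ofReal_iff pvt, nsmul_eq_mul] at h10
  have h7 : δ ^ n ≤ 1 := plo hδ.le hδ1
  have : 2 ^ n * ((2 * C0) ^ n * vB n + δ ^ n) ≤ B := by rw [hB]; gcongr
  linarith
lemma normz (hn : 0 < n) : ∃ c1 C0 : ℝ, 0 < c1 ∧ c1 ≤ 1 ∧ 1 ≤ C0 ∧ ∀ (v f : Fu n) (δ σ : ℝ), CD v → (∀ x a, a ≠ 0 → 0 < D2 v x a a) →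
    v 0 = 0 → (∀ x, 0 ≤ v x) → (∀ x, (mat (D2 v x)).det = f x ^ n) → (∀ x, 0 < f x) → Err f δ → 0 < δ → δ ≤ 1 → 0 < σ →
    (∀ i, v (σ • ee i) ≤ 1) → (∀ x, v x ≤ 1 → ∀ i, |x i| ≤ σ) → NData c1 C0 δ v f := by
  obtain ⟨σ2, h2, H2⟩ := sig_bound hn
  have hn' : (1:ℝ) ≤ n := by exact_mod_cast hn
  obtain ⟨c1, h3, h4, H3⟩ := dist_bound hn (C0 := n * σ2) (by nlinarith)
  refine ⟨c1, n * σ2, h3, h4, by nlinarith, ?_⟩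
  intro v f δ σ hv hp v0 hnn hd hf he hδ hδ1 hσ h1 h1'
  have hsub : ∀ x, v x ≤ 1 → ‖x‖ ≤ n * σ2 := fun x hx =>
    (norm_le_coord (h1' x hx)).trans (by gcongr; exact H2 v f δ σ hv hp v0 hnn hd hf he hδ hδ1 hσ h1)
  exact ⟨hv, hp, v0, hnn, hsub, H3 v f δ hv hp v0 hnn hd hf he hδ hδ1 hsub, hd, hf, he⟩
structure Ent (Θ : ℝ) (u F : Fu n) : Prop where
  cd : CD u
  pos : ∀ x a, a ≠ 0 → 0 < D2 u x a a
  u0 : u 0 = 0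
  nonneg : ∀ x, 0 ≤ u x
  det : ∀ x, (mat (D2 u x)).det = F x ^ n
  fpos : ∀ x, 0 < F x
  err : Err F Θ
def LT (b : Fr n) : E n →L[ℝ] E n :=
  ∑ i, (EuclideanSpace.proj i : E n →L[ℝ] ℝ).smulRight (b i)
lemma LT_apply (b : Fr n) (x : E n) : LT b x = ∑ i, x i • b i := by
  simp [LT, _root_.sum_apply]
lemma LT_ee (b : Fr n) (i : Fin n) : LT b (ee i) = b i := by
  rw [LT_apply, sum_eq_single i] <;> simp +contextual [ee]
lemma LT_det (b : Fr n) : (LT b).det = (frM b).det := by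
  rw [ContinuousLinearMap.det, ← det_toMatrix (basisFun (Fin n) ℝ).toBasis, ← det_transpose]
  congr 1
  ext i j
  rw [transpose_apply, toMatrix_apply]
  have := LT_ee b i
  simp only [ee] at this
  simp [frM, this]
lemma LT_inj (h : (frM b).det ≠ 0) : Injective (LT b) := by
  have h' : LinearMap.det (LT b : E n →ₗ[ℝ] E n) ≠ 0 := by
    have := LT_det b; rw [ContinuousLinearMap.det] at this; rwa [this]
  have := LinearMap.bot_lt_ker_of_det_eq_zero (f := (LT b : E n →ₗ[ℝ] E n))
  have hu := (equivOfDetNeZero _ h').injective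
  exact hu
lemma LT_surj (h : (frM b).det ≠ 0) : Function.Surjective (LT b) :=
  LinearMap.surjective_of_injective (f := (LT b : E n →ₗ[ℝ] E n)) (LT_inj h)
lemma err_LT {ρ : ℝ} (he : Err F Θ) (hρ : 0 < ρ) (hb : |(frM b).det| = ρ ^ n) :
    Err (fun x => F (LT b x)) (Θ / ρ) := by
  have h0 : (frM b).det ≠ 0 := by
    intro h; rw [h, abs_zero] at hb; exact (pow_pos hρ n).ne hb
  have hF : ∀ x ∈ Set.univ, HasFDerivWithinAt (LT b) (LT b) Set.univ x := fun x _ => (LT b).hasFDerivAt.hasFDerivWithinAt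
  have hu : (LT b) '' Set.univ = Set.univ := by rw [Set.image_univ]; exact (LT_surj h0).range_eq
  have h1 := integral_image_eq_integral_abs_det_fderiv_smul volume MeasurableSet.univ hF (LT_inj h0).injOn (fun x => |F x - 1| ^ n)
  have h2 := integrableOn_image_iff_integrableOn_abs_det_fderiv_smul volume MeasurableSet.univ hF (LT_inj h0).injOn (fun x => |F x - 1| ^ n)
  rw [hu, LT_det, hb] at h1 h2
  simp only [Measure.restrict_univ, integrableOn_univ, sem] at h1 h2
  have hpn := pow_pos hρ n
  refine ⟨he.cont.comp (LT b).continuous, ?_, ?_⟩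
  · have := (h2.1 he.int).const_mul (ρ^n)⁻¹
    refine this.congr (evF fun x => ?_)
    simp only
    rw [inv_mul_cancel_left₀ hpn.ne']
  · rw [integral_const_mul] at h1
    rw [div_pow, ldi hpn, mul_comm, ← h1]
    exact he.le
lemma D2_LT (hu : CD u) (B : Fr n) (c : ℝ) (x a b : E n) :
    D2 (fun y => c * u (LT B y)) x a b = c * D2 u (LT B x) (LT B a) (LT B b) := by
  rw [D2_smul (v := fun y => u (LT B y)) (hu.comp (LT B).contDiff)]
  have := D2_affine hu (LT B) 0 x a b
  simp only [zero_add] at this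
  simp [this]
lemma pos_of_det (hs : Sym Q) (hp : Psd Q) (hd : (mat Q).det ≠ 0) (a : E n) (ha : a ≠ 0) : 0 < Q a a := by
  have h := (gram_psd hs hp ee).posDef_iff_det_ne_zero.2 hd
  rw [Matrix.posDef_iff_dotProduct_mulVec] at h
  have h2 := h.2 (x := fun i => a i) (by
    intro h; apply ha; ext i; exact congrFun h i)
  have e := bl_sum Q (fun i => a i) ee
  rw [sum_ee] at e
  simp only [star_trivial] at h2
  rw [e]
  refine h2.trans_eq ?_
  simp only [dotProduct, mulVec, of_apply, mul_sum]
  exact sum_congr rfl fun i _ => sum_congr rfl fun j _ => rng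
lemma Ent.psd (h : Ent Θ u F) (x : E n) : Psd (D2 u x) := psd_of_pos (h.pos x)
lemma Ent.coer (hn : 0 < n) (h : Ent Θ u F) : ∃ μ > 0, ∀ x, 1 ≤ ‖x‖ → μ * ‖x‖ ≤ u x := by
  have hgz : ∀ x, u x = 0 → gr u x = 0 := fun x hx => by
    have hl : IsLocalMin u x := evF fun y => by rw [hx]; exact h.nonneg y
    rw [← norm_eq_zero, gr_norm, hl.fderiv_eq_zero, norm_zero]
  have hp : ∀ x, x ≠ 0 → 0 < u x := fun x hx => by
    refine lt_of_le_of_ne (h.nonneg x) fun h' => hx ?_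
    exact gr_inj h.cd h.pos ((hgz x h'.symm).trans (hgz 0 h.u0).symm)
  haveI : Nonempty (Fin n) := ⟨⟨0, hn⟩⟩
  have hne : (Metric.sphere zE n 1).Nonempty := NormedSpace.sphere_nonempty.2 zero_le_one
  obtain ⟨z, hz, hm⟩ := (isCompact_sphere zE n 1).exists_isMinOn hne h.cd.continuous.continuousOn
  have hz1 : ‖z‖ = 1 := by simpa using hz
  refine ⟨u z, hp z (by rw [← norm_pos_iff, hz1]; norm_num), fun x hx => ?_⟩
  have hx0 : 0 < ‖x‖ := lnr
  set y := ‖x‖⁻¹ • x with hy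
  have hxy : x = ‖x‖ • y := by rw [hy, smul_smul, mul_inv_cancel₀ hx0.ne', one_smul]
  have h1 : u z ≤ u y := hm (by simp [hy, norm_smul, hx0.ne'])
  have h2 := supp_plane h.cd h.psd y x
  have h3 := supp_plane h.cd h.psd y 0
  rw [zero_sub, map_neg, h.u0] at h3
  have e : x - y = (‖x‖ - 1) • y := by conv_lhs => rw [hxy]
                                       module
  rw [e, map_smul, sem] at h2
  have h4 := mml (show u y ≤ fd u y y by linarith) (sub_nonneg.2 hx)
  nlinarith
lemma norm_exists (hn : 0 < n) : ∃ c1 C0 : ℝ, 0 < c1 ∧ c1 ≤ 1 ∧ 1 ≤ C0 ∧ ∀ (Θ : ℝ) (u F : Fu n), 0 < Θ → Ent Θ u F → ∀ ρ, Θ ≤ ρ →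
    ∃ B : Fr n, |(frM B).det| = ρ ^ n ∧ NData c1 C0 (Θ/ρ) (fun x => (ρ^2)⁻¹ * u (LT B x)) (fun x => F (LT B x)) := by
  obtain ⟨c1, C0, h1, h2, h3, H⟩ := normz hn
  refine ⟨c1, C0, h1, h2, h3, ?_⟩
  intro Θ u F hΘ h ρ hρ
  have hρ0 : 0 < ρ := hΘ.trans_le hρ
  obtain ⟨μ, hμ, hco⟩ := h.coer hn
  set K : Set (E n) := {x | u x ≤ ρ^2} with hK
  have hKc : IsCompact K := by
    apply (iCB zE n (max 1 (ρ^2/μ))).of_isClosed_subset (isClosed_le h.cd.continuous cco)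
    intro z hz
    rw [mcz]
    rcases le_total ‖z‖ 1 with h4 | h4
    · exact h4.trans (le_max_left _ _)
    · refine le_trans ?_ (le_max_right _ _)
      rw [ldi hμ]
      have := hco z h4
      have : u z ≤ ρ^2 := hz
      linarith
  have hcpi := isCompact_univ_pi (fun _ : Fin n => hKc)
  have h0K : zE n ∈ K := by show u 0 ≤ _; rw [h.u0]; positivity
  obtain ⟨b, hb, hmax⟩ := hcpi.exists_isMaxOn ⟨fun _ => 0, fun _ _ => h0K⟩ (f := fun b => |(frM b).det|) (by
    refine Continuous.continuousOn ?_
    refine Continuous.abs (Continuous.matrix_det ?_)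
    refine continuous_matrix fun i j => ?_
    show Continuous fun b : Fr n => b i j
    fun_prop)
  have hbK : ∀ i, b i ∈ K := fun i => hb i trivial
  have hD : 0 < |(frM b).det| := by
    have : ∀ᶠ x in nhds zE n, u x < ρ^2 := h.cd.continuous.continuousAt.eventually_lt continuousAt_const (by rw [h.u0]; positivity)
    obtain ⟨ε, hε, hb'⟩ := Metric.eventually_nhds_iff.1 this
    have hm := hmax (show (fun i => (ε/2) • ee i : Fr n) ∈ _ from fun i _ => by
      refine (hb' (y := (ε/2) • ee i) ?_).le
      rw [dist_zero_right, norm_smul, ee]; simp; rw [aop hε]; linarith)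
    have e : frM (fun i => (ε/2) • ee i : Fr n) = (ε/2) • (1 : Matrix (Fin n) (Fin n) ℝ) := by
      rw [← frM_ee]; ext i j; simp [frM]
    simp only [mem_setOf_eq, e, det_smul, det_one, mul_one, card_fin] at hm
    exact lt_of_lt_of_le pvt hm
  have hcr : ∀ x, LT b x ∈ K → ∀ i, |x i| ≤ 1 := by
    intro x hx i
    have hm := hmax (show update b i (LT b x) ∈ _ from fun j _ => by
      rcases eq_or_ne j i with rfl | hj
      · simpa using hx
      · simpa [hj] using hbK j)
    have e : frM (update b i (LT b x)) = (frM b).updateRow i (∑ k, x k • (frM b) k) := by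
      ext k j
      rcases eq_or_ne k i with rfl | hj
      · simp [frM, LT_apply, Finset.sum_apply]
      · simp [frM, hj]
    simp only [mem_setOf_eq, e, Matrix.det_updateRow_sum, sem, abs_mul] at hm
    exact le_of_mul_le_mul_right lnr hD
  set D := |(frM b).det| with hDd
  set s : ℝ := ρ / D ^ ((1:ℝ)/n) with hs
  have hs0 : 0 < s := pvt
  have hsn : s ^ n * D = ρ ^ n := by
    rw [hs, div_pow, ← rpow_natCast (D ^ ((1:ℝ)/n)) n, ← rpow_mul hD.le, one_div, imc pvt, Real.rpow_one, div_mul_cancel₀ _ hD.ne']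
  set B : Fr n := fun i => s • b i with hB
  have hfB : frM B = s • frM b := by ext i j; simp [frM, hB]
  have hBd : |(frM B).det| = ρ ^ n := by
    rw [hfB, det_smul, card_fin, abs_mul, aop (pow_pos hs0 n), ← hDd, hsn]
  have hB0 : (frM B).det ≠ 0 := by intro h'; rw [h', abs_zero] at hBd; exact (pow_pos hρ0 n).ne hBd
  have hLB : ∀ x, LT B x = LT b (s • x) := fun x => by
    simp only [LT_apply, hB, PiLp.smul_apply, sem, smul_smul, mul_comm]
  refine ⟨B, hBd, ?_⟩
  have hr2 : (0:ℝ) < (ρ^2)⁻¹ := pvt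
  have hcd : CD (fun x => (ρ^2)⁻¹ * u (LT B x)) := contDiff_const.mul (h.cd.comp (LT B).contDiff)
  apply H _ _ (Θ/ρ) s⁻¹ hcd
  · intro x a ha
    rw [D2_LT h.cd]
    refine mul_pos hr2 (h.pos _ _ fun h' => ha (LT_inj hB0 (by rw [h', map_zero])))
  · simp [h.u0]
  · intro x; have := h.nonneg (LT B x); positivity
  · intro x
    have e : mat (D2 (fun x => (ρ^2)⁻¹ * u (LT B x)) x) = (ρ^2)⁻¹ • Matrix.of fun i j => D2 u (LT B x) (B i) (B j) := by
      ext i j; simp only [mat, of_apply, D2_LT h.cd, LT_ee, Matrix.smul_apply, sem]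
    rw [e, det_smul, det_gram, card_fin, h.det, ← sq_abs (frM B).det, hBd]
    have := pow_pos hρ0 n
    rw [← mul_assoc, inv_pow, ← pow_mul, ← pow_mul, mul_comm 2 n, imc pvt, one_mul]
  · intro x; exact h.fpos _
  · exact err_LT h.err hρ0 hBd
  · positivity
  · rwa [div_le_one hρ0]
  · positivity
  · intro i
    rw [hLB, smul_smul, mul_inv_cancel₀ hs0.ne', one_smul, LT_ee, iml pvt, mul_one]
    exact hbK i
  · intro x hx i
    rw [iml pvt, mul_one, hLB] at hx
    have := hcr _ hx i
    rw [PiLp.smul_apply, sem, abs_mul, aop hs0] at this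
    rw [← one_div, ldi hs0]; linarith
lemma avLip_ex : ∃ C : ℝ, 1 ≤ C ∧ ∀ (g : Fu n) (x x' : E n) (r M : ℝ), Continuous g → 0 < r → ‖x' - x‖ ≤ r →
    (∀ y, ‖y - x‖ ≤ 2 * r → |g y| ≤ M) → |Av om r g x' - Av om r g x| ≤ C / r * M * ‖x' - x‖ := by
  obtain ⟨L, hL⟩ := (om_cd (n := n)).lipschitzWith_of_hasCompactSupport ker_om.compactSupp smp
  set V := (volume (closedBall zE n 2)).toReal with hV
  refine ⟨max 1 (L * V), le_max_left _ _, fun g x x' r M hg hr hx hM => ?_⟩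
  set a := r⁻¹ • (x' - x) with ha
  have hna : ‖a‖ = ‖x' - x‖ / r := by rw [ha, norm_smul, norm_inv, nnn hr.le]; ring
  have hna1 : ‖a‖ ≤ 1 := by rw [hna, div_le_one hr]; exact hx
  have hM0 : 0 ≤ M := (abs_nonneg _).trans (hM x (by simp; linarith))
  have e1 : Av om r g x' = ∫ k, om (k - a) * g (x + r • k) := by
    rw [Av, IB, ← integral_sub_right_eq_self _ a]
    congr 1; ext k; congr 2
    rw [ha, smul_sub, smul_smul, mul_inv_cancel₀ hr.ne', one_smul]; abel
  have hz : ∀ k : E n, 2 < ‖k‖ → om (k - a) = 0 ∧ om k = 0 := fun k hk =>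
    ⟨ker_om.supp _ (by have := norm_sub_norm_le k a; linarith), ker_om.supp _ lnr⟩
  have hoc := ker_om (n := n) |>.cont
  have i1 : Integrable (fun k => om (k - a) * g (x + r • k)) :=
    cIH fpr (HasCompactSupport.intro (iCB 0 2) fun k hk => by
      simp at hk; simp [(hz k hk).1])
  have e2 : Av om r g x' - Av om r g x = ∫ k in closedBall zE n 2, (om (k - a) - om k) * g (x + r • k) := by
    rw [e1, Av, IB, ← integral_sub i1 (ker_om.int fpr)]
    rw [setIntegral_eq_integral_of_forall_compl_eq_zero]
    · congr 1; ext k; ring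
    · intro k hk; simp at hk; simp [hz k hk]
  rw [e2, ← norm_eq_abs]
  refine (norm_setIntegral_le_of_norm_le_const (C := L * ‖a‖ * M) measure_closedBall_lt_top fun k hk => ?_).trans ?_
  · rw [norm_mul]
    have h1 := hL.dist_le_mul (k - a) k
    rw [dist_eq_norm, dist_eq_norm, show k - a - k = -a by abel, norm_neg] at h1
    refine mul_le_mul h1 (hM _ ?_) (norm_nonneg _) pvt
    simp at hk
    rw [add_sub_cancel_left, norm_smul, nnn hr.le]; nlinarith
  · change L * ‖a‖ * M * V ≤ _
    rw [hna]
    calc (L:ℝ) * (‖x' - x‖ / r) * M * V = L * V * (M * ‖x' - x‖ / r) := rng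
      _ ≤ max 1 (L * V) * (M * ‖x' - x‖ / r) := mmr (le_max_right _ _) pvt
      _ = _ := rng
def cL (n : ℕ) : ℝ := Classical.choose (avLip_ex (n := n))
lemma cL_one (n : ℕ) : 1 ≤ cL n := (cSp (avLip_ex (n := n))).1
lemma avLip (hg : Continuous g) (hr : 0 < r) (hx : ‖x' - x‖ ≤ r)
    (hM : ∀ y, ‖y - x‖ ≤ 2 * r → |g y| ≤ M) : |Av om r g x' - Av om r g x| ≤ cL n / r * M * ‖x' - x‖ :=
  (cSp (avLip_ex (n := n))).2 g x x' r M hg hr hx hM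
lemma avDer {L : E n →L[ℝ] ℝ} (hg : Continuous g) (hr : 0 < r)
    (hM : ∀ y, ‖y - x‖ ≤ 2 * r → |g y| ≤ M) (hL : HasFDerivAt (Av om r g) L x) (a : E n) : |L a| ≤ cL n / r * M * ‖a‖ := by
  have h0 := cL_one n
  have hM0 : 0 ≤ M := (abs_nonneg _).trans (hM x (by simp; linarith))
  have h1 : ‖L‖ ≤ cL n / r * M := hL.le_of_lip' pvt (by
    filter_upwards [Metric.ball_mem_nhds x hr] with y hy
    exact avLip hg hr (by rw [← dist_eq_norm]; exact hy.le) hM)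
  exact (L.le_opNorm a).trans (mmr h1 (norm_nonneg _))
lemma Av_cont (hg : Continuous g) (r : ℝ) : Continuous (Av om r g) :=
  IB_cont ker_om (F := fun x k => g (x + r • k)) (by unfold uncurry; fun_prop)
lemma av2 (hg : CD g) (hr : 0 < r)
    (hM : ∀ y, ‖y - x‖ ≤ 4 * r → |g y| ≤ M) (a b : E n) :
    |D2 (Av om r (Av om r g)) x a b| ≤ (cL n / r) ^ 2 * M * ‖a‖ * ‖b‖ := by
  have hG := Av_cd ker_om hg r
  have hGG := Av_cd ker_om hG r
  have hF := cont_F hG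
  have e : (fun y => fd (Av om r (Av om r g)) y b) = Av om r (fun y => fd (Av om r g) y b) := by
    ext y; rw [Av_F ker_om hG]; rfl
  have hd : HasFDerivAt (fun y => fd (Av om r (Av om r g)) y b)
      ((ContinuousLinearMap.apply ℝ ℝ b).comp (D2 (Av om r (Av om r g)) x)) x :=
    (ContinuousLinearMap.apply ℝ ℝ b).hasFDerivAt.comp x (hasFF hGG x)
  rw [e] at hd
  have := avDer (M := cL n / r * M * ‖b‖) fpr hr (fun y hy => ?_) hd a
  · simp at this
    calc _ ≤ _ := this
      _ = _ := rng
  · refine avDer hg.continuous hr (fun z hz => hM z ?_) (hasF hG y) b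
    have := norm_add_le (z - y) (y - x)
    rw [show z - y + (y - x) = z - x by abel] at this; linarith
lemma av3 (hg : CD g) (hr : 0 < r) (hx : ‖x' - x‖ ≤ r)
    (hM : ∀ y, ‖y - x‖ ≤ 6 * r → |g y| ≤ M) (a b : E n) :
    |D2 (Av om r (Av om r (Av om r g))) x' a b - D2 (Av om r (Av om r (Av om r g))) x a b|
      ≤ (cL n / r) ^ 3 * M * ‖a‖ * ‖b‖ * ‖x' - x‖ := by
  have hG := Av_cd ker_om (Av_cd ker_om hg r) r
  have hF := cont_D2 hG
  rw [Av_D2 ker_om hG, Av_D2 ker_om hG]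
  have := avLip (g := fun y => D2 (Av om r (Av om r g)) y a b) (M := (cL n / r) ^ 2 * M * ‖a‖ * ‖b‖) fpr hr hx fun y hy =>
    av2 hg hr (fun z hz => hM z (by
      have := norm_add_le (z - y) (y - x)
      rw [show z - y + (y - x) = z - x by abel] at this; linarith)) a b
  calc _ ≤ _ := this
    _ = _ := rng
lemma IB_swap (h1 : Ker ρ1) (h2 : Ker ρ2) {g : E n → Fu n} (hg : Continuous g.uncurry) :
    IB ρ1 (fun k => IB ρ2 (fun m => g k m)) = IB ρ2 (fun m => IB ρ1 (fun k => g k m)) := by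
  have c1 := h1.cont
  have c2 := h2.cont
  have hg' : Continuous fun p : E n × E n => g p.1 p.2 := hg
  have := integral_integral_swap_of_hasCompactSupport (μ := volume) (ν := volume) (f := fun k m => ρ1 k * (ρ2 m * g k m)) (by
    unfold uncurry; fun_prop) (HasCompactSupport.intro ((iCB 0 1).prod (iCB 0 1)) (by
      rintro ⟨k, m⟩ hk
      simp only [Set.mem_prod, not_and_or, mcz, not_le] at hk
      rcases hk with hk | hk
      · simp [h1.supp k hk.le]
      · simp [h2.supp m hk.le]))
  simp only [IB, ← integral_const_mul]
  rw [this]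
  congr 1; ext m; congr 1; ext k; ring
lemma Av_comm (hg : Continuous g) (r s : ℝ) (x : E n) : Av om r (Av om s g) x = Av om s (Av om r g) x := by
  have := IB_swap ker_om ker_om (g := fun k m : E n => g (x + r • k + s • m)) (by unfold uncurry; fun_prop)
  refine this.trans ?_
  simp only [Av]; congr 1; ext m; congr 1; ext k; congr 1; abel
lemma Av_zero (g : Fu n) (x : E n) : Av om 0 g x = g x := by simp [Av, IB_c]
lemma Av_deriv (hZ : CD Z) (x : E n) (s : ℝ) :
    HasDerivAt (fun s => Av om s Z x) (s * IB Wm (fun k => lap Z (x + s • k))) s := by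
  have h0 := hZ.continuous
  have h1 := cont_F hZ
  have := IB_hasF ker_om (H := ℝ) (V := ℝ) (F := fun s k => Z (x + s • k))
    (F' := fun s k => (ContinuousLinearMap.toSpanSingletonCLE (fd Z (x + s • k) k) : ℝ →L[ℝ] ℝ)) (by unfold uncurry; fun_prop)
    (by unfold uncurry; fun_prop) (fun s k => by
      have h2 : HasDerivAt (fun s : ℝ => x + s • k) k s := by
        simpa using ((hasDerivAt_id s).smul_const k).const_add x
      exact ((hasF hZ (x + s • k)).comp_hasDerivAt s h2).hasFDerivAt) s
  have h3 := this.hasDerivAt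
  rw [integral_apply (ker_om.int' fpr)] at h3
  simp only [sma, ContinuousLinearMap.toSpanSingletonCLE_apply_apply, one_smul] at h3
  rw [← ibp_ker hZ]
  exact h3
lemma av_le (hZ : CD Z) {s : ℝ} (hs : 0 ≤ s) (h : ∀ y, ‖y - x‖ ≤ s → lap Z y ≤ L) :
    Av om s Z x ≤ Z x + cW n / 2 * L * s ^ 2 := by
  have hcl := cont_lap hZ
  have hd : ∀ t, HasDerivAt (fun t => Av om t Z x - cW n / 2 * L * t ^ 2)
      (t * IB Wm (fun k => lap Z (x + t • k)) - cW n / 2 * L * (2 * t)) t := fun t => by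
    refine (Av_deriv hZ x t).sub ?_
    simpa using (hasDerivAt_pow 2 t).const_mul (cW n / 2 * L)
  have := antitoneOn_of_deriv_nonpos (convex_Icc 0 s) (f := fun t => Av om t Z x - cW n / 2 * L * t ^ 2)
    (fun t _ => (hd t).continuousAt.continuousWithinAt) (fun t _ => (hd t).differentiableAt.differentiableWithinAt) (fun t ht => by
      rw [(hd t).deriv]
      rw [interior_Icc] at ht
      have h1 : IB Wm (fun k => lap Z (x + t • k)) ≤ cW n * L := by
        rw [IB_Wm, ← IB_cn (n := n) L]
        refine mml (IB_mono ker_Wn fpr fpr fun k hk => h _ ?_) (cW_pos _).le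
        rw [add_sub_cancel_left, norm_smul, nnn ht.1.le]; nlinarith [ht.1, ht.2]
      nlinarith [mml h1 ht.1.le])
  have h2 := this (left_mem_Icc.2 hs) (right_mem_Icc.2 hs) hs
  simp only [Av_zero] at h2
  linarith
lemma Av_neg (g : Fu n) (s : ℝ) (x : E n) : Av om s (fun y => - g y) x = - Av om s g x := by
  simp only [Av]; rw [← neg_one_mul (IB _ _), ← IB_mul]; simp
lemma lap_neg (hZ : CD Z) (y : E n) : lap (fun y => - Z y) y = - lap Z y := by
  simp [lap, tr, D2_neg hZ]
lemma av_ge (hZ : CD Z) {s : ℝ} (hs : 0 ≤ s) (h : ∀ y, ‖y - x‖ ≤ s → L ≤ lap Z y) :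
    Z x + cW n / 2 * L * s ^ 2 ≤ Av om s Z x := by
  have := av_le hZ.neg (x := x) (L := -L) hs fun y hy => by
    rw [lap_neg hZ]; linarith [h y hy]
  rw [Av_neg] at this
  linarith
lemma om_low : ∃ c : ℝ, 0 < c ∧ ∀ k : E n, ‖k‖ ≤ 1 / 2 → c ≤ om k := by
  obtain ⟨k0, hk0, h⟩ := (iCB zE n (1 / 2)).exists_isMinOn ⟨0, by simp⟩ ker_om.cont.continuousOn
  refine ⟨om k0, ?_, fun k hk => h (by simpa using hk)⟩
  simp only [mcz] at hk0
  have h1 : 0 < 1 - ‖k0‖ ^ 2 := by nlinarith [norm_nonneg k0]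
  rw [om, om0, glu2]
  have := expNegInvGlue.pos_of_pos h1
  have := om0_int_pos (n := n)
  positivity
lemma fn_abs {f : ℝ} (hf : 0 < f) (n : ℕ) : |f ^ n - 1| ≤ n * 2 ^ n * (|f - 1| + |f - 1| ^ n) := by
  rcases Nat.eq_zero_or_pos n with rfl | hn
  · simp
  set t := |f - 1| with ht
  have ht0 : 0 ≤ t := abs_nonneg _
  have h1 : f ≤ 1 + t := by have := le_abs_self (f - 1); linarith
  have h2 : |f ^ n - 1| ≤ t * (n * (1 + t) ^ (n - 1)) := by
    rw [← mul_geom_sum f n, abs_mul]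
    refine mml ?_ ht0
    rw [abs_of_nonneg (sum_nonneg fun i _ => pvt)]
    calc ∑ i ∈ range n, f ^ i ≤ ∑ i ∈ range n, (1 + t) ^ (n - 1) := by
          refine sum_le_sum fun i hi => ?_
          have := mem_range.1 hi
          calc f ^ i ≤ (1 + t) ^ i := gcg
            _ ≤ _ := ppr lnr omg
      _ = _ := smp
  have h3 : t * (1 + t) ^ (n - 1) ≤ 2 ^ n * (t + t ^ n) := by
    have e : t * t ^ (n - 1) = t ^ n := by rw [← pow_succ']; congr 1; omega
    have h5 : (2:ℝ) ^ (n - 1) ≤ 2 ^ n := ppr nnm omg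
    have h6 : 0 ≤ t ^ n := pvt
    rcases le_total t 1 with h | h
    · have : (1 + t) ^ (n - 1) ≤ 2 ^ (n - 1) := by gcongr; linarith
      nlinarith [mml (this.trans h5) ht0, mul_nonneg (pow_pos (two_pos (α := ℝ)) n).le h6]
    · have : (1 + t) ^ (n - 1) ≤ 2 ^ (n - 1) * t ^ (n - 1) := by rw [← mul_pow]; gcongr; linarith
      have h7 := mml this ht0
      have : t * (2 ^ (n - 1) * t ^ (n - 1)) = 2 ^ (n - 1) * t ^ n := by rw [← e]; ring
      nlinarith [mmr h5 h6, pow_pos (two_pos (α := ℝ)) n]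
  calc _ ≤ _ := h2
    _ = n * (t * (1 + t) ^ (n - 1)) := rng
    _ ≤ n * (2 ^ n * (t + t ^ n)) := gcg
    _ = _ := rng
def cF (n : ℕ) (R : ℝ) : ℝ := n * 2 ^ n * (R ^ n * vB n + 2)
lemma int_fn (hn : 0 < n) (he : Err f δ) (hf : ∀ x, 0 < f x) (hδ : 0 < δ) (hδ1 : δ ≤ 1) (hR : 0 < R)
    (hS : S ⊆ MB 0 R) :
    ∫⁻ x in S, ofReal |f x ^ n - 1| ≤ ofReal (cF n R * δ) := by
  have hc := he.cont
  have hv := vB_pos n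
  set A : ℝ := n * 2 ^ n
  have hA : 0 ≤ A := pvt
  set c := 1 + (δ⁻¹) ^ (n - 1)
  have hcp : 0 ≤ c := pvt
  calc ∫⁻ x in S, ofReal |f x ^ n - 1| ≤ ∫⁻ x in S, (ofReal (A * δ) + ofReal (A * c) * ofReal (|f x - 1| ^ n)) := by
        refine lintegral_mono fun x => ?_
        simp only
        rw [← ofReal_mul pvt, ← ofReal_add pvt pvt]
        refine oRl ((fn_abs (hf x) n).trans ?_)
        have := young hn hδ (abs_nonneg (f x - 1))
        calc A * (|f x - 1| + |f x - 1| ^ n) ≤ A * ((δ + δ⁻¹ ^ (n - 1) * |f x - 1| ^ n) + |f x - 1| ^ n) := gcg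
          _ = _ := by simp only [c]; ring
    _ = ofReal (A * δ) * volume S + ofReal (A * c) * ∫⁻ x in S, ofReal (|f x - 1| ^ n) := by
        rw [lintegral_add_left fpr, lintegral_const_mul _ fpr]; simp
    _ ≤ ofReal (A * δ) * ofReal (R ^ n * vB n) + ofReal (A * c) * ofReal (δ ^ n) := by
        gcongr
        · rw [← vol_ball zE n hR]; exact measure_mono hS
        · exact he.lint S
    _ = ofReal (A * δ * (R ^ n * vB n) + A * c * δ ^ n) := by
        rw [← ofReal_mul pvt, ← ofReal_mul pvt, ← ofReal_add pvt pvt]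
    _ ≤ _ := by
        refine oRl ?_
        have e : (δ⁻¹) ^ (n - 1) * δ ^ n = δ := by
          obtain ⟨m, rfl⟩ : ∃ m, n = m + 1 := ⟨n - 1, by omega⟩
          simp only [Nat.add_sub_cancel]; rw [pow_succ, ← mul_assoc, ← mul_pow, imc hδ.ne']; simp
        have e2 : δ ^ n ≤ δ := by
          calc δ ^ n ≤ δ ^ 1 := pow_le_pow_of_le_one hδ.le hδ1 hn
            _ = δ := pow_one _
        have : c * δ ^ n ≤ 2 * δ := by simp only [c]; rw [add_mul, e]; linarith
        calc A * δ * (R ^ n * vB n) + A * c * δ ^ n = A * δ * (R ^ n * vB n) + A * (c * δ ^ n) := rng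
          _ ≤ A * δ * (R ^ n * vB n) + A * (2 * δ) := gcg
          _ = _ := by simp only [cF, A]; ring
lemma mass_le (hn : 0 < n) (hv : CD v) (hp : ∀ x a, a ≠ 0 → 0 < D2 v x a a)
    (hd : ∀ x, (mat (D2 v x)).det = f x ^ n) (hf : ∀ x, 0 < f x) (he : Err f δ) (hδ : 0 < δ) (hδ1 : δ ≤ 1) (hR : 0 < R)
    (hS : MeasurableSet S) (hSR : S ⊆ MB 0 R) :
    volume (gr v '' S) ≤ volume S + ofReal (cF n R * δ) := by
  rw [← area hv hp hd hf hS]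
  have hc := he.cont
  calc ∫⁻ x in S, ofReal (f x ^ n) ≤ ∫⁻ x in S, (1 + ofReal |f x ^ n - 1|) := by
        refine lintegral_mono fun x => ?_
        simp only
        rw [← ofReal_one, ← ofReal_add nnm pvt]
        exact oRl (by linarith [le_abs_self (f x ^ n - 1)])
    _ = volume S + ∫⁻ x in S, ofReal |f x ^ n - 1| := by rw [lintegral_add_left fpr]; simp
    _ ≤ _ := by gcongr; exact int_fn hn he hf hδ hδ1 hR hSR
lemma IB_pos (h : Ker ρ) (h1 : IB ρ (fun _ => 1) = 1) (hg : Continuous g) (hp : ∀ k, 0 < g k) :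
    0 < IB ρ g := by
  obtain ⟨k0, hk0, hm⟩ := (iCB zE n 1).exists_isMinOn ⟨0, by simp⟩ hg.continuousOn
  have : IB ρ (fun _ => g k0) ≤ IB ρ g := IB_mono h fpr hg fun k hk => hm (by simpa using hk.le)
  rw [IB_const, h1, mul_one] at this
  exact (hp k0).trans_le this
lemma low_eig (hs : Sym Q) (hp : Psd Q) (hd : 0 < d) (hdet : d ≤ (mat Q).det) (hL : tr Q ee ≤ L) (hL1 : 1 ≤ L) (a : E n) :
    d / (n * L) ^ n * ‖a‖ ^ 2 ≤ Q a a := by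
  obtain ⟨v, l, hv⟩ := diag hs
  have hl0 : ∀ i, 0 ≤ l i := fun i => by have := hp (v i); simpa [hv] using this
  have hl1 : ∀ i, l i ≤ n * L := fun i => by
    have := psd_le_tr hs hp (v i)
    rw [v.orthonormal.1 i, hv] at this
    simp at this
    exact this.trans gcg
  have hu : (frM v).det ^ 2 = 1 := by
    have h := UF_of_gram (Q := innerSL ℝ) (b := v) (f := 1) one_pos (by
      have : mat (innerSL ℝ : BL n) = 1 := by
        ext i j
        change inr (ee i : E n) (ee j) = _
        simp [ee, Matrix.one_apply, inner_single_left, Pi.single_apply]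
      rw [this]; simp) (fun i j => v.inner_eq_ite i j)
    exact h
  have hdet2 : d ≤ ∏ i, l i := by
    have h1 := det_gram Q v
    have : (Matrix.of fun i j => Q (v i) (v j)) = diagonal l := by
      ext i j; rw [of_apply, hv, diagonal_apply]
    rw [this, det_diagonal, hu, one_mul] at h1
    rw [h1]; exact hdet
  have hlow : ∀ i, d / (n * L) ^ n ≤ l i := fun i => by
    have hn1 : (1:ℝ) ≤ n := by exact_mod_cast (Fin.pos i)
    have hnL : 1 ≤ n * L := by nlinarith
    rw [dli pvt]
    rw [← Finset.mul_prod_erase _ _ (Finset.mem_univ i)] at hdet2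
    refine hdet2.trans (mml ?_ (hl0 i))
    calc ∏ x ∈ Finset.univ.erase i, l x ≤ ∏ x ∈ Finset.univ.erase i, (n * L) := Finset.prod_le_prod (fun j _ => hl0 j) fun j _ => hl1 j
      _ = (n * L) ^ (n - 1) := smp
      _ ≤ _ := ppr hnL omg
  have e : Q a a = ∑ i, l i * (inr (v i) a) ^ 2 := by
    conv_lhs => rw [← v.sum_repr a]
    simp only [map_sum, map_smul, sum_apply, smul_apply, sem, hv]
    simp [v.repr_apply_apply]
    refine sum_congr rfl fun i _ => rng
  have e2 : ‖a‖ ^ 2 = ∑ i, (inr (v i) a) ^ 2 := by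
    rw [← v.sum_sq_norm_inner_right a]; simp
  rw [e, e2, mul_sum]
  exact sum_le_sum fun i _ => mmr (hlow i) pvt
lemma img_sub (hv : CD v) {s : ℝ} (hs : 0 < s)
    (h : ∀ z, ‖z - x‖ = s → v x + inr p (z - x) < v z) : ∃ z, ‖z - x‖ < s ∧ gr v z = p := by
  have hc : Continuous fun z => v z - inr p z := by have := hv.continuous; fun_prop
  obtain ⟨z, hz, hmin⟩ := (iCB x s).exists_isMinOn ⟨x, by simp [hs.le]⟩ hc.continuousOn
  rw [mcB] at hz
  have h1 : v z - inr p z ≤ v x - inr p x := hmin (mem_closedBall_self hs.le)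
  have hlt : ‖z - x‖ < s := by
    rcases hz.lt_or_eq with h2 | h2
    · exact h2
    · have := h z h2; rw [inner_sub_right] at this; linarith
  refine ⟨z, hlt, ?_⟩
  have hl : IsLocalMin (fun z => v z - inr p z) z := by
    refine Filter.mem_of_superset (isOpen_ball.mem_nhds (by rw [mem_ball_iff_norm]; exact hlt : z ∈ MB x s)) ?_
    exact fun w hw => hmin (ball_subset_closedBall hw)
  have hd : HasFDerivAt (fun z => v z - inr p z) (fd v z - innerSL ℝ p) z :=
    (hasF hv z).sub (innerSL ℝ p).hasFDerivAt
  have h0 := hl.hasFDerivAt_eq_zero hd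
  refine ext_inner_right ℝ fun w => ?_
  rw [gr_inner]
  have := congrArg (fun L : E n →L[ℝ] ℝ => L w) h0
  simp at this
  linarith
lemma uconv (hy : CD y) (hS : Convex ℝ S) (h : ∀ x ∈ S, ∀ a, l * ‖a‖ ^ 2 ≤ D2 y x a a) {z : E n} (hx : x ∈ S) (hz : z ∈ S) :
    y x + fd y x (z - x) + l / 2 * ‖z - x‖ ^ 2 ≤ y z := by
  have c2 : CD (fun x : E n => l / 2 * ‖x‖ ^ 2) := contDiff_const.mul cd_nsq
  have := grad_ineq (w := fun x => y x - l / 2 * ‖x‖ ^ 2) (hy.sub c2) hS (fun w hw a => by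
    have e := D2_nsq w a a
    rw [ris] at e
    rw [D2_sub hy c2, D2_smul cd_nsq]
    simp only [sba, sma, sem, e]
    linarith [h w hw a]) hx hz
  have e : fd (fun x => y x - l / 2 * ‖x‖ ^ 2) x (z - x) = fd y x (z - x) - l * inr x (z - x) := by
    have := ((hasF hy x).sub ((hasF_nsq x).const_mul (l / 2))).fderiv
    change fd (y - fun x => l / 2 * ‖x‖ ^ 2) x (z - x) = _
    rw [this]
    simp; ring
  rw [e] at this
  have e2 : ‖z - x‖ ^ 2 = ‖z‖ ^ 2 - ‖x‖ ^ 2 - 2 * inr x (z - x) := by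
    rw [norm_sub_sq_real, inner_sub_right, ris, real_inner_comm]; ring
  rw [e2]; linarith
structure YD (ϱ Λ K Cd r ε : ℝ) (v y g : Fu n) : Prop where
  cd : CD y
  pos : ∀ x a, a ≠ 0 → 0 < D2 y x a a
  gc : Continuous g
  gpos : ∀ x, 0 < g x
  det : ∀ x, (mat (D2 y x)).det = g x ^ n
  lap : ∀ x, ‖x‖ ≤ ϱ → lap y x ≤ Λ
  glo : ∀ x, 1 - ε ≤ g x
  vy : ∀ x, ‖x‖ ≤ ϱ → v x ≤ y x ∧ y x ≤ v x + Cd * r ^ 2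
  fr : ∀ x, ‖x‖ ≤ ϱ → ∃ b, UF b ∧ (∀ i, ‖b i‖ ≤ K) ∧ ∀ i j, D2 y x (b i) (b j) = if i = j then g x else 0
  exc : ∫⁻ x in MB 0 ϱ, ofReal ((max (g x - 1) 0) ^ n) ≤ ofReal (ε ^ n)
lemma NData.q (h : NData c1 C0 δ v f) (hx : ‖x‖ ≤ c1 / 4) : v x ≤ 1 / 4 := by
  have h1 := supp_plane h.cd h.psd x 0
  have h2 := supp_plane h.cd h.psd x ((4:ℝ) • x)
  have h3 := h.sup 0 ((4:ℝ) • x) (by rw [h.v0]; norm_num) (by rw [sub_zero, norm_smul]; norm_num; linarith)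
  rw [show (4:ℝ) • x - x = (3:ℝ) • x by module, map_smul, sem] at h2
  rw [zero_sub, map_neg, h.v0] at h1
  linarith
lemma y_lap (hv : CD v) (hp : ∀ x, Psd (D2 v x)) (hr : 0 < r)
    (h : Av om (2 * r) v x - v x ≤ M * r ^ 2) : lap (Av Wn r v) x ≤ M / cW n := by
  have hc := cW_pos n
  have h1 := Av_step hv hp x r (2 * r)
  have h2 := Av_ge ker_om om_one hv hp x r
  have h3 : lap (Av Wn r v) x = IB Wn (fun k => lap v (x + r • k)) := Av_tr ker_Wn hv r x ee
  rw [h3, ldi hc, mul_comm, ← IB_Wm]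
  have h4 : r ^ 2 * IB Wm (fun k => lap v (x + r • k)) ≤ r ^ 2 * M := lnr
  exact le_of_mul_le_mul_left h4 pvt
lemma Wn_le (hg : Continuous g) (h0 : ∀ k, ‖k‖ < 1 → 0 ≤ g k) : IB Wn g ≤ IB om g / (2 * cW n) := by
  have hc := cW_pos n
  have := IB_Wm_le hg h0
  rw [IB_Wm] at this
  rw [ldi pvt]; linarith
lemma y_up (hv : CD v) (hp : ∀ x, Psd (D2 v x)) (hr : 0 < r)
    (h : Av om (2 * r) v x - v x ≤ M * r ^ 2) : Av Wn r v x ≤ v x + M / (2 * cW n) * r ^ 2 := by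
  have hcc := hv.continuous
  have hc := cW_pos n
  have h1 := Wn_le (g := fun k => v (x + r • k) - (v x + fd v x (r • k))) fpr (fun k _ => by
    have := supp_plane hv hp x (x + r • k); simp at this ⊢; linarith)
  have h3 : IB om (fun k => v (x + r • k) - (v x + fd v x (r • k))) = Av om r v x - v x := by
    rw [IB_sub ker_om fpr fpr, IB_add ker_om fpr fpr, IB_c, IB_odd (g := fun k => fd v x (r • k)) ker_om (fun k => smp)]
    simp [Av]
  have h4 : IB Wn (fun k => v (x + r • k) - (v x + fd v x (r • k))) = Av Wn r v x - v x := by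
    rw [IB_sub ker_Wn fpr fpr, IB_add ker_Wn fpr fpr, IB_cn, IB_odd (g := fun k => fd v x (r • k)) ker_Wn (fun k => smp)]
    simp [Av]
  rw [h3, h4] at h1
  have h5 := Av_mono hv hp x hr.le (by linarith : r ≤ 2 * r)
  have h6 : (Av om r v x - v x) / (2 * cW n) ≤ (M * r ^ 2) / (2 * cW n) := by gcongr; linarith
  have : (M * r ^ 2) / (2 * cW n) = M / (2 * cW n) * r ^ 2 := rng
  linarith
lemma y_lo (hn : 0 < n) {e : ℝ} (hv : CD v) (hp : ∀ x a, a ≠ 0 → 0 < D2 v x a a)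
    (hd : ∀ x, (mat (D2 v x)).det = f x ^ n) (hf : ∀ x, 0 < f x) (hfc : Continuous f) (he : IB om (fun k => |f (x + r • k) - 1|) ≤ 2 * cW n * e) {g : ℝ} (hg : 0 < g) (hdet : (mat (D2 (Av Wn r v) x)).det = g ^ n)
    (hpos : ∀ a, a ≠ 0 → 0 < D2 (Av Wn r v) x a a) : 1 - e ≤ g := by
  have hc := cW_pos n
  have hD := cont_D2 hv
  have hn' : (0:ℝ) < n := by exact_mod_cast hn
  obtain ⟨b, hb, hb'⟩ := frame (D2_symm (Av_cd ker_Wn hv r) x) hpos hg hdet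
  have h1 := tr_frame hb'
  rw [Av_tr ker_Wn hv] at h1
  have h2 : IB Wn (fun k => n * (1 - |f (x + r • k) - 1|)) ≤ n * g := by
    rw [← h1]
    refine IB_mono ker_Wn fpr (by unfold tr; fun_prop) fun k _ => ?_
    have := amgm hn (D2_symm hv (x + r • k)) (psd_of_pos (hp _)) hb (hf _).le (hd _).symm
    refine le_trans (mml ?_ hn'.le) this
    linarith [neg_abs_le (f (x + r • k) - 1)]
  rw [IB_mul, IB_sub ker_Wn fpr fpr, IB_cn] at h2
  have h3 := le_of_mul_le_mul_left h2 hn'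
  have h4 := Wn_le (g := fun k => |f (x + r • k) - 1|) fpr (fun k _ => abs_nonneg _)
  have h5 : IB om (fun k => |f (x + r • k) - 1|) / (2 * cW n) ≤ e := by rw [dli pvt]; linarith
  linarith
lemma exc_pt (hn : 0 < n) {g e : ℝ} (hg : 0 < g) (he : 1 - e ≤ g) (he0 : 0 ≤ e) (he1 : e ≤ 1) :
    (max (g - 1) 0) ^ n + 1 ≤ g ^ n + n * e := by
  have hne : 0 ≤ n * e := pvt
  rcases le_total 1 g with h | h
  · rw [max_eq_left lnr]
    have := pow_add_pow_le (by linarith : 0 ≤ g - 1) zero_le_one hn.ne'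
    simp at this; linarith
  · rw [max_eq_right lnr, zero_pow hn.ne']
    have h1 := one_add_mul_le_pow (by linarith : -2 ≤ -e) n
    have h2 : (1 + -e) ^ n ≤ g ^ n := ppl lnr lnr n
    linarith
lemma exc_int (hn : 0 < n) {e s : ℝ} (hgc : Continuous g) (hg : ∀ x, 0 < g x) (hϱ : 0 < ϱ) (hs : 0 < s)
    (he : ∀ x, 1 - e ≤ g x) (he0 : 0 ≤ e) (he1 : e ≤ 1) (hY : 0 ≤ Y)
    (hm : ∫⁻ x in MB 0 ϱ, ofReal (g x ^ n) ≤ volume (MB zE n (ϱ + s)) + ofReal Y)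
    (hX : ((ϱ + s) ^ n - ϱ ^ n) * vB n + Y + n * e * (ϱ ^ n * vB n) ≤ X) :
    ∫⁻ x in MB 0 ϱ, ofReal ((max (g x - 1) 0) ^ n) ≤ ofReal X := by
  have hv := vB_pos n
  have h1 : (∫⁻ x in MB 0 ϱ, ofReal ((max (g x - 1) 0) ^ n)) + volume (MB zE n ϱ) ≤
      (∫⁻ x in MB 0 ϱ, ofReal (g x ^ n)) + ofReal (n * e) * volume (MB zE n ϱ) := by
    calc _ = ∫⁻ x in MB 0 ϱ, (ofReal ((max (g x - 1) 0) ^ n) + 1) := by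
          rw [lintegral_add_right _ fpr]; simp
      _ ≤ ∫⁻ x in MB 0 ϱ, (ofReal (g x ^ n) + ofReal (n * e)) := by
          refine lintegral_mono fun x => ?_
          have := hg x
          simp only
          rw [← ofReal_one, ← ofReal_add pvt nnm, ← ofReal_add pvt pvt]
          exact oRl (exc_pt hn (hg x) (he x) he0 he1)
      _ = _ := by rw [lintegral_add_right _ fpr]; simp
  rw [vol_ball _ hϱ] at h1
  rw [vol_ball _ pvt] at hm
  rw [← ofReal_mul pvt] at h1
  have h2 := h1.trans (add_le_add_left hm _)
  rw [← ofReal_add pvt pvt, ← ofReal_add pvt pvt] at h2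
  have h3 := ENNReal.le_sub_of_add_le_right ofReal_ne_top h2
  rw [← ENNReal.ofReal_sub _ pvt] at h3
  exact h3.trans (oRl lnr)
lemma ball_diff (n : ℕ) (hε : 0 < ε) : ∃ r0, 0 < r0 ∧ ∀ r, 0 < r → r ≤ r0 → ((ϱ + C * r) ^ n - ϱ ^ n) * vB n ≤ ε := by
  have hc : ContinuousAt (fun r : ℝ => ((ϱ + C * r) ^ n - ϱ ^ n) * vB n) 0 := fpr
  have h0 : ∀ᶠ r in nhds (0:ℝ), ((ϱ + C * r) ^ n - ϱ ^ n) * vB n < ε := hc.eventually_lt continuousAt_const (by simpa using hε)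
  obtain ⟨d, hd, h⟩ := Metric.eventually_nhds_iff.1 h0
  exact ⟨d / 2, by positivity, fun r hr hr' => (h (by rw [Real.dist_eq, sub_zero, aop hr]; linarith)).le⟩
lemma det_pos (hs : Sym Q) (hp : ∀ a, a ≠ 0 → 0 < Q a a) : 0 < (mat Q).det := by
  obtain ⟨v, l, hv⟩ := diag hs
  have hl : ∀ i, 0 < l i := fun i => by
    have := hp (v i) (v.orthonormal.ne_zero i)
    simpa [hv] using this
  have h := det_gram Q v
  rw [show (Matrix.of fun i j => Q (v i) (v j)) = diagonal l by ext i j; simp [hv, diagonal_apply], det_diagonal] at h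
  have h2 : 0 < ∏ i, l i := Finset.prod_pos fun i _ => hl i
  rw [h] at h2
  exact pos_of_mul_pos_right h2 (sq_nonneg _)
lemma kle {K : ℝ} (hK : 1 ≤ K) (h : a ^ 2 ≤ K) : a ≤ K := by nlinarith
theorem P4 (hn : 3 ≤ n) (hc1 : 0 < c1) (hc1' : c1 ≤ 1) (hC0 : 1 ≤ C0) :
    ∃ Λ K Cd : ℝ, 1 ≤ Λ ∧ 1 ≤ K ∧ 0 < Cd ∧ ∀ ε r1, 0 < ε → 0 < r1 → ∃ r δ0, 0 < r ∧ r ≤ r1 ∧ 0 < δ0 ∧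
      ∀ (δ : ℝ) (v f : Fu n), 0 < δ → δ ≤ δ0 → NData c1 C0 δ v f → ∃ y g, YD (c1 / 8) Λ K Cd r ε v y g := by
  obtain ⟨Λ0, κ0, hΛ0, hκ0, hP3⟩ := P3 hn hc1 hc1' hC0
  obtain ⟨Ce, hCe, hav⟩ := avg_err (n := n)
  have hn0 : 0 < n := omg
  have hn1 : (1:ℝ) ≤ n := by exact_mod_cast hn0
  have hc := cW_pos n
  have hv := vB_pos n
  set Λ := max 1 (64 * Λ0 / cW n) with hΛ
  have hΛ1 : 1 ≤ Λ := le_max_left _ _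
  set l : ℝ := (1 / 2) ^ n / (n * Λ) ^ n with hl
  have hl0 : 0 < l := pvt
  set Cd := 64 * Λ0 / (2 * cW n) with hCd
  have hCd0 : 0 < Cd := pvt
  set C' := Cd / l + 2 with hC'
  have hC'0 : 0 < C' := pvt
  have hC'2 : Cd < l / 2 * C' ^ 2 := by
    have h1 : l * (Cd / l) = Cd := by field_simp
    have h3 : l / 2 * C' ^ 2 = l * (Cd / l) ^ 2 / 2 + 2 * (l * (Cd / l)) + 2 * l := by rw [hC']; ring
    have h2 : 0 ≤ l * (Cd / l) ^ 2 := pvt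
    rw [h3, h1]; linarith
  refine ⟨Λ, max 1 (Λ / l), Cd, hΛ1, le_max_left _ _, hCd0, fun ε r1 hε hr1 => ?_⟩
  obtain ⟨r2, hr2, hball⟩ := ball_diff (ϱ := c1 / 8) (C := C') n (by positivity : 0 < ε ^ n / 3)
  set r := min (min r1 r2) (min (κ0 / 8) (c1 / 8 / C')) with hr
  have hr0 : 0 < r := pvt
  have hrr1 : r ≤ r1 := (mll _ _).trans (mll _ _)
  have hrr2 : r ≤ r2 := (mll _ _).trans (mlr _ _)
  have hrk : 8 * r ≤ κ0 := by have : r ≤ κ0 / 8 := (mlr _ _).trans (mll _ _); linarith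
  have hrc : C' * r ≤ c1 / 8 := by
    have : r ≤ c1 / 8 / C' := (mlr _ _).trans (mlr _ _)
    rw [ldi hC'0] at this; linarith
  obtain ⟨δ1, hδ1, hP⟩ := hP3 (8 * r) pvt hrk
  set A := n * ((c1 / 8) ^ n * vB n) with hA
  have hA0 : 0 < A := pvt
  set e := min (min ε (1 / 2)) (ε ^ n / 3 / A) with he
  have he0 : 0 < e := pvt
  have heε : e ≤ ε := (mll _ _).trans (mll _ _)
  have he2 : e ≤ 1 / 2 := (mll _ _).trans (mlr _ _)
  have heA : e * A ≤ ε ^ n / 3 := by rw [← ldi hA0]; exact mlr _ _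
  set F := cF n (c1 / 4 + 1) with hF
  have hF0 : 0 < F := by rw [hF, cF]; positivity
  set δ0 := min (min δ1 1) (min (2 * cW n * e * r / Ce) (ε ^ n / 3 / F)) with hδ0
  refine ⟨r, δ0, hr0, hrr1, by positivity, fun δ v f hδ hδ' hN => ?_⟩
  have hd1 : δ ≤ δ1 := hδ'.trans ((mll _ _).trans (mll _ _))
  have hd2 : δ ≤ 1 := hδ'.trans ((mll _ _).trans (mlr _ _))
  have hd3 : Ce * δ / r ≤ 2 * cW n * e := by
    have : δ ≤ 2 * cW n * e * r / Ce := hδ'.trans ((mlr _ _).trans (mll _ _))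
    rw [ldi hCe] at this
    rw [dli hr0]; linarith
  have hd4 : F * δ ≤ ε ^ n / 3 := by
    have : δ ≤ ε ^ n / 3 / F := hδ'.trans ((mlr _ _).trans (mlr _ _))
    rw [ldi hF0] at this; linarith
  have h3 : ∀ x, ‖x‖ ≤ c1 / 4 → Av om (2 * r) v x - v x ≤ 64 * Λ0 * r ^ 2 := fun x hx => by
    have := hP δ v f hδ hd1 hN x (hN.q hx)
    rw [show 8 * r / 4 = 2 * r by ring] at this
    linarith
  have hvc := hN.cd
  have hps := hN.psd
  set y := Av Wn r v with hy
  have hycd : CD y := Av_cd ker_Wn hvc r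
  have hD := cont_D2 hvc
  have hypos : ∀ x a, a ≠ 0 → 0 < D2 y x a a := fun x a ha => by
    rw [hy, Av_D2 ker_Wn hvc]
    exact IB_pos ker_Wn Wn_one fpr fun k => hN.pos _ a ha
  have hysym := fun x => D2_symm hycd x
  have hypsd := fun x => psd_of_pos (hypos x)
  have hdp : ∀ x, 0 < (mat (D2 y x)).det := fun x => det_pos (hysym x) (hypos x)
  obtain ⟨g, hg⟩ := exF (fun x => ((mat (D2 y x)).det) ^ ((n:ℝ)⁻¹))
  have hgc : Continuous g := by rw [hg]; exact (cont_mat_det hycd).rpow_const (fun x => Or.inl (hdp x).ne')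
  have hgp : ∀ x, 0 < g x := fun x => by rw [hg]; exact rpow_pos_of_pos (hdp x) _
  have hgd : ∀ x, (mat (D2 y x)).det = g x ^ n := fun x => by
    rw [hg]; exact (rpow_inv_natCast_pow (hdp x).le hn0.ne').symm
  have hglo : ∀ x, 1 - e ≤ g x := fun x =>
    y_lo hn0 hvc hN.pos hN.det hN.fpos hN.err.cont ((hav f δ x r hn0 hN.err hδ hr0).trans hd3) (hgp x) (hgd x) (hypos x)
  have hlap : ∀ x, ‖x‖ ≤ c1 / 4 → lap y x ≤ Λ := fun x hx =>
    (y_lap hvc hps hr0 (h3 x hx)).trans (le_max_right _ _)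
  have hvy : ∀ x, ‖x‖ ≤ c1 / 4 → v x ≤ y x ∧ y x ≤ v x + Cd * r ^ 2 := fun x hx =>
    ⟨Av_ge ker_Wn Wn_one hvc hps x r, y_up hvc hps hr0 (h3 x hx)⟩
  have hlow : ∀ x, ‖x‖ ≤ c1 / 4 → ∀ a, l * ‖a‖ ^ 2 ≤ D2 y x a a := fun x hx a => by
    refine low_eig (hysym x) (hypsd x) pvt ?_ (hlap x hx) hΛ1 a
    rw [hgd]
    exact ppl nnm (by linarith [hglo x]) n
  refine ⟨y, g, hycd, hypos, hgc, hgp, hgd, fun x hx => hlap x lnr, fun x => by linarith [hglo x],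
    fun x hx => hvy x lnr, fun x hx => ?_, ?_⟩
  · obtain ⟨b, hb, hb2⟩ := frame (hysym x) (hypos x) (hgp x) (hgd x)
    refine ⟨b, hb, fun i => ?_, hb2⟩
    have h1 := hlow x lnr (b i)
    rw [hb2, if_pos rfl] at h1
    have h2 := amgm hn0 (hysym x) (hypsd x) UF_ee (hgp x).le (hgd x).symm
    have h4 : tr (D2 y x) ee ≤ Λ := hlap x lnr
    have h5 : ‖b i‖ ^ 2 ≤ Λ / l := by
      rw [ldi hl0]
      have h1n : (1:ℝ) ≤ n := by exact_mod_cast hn0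
      linarith [le_mul_of_one_le_left (hgp x).le h1n]
    have h6 : Λ / l ≤ max 1 (Λ / l) := le_max_right _ _
    have h7 : (1:ℝ) ≤ max 1 (Λ / l) := le_max_left _ _
    exact kle h7 (h5.trans h6)
  · have hinc : gr y '' MB 0 (c1 / 8) ⊆ gr v '' MB 0 (c1 / 8 + C' * r) := by
      rintro _ ⟨x, hx, rfl⟩
      rw [mbz] at hx
      obtain ⟨z, hz, hz2⟩ := img_sub hvc (p := gr y x) (x := x) (s := C' * r) pvt (fun z hz => by
        have hz4 : ‖z‖ ≤ c1 / 4 := by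
          have := norm_add_le x (z - x)
          rw [add_sub_cancel] at this; linarith
        have h1 := uconv hycd (convex_closedBall zE n (c1 / 4)) (l := l) (fun w hw => hlow w (by simpa using hw))
          (x := x) (z := z) (by simp; linarith) (by simpa using hz4)
        rw [gr_inner]
        rw [hz] at h1
        have h2 := (hvy z hz4).2
        have h4 := (hvy x lnr).1
        have h5 : Cd * r ^ 2 < l / 2 * C' ^ 2 * r ^ 2 := mul_lt_mul_of_pos_right hC'2 pvt
        have h6 : l / 2 * (C' * r) ^ 2 = l / 2 * C' ^ 2 * r ^ 2 := rng
        linarith)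
      refine ⟨z, ?_, hz2⟩
      rw [mbz]
      have := norm_add_le x (z - x)
      rw [add_sub_cancel] at this; linarith
    refine exc_int hn0 (s := C' * r) (Y := F * δ) hgc hgp pvt pvt hglo he0.le lnr pvt ?_ ?_
    · rw [area hycd hypos hgd hgp isOpen_ball.measurableSet]
      refine (measure_mono hinc).trans ?_
      exact mass_le hn0 hvc hN.pos hN.det hN.fpos hN.err hδ hd2 pvt isOpen_ball.measurableSet
        (ball_subset_ball lnr)
    · have h1 := hball r hr0 hrr2
      have h2 : n * e * ((c1 / 8) ^ n * vB n) = e * A := by rw [hA]; ring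
      rw [h2]; linarith
structure SS (P K δ : ℝ) (s e : Fu n) : Prop where
  cd : CD s
  nonneg : ∀ x, ‖x‖ ≤ P → 0 ≤ s x
  e0 : ∀ x, 0 ≤ e x
  fr : ∀ x, ‖x‖ ≤ P → ∃ b, UF b ∧ (∀ i, ‖b i‖ ≤ K) ∧ tr (D2 s x) b ≤ e x
  ei : ∫⁻ x in closedBall 0 P, ofReal (e x ^ n) ≤ ofReal (δ ^ n)
def qK (n : ℕ) (K : ℝ) : ℝ := n ^ 2 * (n.factorial * K ^ n) ^ 2
def bar (A β c : ℝ) (z x : E n) : ℝ := A * (exp (-β * ‖x - z‖ ^ 2) - c)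
lemma bar_cd (A β c : ℝ) (z : E n) : CD (bar A β c z) := by
  have h1 : CD (fun x : E n => ‖x - z‖ ^ 2) := cd_nsq.comp (contDiff_id.sub contDiff_const)
  unfold bar
  exact contDiff_const.mul ((Real.contDiff_exp.comp (contDiff_const.mul h1)).sub contDiff_const)
lemma bar_D2 (A β c : ℝ) (z x a : E n) :
    D2 (bar A β c z) x a a = A * exp (-β * ‖x - z‖ ^ 2) * (4 * β ^ 2 * inr (x - z) a ^ 2 - 2 * β * ‖a‖ ^ 2) := by
  have h := D2_shift (v := fun y => bar A β c 0 y) (bar_cd A β c 0) (-z) x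
  have h0 : (fun y => bar A β c 0 (y + -z)) = bar A β c z := by ext y; simp [bar, sub_eq_add_neg]
  rw [h0] at h
  rw [h]
  have h2 := D2_gcomp (w := fun y : E n => ‖y‖ ^ 2) cd_nsq (g := fun t => A * (exp (-β * t) - c))
    (g' := fun t => A * (exp (-β * t) * (-β))) (g'' := fun t => A * (exp (-β * t) * (-β) * (-β)))
    (fun t => by
      have := (((hasDerivAt_id t).const_mul (-β)).exp.sub_const c).const_mul A
      simpa using this)
    (fun t => by
      have := ((((hasDerivAt_id t).const_mul (-β)).exp).mul_const (-β)).const_mul A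
      simpa using this) (x + -z) a a
  have h3 : (fun y : E n => bar A β c 0 y) = fun y => A * (exp (-β * ‖y‖ ^ 2) - c) := by ext y; simp [bar]
  rw [h3, h2, D2_nsq, (hasF_nsq _).fderiv, ris]
  simp only [sma, sem, innerSL_apply_apply, sub_eq_add_neg]
  ring
lemma inner_tr (hb : UF b) {K : ℝ} (hK : 1 ≤ K) (h : ∀ i, ‖b i‖ ≤ K) (X : E n) :
    ‖X‖ ^ 2 ≤ qK n K * ∑ i, inr X (b i) ^ 2 := by
  let Q : BL n := ((innerSL ℝ X).smulRight (innerSL ℝ X))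
  have hQ : ∀ a b, Q a b = inr X a * inr X b := fun a b => by simp [Q]
  have h1 := tr_ee_le (Q := Q) (fun a b => by rw [hQ, hQ, mul_comm]) (fun a => by rw [hQ]; exact mul_self_nonneg _) hb hK h
  have h2 : tr Q ee = ‖X‖ ^ 2 := by
    simp only [tr, hQ]
    rw [norm_sq_eq]
    refine sum_congr rfl fun i _ => ?_
    simp [ee, EuclideanSpace.inner_single_right, sq]
  have h3 : tr Q b = ∑ i, inr X (b i) ^ 2 := sum_congr rfl fun i _ => by rw [hQ, sq]
  rw [h2, h3] at h1
  exact h1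
lemma bar_tr {K : ℝ} (hA : 0 ≤ A) (hβ : 0 ≤ β) (hb : UF b) (hK : 1 ≤ K) (h : ∀ i, ‖b i‖ ≤ K) (z x : E n) :
    -(2 * A * β * n * K ^ 2) ≤ tr (D2 (bar A β c z) x) b ∧
    (qK n K * n * K ^ 2 ≤ 2 * β * ‖x - z‖ ^ 2 → 0 ≤ tr (D2 (bar A β c z) x) b) := by
  have h1 : tr (D2 (bar A β c z) x) b = A * exp (-β * ‖x - z‖ ^ 2) *
      (4 * β ^ 2 * (∑ i, inr (x - z) (b i) ^ 2) - 2 * β * ∑ i, ‖b i‖ ^ 2) := by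
    simp only [tr, bar_D2, mul_sum, ← sum_sub_distrib]
  have h2 : ∑ i, ‖b i‖ ^ 2 ≤ n * K ^ 2 := by
    calc ∑ i, ‖b i‖ ^ 2 ≤ ∑ i : Fin n, K ^ 2 := sum_le_sum fun i _ => ppl (norm_nonneg _) (h i) 2
      _ = _ := smp
  have h3 := inner_tr hb hK h (x - z)
  have h0 : 0 ≤ ∑ i, inr (x - z) (b i) ^ 2 := sum_nonneg fun i _ => sq_nonneg _
  set T := ∑ i, inr (x - z) (b i) ^ 2
  set B := ∑ i, ‖b i‖ ^ 2
  have hB : 0 ≤ B := sum_nonneg fun i _ => sq_nonneg _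
  have he0 := exp_pos (-β * ‖x - z‖ ^ 2)
  have he1 : exp (-β * ‖x - z‖ ^ 2) ≤ 1 := exp_le_one_iff.2 (by nlinarith [sq_nonneg ‖x - z‖])
  set ex := exp (-β * ‖x - z‖ ^ 2)
  rw [h1]
  constructor
  · have h4 : A * ex * (2 * β * B) ≤ A * 1 * (2 * β * (n * K ^ 2)) := gcg
    have h5 : 0 ≤ A * ex * (4 * β ^ 2 * T) := pvt
    linarith
  · intro h6
    refine mul_nonneg pvt ?_
    have hq : 0 ≤ qK n K := by unfold qK; positivity
    have h7 : qK n K * (n * K ^ 2) ≤ qK n K * (2 * β * T) := by nlinarith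
    rcases hq.eq_or_lt with hq0 | hq0
    · rw [← hq0, zero_mul] at h3
      have hn0 : n = 0 := by
        by_contra hn
        have : 0 < qK n K := by
          unfold qK
          have : (0:ℝ) < n := by exact_mod_cast Nat.pos_of_ne_zero hn
          have : (0:ℝ) < n.factorial := by exact_mod_cast n.factorial_pos
          positivity
        linarith
      subst hn0
      have : B ≤ 0 := by simpa using h2
      have : B = 0 := le_antisymm this hB
      rw [this]; simp; positivity
    · have h8 := le_of_mul_le_mul_left h7 hq0
      nlinarith
lemma ks_scal (n : ℕ) {D V v : ℝ} (hσ : 0 < σ) (hσ1 : σ ≤ 1) (hδ : 0 ≤ δ) (hD : 0 < D)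
    (h : (1 / (2 * (32 * σ))) ^ n * v ≤ 2 ^ n * ((D / σ ^ 2) ^ n * V + δ ^ n)) (hd : (2 * δ) ^ n < (1 / 64) ^ n * v / 2) :
    ((1 / 64) ^ n / 2 / (2 * D) ^ n) * (σ ^ n * v) ≤ V := by
  have h1 : (1 / (2 * (32 * σ))) ^ n * σ ^ n = (1 / 64) ^ n := by
    rw [← mul_pow]; congr 1; field_simp; norm_num
  have h2 : 2 ^ n * (D / σ ^ 2) ^ n * σ ^ n * σ ^ n = (2 * D) ^ n := by
    rw [← mul_pow, ← mul_pow, ← mul_pow]; congr 1; field_simp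
  have h3 := mml h (pow_nonneg hσ.le n)
  have h4 : σ ^ n * (2 * δ) ^ n ≤ (2 * δ) ^ n := mlol pvt (plo hσ.le hσ1)
  have h5 : σ ^ n * (2 ^ n * ((D / σ ^ 2) ^ n * V + δ ^ n)) = σ ^ n * (2 ^ n * (D / σ ^ 2) ^ n) * V + σ ^ n * (2 * δ) ^ n := by
    rw [mul_pow]; ring
  have h6 : (1 / 64) ^ n * v / 2 ≤ σ ^ n * (2 ^ n * (D / σ ^ 2) ^ n) * V := by
    have : σ ^ n * ((1 / (2 * (32 * σ))) ^ n * v) = (1 / 64) ^ n * v := by rw [← h1]; ring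
    rw [this, h5] at h3
    linarith
  have h7 := mml h6 (pow_nonneg hσ.le n)
  have h8 : σ ^ n * (σ ^ n * (2 ^ n * (D / σ ^ 2) ^ n) * V) = (2 * D) ^ n * V := by rw [← h2]; ring
  rw [h8] at h7
  have hD2 : 0 < (2 * D) ^ n := pvt
  rw [dmm, dli hD2]
  linarith
lemma KS1 (hn : 0 < n) {K : ℝ} (hK : 1 ≤ K) : ∃ N ν δ0 : ℝ, 2 ≤ N ∧ 0 < ν ∧ 0 < δ0 ∧ ∀ (P : ℝ) (s e : Fu n), P ≤ 1 → SS P K δ0 s e →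
    ∀ (z : E n) (σ : ℝ), 0 < σ → ‖z‖ + 16 * σ ≤ P → ∀ x1, ‖x1 - z‖ ≤ 8 * σ → s x1 ≤ 1 →
      ofReal (ν * (σ ^ n * vB n)) ≤ volume ({x | s x ≤ N} ∩ closedBall z σ) := by
  have hv := vB_pos n
  have hq : 0 ≤ qK n K := by unfold qK; positivity
  have hn1 : (0:ℝ) < n := by exact_mod_cast hn
  obtain ⟨α, hα⟩ := exR (qK n K * n * K ^ 2 + 1)
  have hα0 : 0 < α := by rw [hα]; positivity
  have hlt : exp (-256 * α) < exp (-64 * α) := Real.exp_lt_exp.2 lnr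
  obtain ⟨c, hc⟩ := exR (exp (-256 * α))
  obtain ⟨A, hA⟩ := exR (2 / (exp (-64 * α) - c))
  have hdp : 0 < exp (-64 * α) - c := by rw [hc]; linarith
  have hA0 : 0 < A := by rw [hA]; positivity
  have hA2 : A * (exp (-64 * α) - c) = 2 := by rw [hA]; exact div_mul_cancel₀ _ hdp.ne.symm
  have hc0 : 0 < c := by rw [hc]; exact exp_pos _
  obtain ⟨D, hD⟩ := exR (2 * A * α * n * K ^ 2)
  have hD0 : 0 < D := by rw [hD]; positivity
  obtain ⟨d0, hd0, hd⟩ := small_pow hn (A := 2) nnm (by positivity : 0 < (1 / 64 : ℝ) ^ n * vB n / 2)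
  refine ⟨max 2 A, (1 / 64) ^ n / 2 / (2 * D) ^ n, d0, le_max_left _ _, by positivity, hd0, ?_⟩
  intro P s e hP hs z σ hσ hz x1 hx1 hs1
  have hσ1 : σ ≤ 1 := by linarith [norm_nonneg z]
  have hin : ∀ x, ‖x - z‖ ≤ 16 * σ → ‖x‖ ≤ P := fun x hx => by
    have := norm_add_le (x - z) z
    rw [sub_add_cancel] at this; linarith
  have hβσ : ∀ t : ℝ, 0 ≤ t → -(α / σ ^ 2) * (t * σ) ^ 2 = - (t ^ 2) * α := fun t _ => by field_simp
  have hbar : ∀ x, ∀ t, 0 ≤ t → ‖x - z‖ ≤ t * σ → A * (exp (-(t^2) * α) - c) ≤ bar A (α / σ ^ 2) c z x := fun x t ht hx => by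
    unfold bar
    refine mml (sub_le_sub_right (Real.exp_le_exp.2 ?_) _) hA0.le
    rw [← hβσ t ht]
    have : ‖x - z‖ ^ 2 ≤ (t * σ) ^ 2 := ppl (norm_nonneg _) hx 2
    have hb : 0 ≤ α / σ ^ 2 := pvt
    nlinarith
  have hbarA : ∀ x, bar A (α / σ ^ 2) c z x ≤ A := fun x => by
    unfold bar
    have : exp (-(α / σ ^ 2) * ‖x - z‖ ^ 2) ≤ 1 := exp_le_one_iff.2 (by
      have : 0 ≤ (α / σ ^ 2) * ‖x - z‖ ^ 2 := pvt
      linarith)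
    nlinarith
  have hcont := hs.cd.continuous
  have habp := abp hn (w := fun x => bar A (α / σ ^ 2) c z x - s x) ((bar_cd _ _ _ _).sub hs.cd)
    (iCB z (16 * σ)) (x1 := x1) (by rw [mcB]; linarith) (m := 1) one_pos
    (R := 32 * σ) pvt (by
      have := hbar x1 8 nnm hx1
      rw [show -((8:ℝ) ^ 2) * α = -64 * α by norm_num] at this
      rw [hA2] at this
      linarith)
    (fun x hx => by
      rw [mcB] at hx
      have := norm_sub_le (x - z) (x1 - z)
      rw [sub_sub_sub_cancel_right] at this
      linarith)
    (fun x hx hw => by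
      rw [interior_closedBall _ pvt, mem_ball_iff_norm]
      rw [mcB] at hx
      rcases hx.lt_or_eq with h | h
      · exact h
      · exfalso
        have h1 := hs.nonneg x (hin x hx)
        have h2 : bar A (α / σ ^ 2) c z x = 0 := by
          unfold bar
          rw [h, hβσ 16 nnm, hc]; norm_num
        linarith)
    (S := {x | s x ≤ max 2 A} ∩ closedBall z σ) ((isClosed_le hcont cco).measurableSet.inter isClosed_closedBall.measurableSet)
    (C1 := D / σ ^ 2) pvt hd0.le (e := e) (fun x _ => hs.e0 x)
    ((lintegral_mono_set (fun x hx => by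
      rw [mcB] at hx
      rw [mcz]; exact hin x hx)).trans hs.ei)
    (fun x hx => by
      obtain ⟨hxK, hxw, -, -⟩ := hx
      rw [mcB] at hxK
      obtain ⟨b, hb, hbK, htr⟩ := hs.fr x (hin x hxK)
      refine ⟨b, hb, ?_⟩
      obtain ⟨t1, t2⟩ := bar_tr (c := c) hA0.le (by positivity : 0 ≤ α / σ ^ 2) hb hK hbK z x
      have h1 : tr (D2 (fun x => bar A (α / σ ^ 2) c z x - s x) x) b = tr (D2 (bar A (α / σ ^ 2) c z) x) b - tr (D2 s x) b := by
        rw [D2_sub (v := bar A (α / σ ^ 2) c z) (bar_cd _ _ _ _) hs.cd]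
        simp only [tr, sba, sum_sub_distrib]
      rw [h1]
      by_cases hσx : ‖x - z‖ ≤ σ
      · rw [indicator_of_mem]
        · have : 2 * A * (α / σ ^ 2) * n * K ^ 2 = D / σ ^ 2 := by rw [hD]; ring
          rw [this] at t1
          linarith
        · refine ⟨?_, by rwa [mcB]⟩
          have := hbarA x
          have := le_max_right 2 A
          simp only [mem_setOf_eq]
          linarith
      · have := indicator_nonneg (s := {x | s x ≤ max 2 A} ∩ closedBall z σ) (f := fun _ => D / σ ^ 2) (fun _ _ => pvt) x
        have := t2 (by
          push Not at hσx
          have h3 : σ ^ 2 ≤ ‖x - z‖ ^ 2 := ppl hσ.le hσx.le 2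
          have h4 : 2 * α ≤ 2 * (α / σ ^ 2) * ‖x - z‖ ^ 2 := by
            calc 2 * α = 2 * (α / σ ^ 2) * σ ^ 2 := by field_simp
              _ ≤ _ := gcg
          linarith)
        linarith)
  have hfin : volume ({x | s x ≤ max 2 A} ∩ closedBall z σ ∩ closedBall z (16 * σ)) ≠ ⊤ :=
    ((measure_mono inter_subset_right).trans_lt measure_closedBall_lt_top).ne
  have := ks_scal n hσ hσ1 hd0.le hD0 habp (hd d0 hd0 le_rfl)
  refine (oRl this).trans ?_
  rw [ofReal_toReal hfin]
  exact measure_mono Set.inter_subset_left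
lemma vol_cball (x : E n) (hr : 0 < r) (hn : 0 < n) : volume (closedBall x r) = ofReal (r ^ n * vB n) := by
  haveI : Nonempty (Fin n) := ⟨⟨0, hn⟩⟩
  rw [Measure.addHaar_closedBall_eq_addHaar_ball, vol_ball x hr]
lemma SS.scale {K : ℝ} {s : Fu n} (h : SS P K δ s e) (hδ : 0 ≤ δ) (hc : 0 ≤ c) (hcδ : c * δ ≤ δ') :
    SS P K δ' (fun x => c * s x) (fun x => c * e x) where
  cd := contDiff_const.mul h.cd
  nonneg := fun x hx => mul_nonneg hc (h.nonneg x hx)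
  e0 := fun x => mul_nonneg hc (h.e0 x)
  fr := fun x hx => by
    obtain ⟨b, hb, hb2, hb3⟩ := h.fr x hx
    refine ⟨b, hb, hb2, ?_⟩
    have : tr (D2 (fun x => c * s x) x) b = c * tr (D2 s x) b := by
      rw [D2_smul h.cd]; simp only [tr, sma, sem, mul_sum]
    rw [this]; exact mml hb3 hc
  ei := by
    simp only [mul_pow]
    calc _ = ofReal (c ^ n) * ∫⁻ x in closedBall 0 P, ofReal (e x ^ n) := by
          rw [← lintegral_const_mul' _ _ ofReal_ne_top]
          exact lintegral_congr fun x => ofReal_mul pvt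
      _ ≤ ofReal (c ^ n) * ofReal (δ ^ n) := by gcongr; exact h.ei
      _ = ofReal ((c * δ) ^ n) := by rw [← ofReal_mul pvt, mul_pow]
      _ ≤ _ := oRl (ppl pvt hcδ n)
lemma ink (hn : 0 < n) (hR : 0 < R) (hν : 0 < ν) {G D' D : Set (E n)} (hG : IsClosed G) (hDc : MeasurableSet D')
    (hD' : D' = closedBall 0 R \ G)
    (hD : D ⊆ closedBall 0 R) (hDD : D' ⊆ D)
    (h0 : ofReal (ν * (R ^ n * vB n)) ≤ volume (G ∩ closedBall 0 R))
    (hks : ∀ (z : E n) (σ : ℝ), 0 < σ → σ ≤ R → ‖z‖ ≤ R → volume (G ∩ closedBall z σ) < ofReal (ν * (σ ^ n * vB n)) →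
      ∀ y ∈ closedBall 0 R, ‖y - z‖ ≤ 8 * σ → y ∈ D) :
    ofReal (1 + ν / 5 ^ n) * volume D' ≤ volume D := by
  have hv := vB_pos n
  set c : E n → ℕ → E n := fun x i => (1 - (1/2:ℝ) ^ i) • x with hc
  set ρ : ℕ → ℝ := fun i => (1/2:ℝ) ^ i * R with hρ
  have hρ0 : ∀ i, 0 < ρ i := fun i => pvt
  have hp1 : ∀ i : ℕ, (1/2:ℝ) ^ i ≤ 1 := fun i => plo nnm nnm
  have hxc : ∀ x : E n, ‖x‖ ≤ R → ∀ i, ‖x - c x i‖ ≤ ρ i := fun x hx i => by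
    rw [show x - c x i = ((1/2:ℝ) ^ i) • x by simp only [hc]; module, norm_smul, nnn pvt]
    exact mml hx pvt
  have hcn : ∀ x : E n, ‖x‖ ≤ R → ∀ i, ‖c x i‖ + ρ i ≤ R := fun x hx i => by
    simp only [hc, hρ]
    rw [norm_smul, nnn (by linarith [hp1 i])]
    nlinarith [hp1 i]
  have key : ∀ x ∈ D', ∃ i, ofReal (ν * (ρ i ^ n * vB n)) ≤ volume (G ∩ closedBall (c x i) (ρ i)) ∧
      closedBall (c x i) (ρ i) ⊆ D := fun x hx => by
    have hx' := hx
    rw [hD'] at hx'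
    have hxR : ‖x‖ ≤ R := by simpa using hx'.1
    have hex : ∃ i, volume (G ∩ closedBall (c x i) (ρ i)) < ofReal (ν * (ρ i ^ n * vB n)) := by
      obtain ⟨d, hd, hdG⟩ := Metric.isOpen_iff.1 hG.isOpen_compl x hx'.2
      obtain ⟨i, hi⟩ := exists_pow_lt_of_lt_one (show 0 < d / (2 * R) by positivity) (show (1/2:ℝ) < 1 by norm_num)
      refine ⟨i, ?_⟩
      have : G ∩ closedBall (c x i) (ρ i) = ∅ := by
        ext y
        simp only [Set.mem_inter_iff, Set.mem_empty_iff_false, iff_false, not_and]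
        intro hyG hy
        refine hdG ?_ hyG
        rw [mcB] at hy
        rw [mem_ball_iff_norm]
        have h1 := hxc x hxR i
        have h2 : ρ i < d / 2 := by
          simp only [hρ]; rw [lt_div_iff₀ pvt] at hi; linarith
        have h3 := norm_sub_le (y - c x i) (x - c x i)
        rw [sub_sub_sub_cancel_right] at h3
        linarith
      rw [this, measure_empty]
      have := hρ0 i
      rw [ENNReal.ofReal_pos]; positivity
    classical
    obtain ⟨i, hi, hmin⟩ : ∃ i, volume (G ∩ closedBall (c x i) (ρ i)) < ofReal (ν * (ρ i ^ n * vB n)) ∧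
      ∀ j < i, ¬ volume (G ∩ closedBall (c x j) (ρ j)) < ofReal (ν * (ρ j ^ n * vB n)) :=
      ⟨Nat.find hex, Nat.find_spec hex, fun j hj => Nat.find_min hex hj⟩
    rcases i with _ | j
    · exfalso
      simp [hc, hρ] at hi
      rw [← not_le] at hi
      exact hi h0
    · refine ⟨j, not_lt.1 (hmin j omg), fun y hy => ?_⟩
      rw [mcB] at hy
      have h1 := hcn x hxR j
      have h2 := hcn x hxR (j + 1)
      have h4 : ρ j = 2 * ρ (j + 1) := by simp only [hρ, pow_succ]; ring
      refine hks (c x (j + 1)) (ρ (j + 1)) (hρ0 _) (by linarith [norm_nonneg (c x (j+1))]) (by linarith [hρ0 (j+1)]) hi y ?_ ?_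
      · rw [mcz]
        have := norm_add_le (y - c x j) (c x j)
        rw [sub_add_cancel] at this; linarith
      · have h3 : ‖c x j - c x (j + 1)‖ ≤ ρ (j + 1) := by
          rw [show c x j - c x (j + 1) = (-((1/2:ℝ) ^ (j + 1))) • x by simp only [hc, pow_succ]; module, norm_smul, norm_neg,
            nnn pvt]
          exact mml hxR pvt
        have := norm_add_le (y - c x j) (c x j - c x (j + 1))
        rw [sub_add_sub_cancel] at this
        linarith [hρ0 (j + 1)]
  choose! i hi1 hi2 using key
  obtain ⟨u, hu, hdis, hcov⟩ := Vitali.exists_disjoint_subfamily_covering_enlargement_closedBall D' (fun x => c x (i x)) (fun x => ρ (i x)) R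
    (fun x hx => by simp only [hρ]; exact mlol hR.le (hp1 _)) 5 nnm
  have hucount : u.Countable := by
    refine hdis.countable_of_nonempty_interior fun x hx => ?_
    rw [interior_closedBall _ (hρ0 _).ne']
    exact Metric.nonempty_ball.2 (hρ0 _)
  have hsub : D' ⊆ ⋃ x ∈ u, closedBall (c x (i x)) (5 * ρ (i x)) := fun x hx => by
    obtain ⟨b, hb, hb2⟩ := hcov x hx
    refine Set.mem_biUnion hb (hb2 ?_)
    rw [mcB]
    have hx' := hx
    rw [hD'] at hx'
    exact hxc x (by simpa using hx'.1) _
  haveI := hucount.to_subtype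
  have hfin : volume D' ≠ ⊤ := ((measure_mono (hDD.trans hD)).trans_lt measure_closedBall_lt_top).ne
  have hm1 : ofReal (ν / 5 ^ n) * volume D' ≤ volume (D \ D') := by
    calc ofReal (ν / 5 ^ n) * volume D' ≤ ofReal (ν / 5 ^ n) * ∑' x : u, volume (closedBall (c x (i x)) (5 * ρ (i x))) := by
          gcongr
          exact (measure_mono hsub).trans (measure_biUnion_le _ hucount _)
      _ = ∑' x : u, ofReal (ν * (ρ (i x) ^ n * vB n)) := by
          rw [← ENNReal.tsum_mul_left]
          refine tsum_congr fun x => ?_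
          have := hρ0 (i x)
          rw [vol_cball _ pvt hn, ← ofReal_mul pvt]
          congr 1
          rw [mul_pow]; field_simp
      _ ≤ ∑' x : u, volume (G ∩ closedBall (c x (i x)) (ρ (i x))) := ENNReal.tsum_le_tsum fun x => hi1 x (hu x.2)
      _ = volume (⋃ x ∈ u, G ∩ closedBall (c x (i x)) (ρ (i x))) := by
          rw [measure_biUnion hucount]
          · exact hdis.mono fun x => inter_subset_right
          · exact fun x _ => hG.measurableSet.inter isClosed_closedBall.measurableSet
      _ ≤ volume (D \ D') := measure_mono (Set.iUnion₂_subset fun x hx y hy => ⟨hi2 x (hu hx) hy.2, by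
          rw [hD']; exact fun h => h.2 hy.1⟩)
  rw [ofReal_add nnm pvt, ofReal_one, add_mul, one_mul]
  calc volume D' + _ ≤ volume D' + volume (D \ D') := gcg
    _ = volume D := by rw [add_comm]; rw [measure_diff hDD hDc.nullMeasurableSet hfin, tsub_add_cancel_of_le (measure_mono hDD)]
theorem KS (hn : 0 < n) {K : ℝ} (hK : 1 ≤ K) (hτ : 0 < τ) : ∃ t δ : ℝ, 0 < t ∧ 0 < δ ∧ ∀ (R : ℝ) (s e : Fu n) (x1 : E n),
    0 < R → 18 * R ≤ 1 → SS (18 * R) K δ s e → ‖x1‖ ≤ R → s x1 ≤ t →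
    volume {x | x ∈ closedBall 0 R ∧ τ < s x} ≤ ofReal τ * volume (closedBall zE n R) := by
  obtain ⟨N, ν, δ0, hN, hν, hδ0, h1⟩ := KS1 hn hK
  have hN0 : 0 < N := lnr
  have hstep : ∀ (R : ℝ) (s e : Fu n) (x1 : E n), 0 < R → 18 * R ≤ 1 → SS (18 * R) K δ0 s e → ‖x1‖ ≤ R → s x1 ≤ 1 → ∀ k : ℕ,
      ofReal (1 + ν / 5 ^ n) ^ k * volume {x | x ∈ closedBall 0 R ∧ N ^ k < s x} ≤ volume (closedBall zE n R) := by
    intro R s e x1 hR hR1 hs hx1 hs1 k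
    have hc := hs.cd.continuous
    induction k with
    | zero => simp only [pow_zero, one_mul]; exact measure_mono fun x hx => hx.1
    | succ k ih =>
      have hNk : 0 < N ^ k := pvt
      have hNk1 : 1 ≤ N ^ k := olp lnr
      have hss := hs.scale hδ0.le (c := (N ^ k)⁻¹) (δ' := δ0) pvt (mlol hδ0.le (inv_le_one_of_one_le₀ hNk1))
      have hset : {x | (N ^ k)⁻¹ * s x ≤ N} = {x | s x ≤ N ^ (k + 1)} := by
        ext x; simp only [mem_setOf_eq]; rw [iml hNk, pow_succ]
      have hk := h1 (18 * R) _ _ hR1 hss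
      simp only [hset] at hk
      have := ink hn hR hν (G := {x | s x ≤ N ^ (k + 1)}) (D' := {x | x ∈ closedBall 0 R ∧ N ^ (k + 1) < s x})
        (D := {x | x ∈ closedBall 0 R ∧ N ^ k < s x}) (isClosed_le hc cco)
        (isClosed_closedBall.measurableSet.inter (isOpen_lt cco hc).measurableSet)
        (by ext x; simp [not_le]) (fun x hx => hx.1)
        (fun x hx => ⟨hx.1, lt_of_le_of_lt (ppr lnr omg) hx.2⟩)
        (hk 0 R hR (by simp; linarith) x1 (by simp; linarith) (by rw [iml hNk]; linarith))
        (fun z σ hσ hσR hz hlt y hy hyz => by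
          refine ⟨hy, ?_⟩
          by_contra hcon
          push Not at hcon
          have := hk z σ hσ lnr y hyz (by rw [iml hNk]; linarith)
          exact absurd hlt (not_lt.2 this))
      rw [pow_succ, mul_assoc]
      exact (by gcongr : _ ≤ _).trans ih
  have hb : 1 < 1 + ν / 5 ^ n := by have : 0 < ν / 5 ^ n := pvt
                                    linarith
  obtain ⟨k, hk⟩ := pow_unbounded_of_one_lt τ⁻¹ hb
  have hNk : 0 < N ^ k := pvt
  refine ⟨τ / N ^ k, τ / N ^ k * δ0, by positivity, by positivity, fun R s e x1 hR hR1 hs hx1 hs1 => ?_⟩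
  have hs2 := hs.scale pvt (c := N ^ k / τ) (δ' := δ0) pvt (le_of_eq (by field_simp))
  have := hstep R _ _ x1 hR hR1 hs2 hx1 (by
    calc N ^ k / τ * s x1 ≤ N ^ k / τ * (τ / N ^ k) := gcg
      _ = 1 := by field_simp) k
  have hset : {x : E n | x ∈ closedBall 0 R ∧ N ^ k < N ^ k / τ * s x} = {x | x ∈ closedBall 0 R ∧ τ < s x} := by
    ext x; simp only [mem_setOf_eq]
    rw [show N ^ k / τ * s x = N ^ k * (s x / τ) by ring, lt_mul_iff_one_lt_right hNk, one_lt_div hτ]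
  rw [hset, ← ENNReal.ofReal_pow pvt] at this
  calc volume {x | x ∈ closedBall 0 R ∧ τ < s x} = ofReal τ * (ofReal τ⁻¹ * volume {x | x ∈ closedBall 0 R ∧ τ < s x}) := by
        rw [← mul_assoc, ← ofReal_mul hτ.le, mul_inv_cancel₀ hτ.ne', ofReal_one, one_mul]
    _ ≤ ofReal τ * volume (closedBall zE n R) := by
        gcongr
        exact le_trans gcg this
def wF (s0 : ℝ) (y : Fu n) (x : E n) : ℝ := (s0 ^ 2)⁻¹ * (Av om s0 y x - y x)
lemma wF_cd (hy : CD y) (s0 : ℝ) : CD (wF s0 y) := by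
  unfold wF; exact contDiff_const.mul ((Av_cd ker_om hy s0).sub hy)
lemma wF_tr (hy : CD y) (s0 : ℝ) (x : E n) (b : Fr n) :
    tr (D2 (wF s0 y) x) b = (s0 ^ 2)⁻¹ * (IB om (fun k => tr (D2 y (x + s0 • k)) b) - tr (D2 y x) b) := by
  have h1 : D2 (wF s0 y) x = (s0 ^ 2)⁻¹ • (D2 (Av om s0 y) x - D2 y x) := by
    unfold wF
    rw [D2_smul ((Av_cd ker_om hy s0).sub hy), D2_sub (Av_cd ker_om hy s0) hy]
  rw [← Av_tr ker_om hy, h1]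
  simp only [tr, sma, sba, sem, ← mul_sum, sum_sub_distrib]
lemma err2 (hn : 0 < n) (hc : 0 ≤ c) (hε : 0 ≤ ε) (hP : P < ϱ) (hϱ : ϱ ≤ 1) (hϱ0 : 0 < ϱ) (hg : Continuous g)
    (hex : ∫⁻ x in MB 0 ϱ, ofReal ((max (g x - 1) 0) ^ n) ≤ ofReal (ε ^ n)) :
    ∫⁻ x in closedBall zE n P, ofReal ((c * (ε + max (g x - 1) 0)) ^ n) ≤
      ofReal ((2 * c * (1 + vB n) * ε) ^ n) := by
  have hv := vB_pos n
  calc _ ≤ ∫⁻ x in MB zE n ϱ, ofReal ((c * (ε + max (g x - 1) 0)) ^ n) :=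
        lintegral_mono_set (Metric.closedBall_subset_ball hP)
    _ ≤ ∫⁻ x in MB zE n ϱ, (ofReal ((2 * c) ^ n) * (ofReal ((max (g x - 1) 0) ^ n) + ofReal (ε ^ n))) := by
        refine lintegral_mono fun x => ?_
        have hm : 0 ≤ max (g x - 1) 0 := le_max_right _ _
        simp only
        rw [← ofReal_add pvt pvt, ← ofReal_mul pvt]
        refine oRl ?_
        have h1 : ε + max (g x - 1) 0 ≤ 2 * max ε (max (g x - 1) 0) := by
          linarith [le_max_left ε (max (g x - 1) 0), le_max_right ε (max (g x - 1) 0)]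
        calc (c * (ε + max (g x - 1) 0)) ^ n ≤ (c * (2 * max ε (max (g x - 1) 0))) ^ n := gcg
          _ = (2 * c) ^ n * (max ε (max (g x - 1) 0)) ^ n := by rw [← mul_pow]; ring
          _ ≤ (2 * c) ^ n * ((max (g x - 1) 0) ^ n + ε ^ n) := by
              gcongr
              rcases le_total ε (max (g x - 1) 0) with h | h
              · rw [max_eq_right h]; linarith [pow_nonneg hε n]
              · rw [max_eq_left h]; linarith [pow_nonneg hm n]
    _ = ofReal ((2 * c) ^ n) * ((∫⁻ x in MB zE n ϱ, ofReal ((max (g x - 1) 0) ^ n)) + ofReal (ε ^ n) * ofReal (ϱ ^ n * vB n)) := by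
        rw [lintegral_const_mul' _ _ ofReal_ne_top, lintegral_add_right _ fpr, lintegral_const, Measure.restrict_apply_univ, vol_ball _ hϱ0]
    _ ≤ ofReal ((2 * c) ^ n) * (ofReal (ε ^ n) + ofReal (ε ^ n) * ofReal (ϱ ^ n * vB n)) := gcg
    _ = ofReal ((2 * c) ^ n * (ε ^ n + ε ^ n * (ϱ ^ n * vB n))) := by
        rw [← ofReal_mul (pow_nonneg hε n), ← ofReal_add pvt pvt, ← ofReal_mul pvt]
    _ ≤ _ := by
        refine oRl ?_
        have h1 : ϱ ^ n ≤ 1 := plo hϱ0.le hϱ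
        have h2 : 1 + vB n ≤ (1 + vB n) ^ n := le_self_pow₀ lnr hn.ne'
        calc (2 * c) ^ n * (ε ^ n + ε ^ n * (ϱ ^ n * vB n)) = (2 * c) ^ n * ε ^ n * (1 + ϱ ^ n * vB n) := rng
          _ ≤ (2 * c) ^ n * ε ^ n * (1 + vB n) ^ n := by
              gcongr
              exact le_trans (by nlinarith) h2
          _ = _ := by rw [← mul_pow, ← mul_pow]; ring
lemma pig (M : ℕ → ℝ) {J : ℕ} (hM0 : M 0 ≤ C) (hMJ : 0 ≤ M J) (hJ : C < J * t) : ∃ j < J, M j - M (j + 1) ≤ t := by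
  by_contra h
  push Not at h
  have h1 : ∀ j ≤ J, j * t ≤ M 0 - M j := fun j => by
    induction j with
    | zero => simp
    | succ j ih => intro hj; have := h j omg; have := ih omg; push_cast; linarith
  have := h1 J le_rfl
  linarith
theorem J12 (hn : 0 < n) {K : ℝ} (hϱ : 0 < ϱ) (hϱ1 : ϱ ≤ 1) (hΛ : 1 ≤ Λ) (hK : 1 ≤ K) (hτ : 0 < τ) :
    ∃ Rmin, 0 < Rmin ∧ ∀ s0, 0 < s0 → s0 ≤ ϱ / 4 → ∃ ε0, 0 < ε0 ∧ ∀ (Cd r ε : ℝ) (v y g : Fu n), 0 < ε → ε ≤ ε0 → YD ϱ Λ K Cd r ε v y g →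
      ∃ R M, Rmin ≤ R ∧ R ≤ ϱ / 36 ∧ 0 ≤ M ∧ M ≤ cW n / 2 * Λ ∧ (∀ x, ‖x‖ ≤ R → 0 ≤ wF s0 y x ∧ wF s0 y x ≤ M) ∧
        volume {x | x ∈ closedBall 0 R ∧ τ < M - wF s0 y x} ≤ ofReal τ * volume (closedBall zE n R) := by
  have hv := vB_pos n
  have hcW := cW_pos n
  have hnr : (0:ℝ) < n := by exact_mod_cast hn
  obtain ⟨t, δ, ht, hδ, hKS⟩ := KS hn hK hτ
  obtain ⟨J, hJ⟩ := exists_nat_gt (cW n / 2 * Λ / t)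
  have hJt : cW n / 2 * Λ < J * t := by rwa [div_lt_iff₀ ht] at hJ
  refine ⟨ϱ / 2 / 18 ^ J, by positivity, fun s0 hs0 hs0' => ?_⟩
  refine ⟨δ / (2 * ((s0 ^ 2)⁻¹ * n) * (1 + vB n)), by positivity, fun Cd r ε v y g hε hε' hY => ?_⟩
  have hy := hY.cd
  have hpsd : ∀ x, Psd (D2 y x) := fun x => psd_of_pos (hY.pos x)
  set w := wF s0 y with hw
  have hwc : Continuous w := (wF_cd hy s0).continuous
  have hw0 : ∀ x, 0 ≤ w x := fun x => mul_nonneg pvt (by linarith [Av_ge ker_om om_one hy hpsd x s0])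
  have hw1 : ∀ x, ‖x‖ ≤ ϱ / 2 → w x ≤ cW n / 2 * Λ := fun x hx => by
    have := av_le hy (x := x) (L := Λ) hs0.le fun z hz => hY.lap z (by
      have := norm_add_le (z - x) x
      rw [sub_add_cancel] at this; linarith)
    simp only [hw, wF]
    rw [iml pvt]; linarith
  set P : ℕ → ℝ := fun j => ϱ / 2 / 18 ^ j with hP
  have hP0 : ∀ j, 0 < P j := fun j => pvt
  have hPle : ∀ j, P j ≤ ϱ / 2 := fun j => div_le_self pvt (olp nnm)
  have hPs : ∀ j, P j = 18 * P (j + 1) := fun j => by simp only [hP, pow_succ]; field_simp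
  have hmax : ∀ j, ∃ x, ‖x‖ ≤ P j ∧ ∀ z, ‖z‖ ≤ P j → w z ≤ w x := fun j => by
    obtain ⟨x, hx, hm⟩ := (iCB zE n (P j)).exists_isMaxOn ⟨0, by simp [(hP0 j).le]⟩ hwc.continuousOn
    exact ⟨x, by simpa using hx, fun z hz => hm (by simpa using hz)⟩
  choose X hX hXm using hmax
  obtain ⟨j, hj, hjt⟩ := pig (fun j => w (X j)) (J := J) (hw1 _ ((hX 0).trans (hPle 0))) (hw0 _) hJt
  have hR : P (j + 1) ≤ ϱ / 36 := by have := hPle j; rw [hPs] at this; linarith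
  have hss : SS (18 * P (j + 1)) K δ (fun x => w (X j) - w x) (fun x => (s0 ^ 2)⁻¹ * n * (ε + max (g x - 1) 0)) := by
    refine ⟨contDiff_const.sub (wF_cd hy s0), fun x hx => ?_, fun x => ?_, fun x hx => ?_, ?_⟩
    · rw [← hPs] at hx; linarith [hXm j x hx]
    · have : 0 ≤ max (g x - 1) 0 := le_max_right _ _
      positivity
    · rw [← hPs] at hx
      obtain ⟨b, hb, hbK, hbg⟩ := hY.fr x (by linarith [hPle j])
      refine ⟨b, hb, hbK, ?_⟩
      have h1 : tr (D2 (fun x => w (X j) - w x) x) b = - tr (D2 w x) b := by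
        rw [D2_sub contDiff_const (wF_cd hy s0), D2_const]; simp [tr, hw]
      rw [h1, hw, wF_tr hy, tr_frame hbg]
      have hD := cont_D2 hy
      have h2 : n * (1 - ε) ≤ IB om (fun k => tr (D2 y (x + s0 • k)) b) := by
        rw [← IB_c (n := n) (n * (1 - ε))]
        refine IB_mono ker_om cco (by unfold tr; fun_prop) fun k _ => ?_
        have h3 := amgm hn (D2_symm hy (x + s0 • k)) (hpsd _) hb (hY.gpos _).le (hY.det _).symm
        have h4 := hY.glo (x + s0 • k)
        exact le_trans gcg h3
      have h5 : g x - 1 ≤ max (g x - 1) 0 := le_max_left _ _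
      rw [← mul_neg, mul_assoc]
      refine mml ?_ pvt
      nlinarith
    · refine (err2 hn pvt hε.le (by rw [← hPs]; linarith [hPle j]) hϱ1 hϱ hY.gc hY.exc).trans (oRl ?_)
      refine ppl pvt ?_ n
      rw [ldi pvt] at hε'
      linarith
  refine ⟨P (j + 1), w (X j), ?_, hR, hw0 _, hw1 _ ((hX j).trans (hPle j)), fun x hx => ⟨hw0 x, hXm j x ?_⟩, ?_⟩
  · simp only [hP]
    gcongr
    · norm_num
    · omega
  · linarith [hPs j, hP0 (j + 1)]
  · exact hKS (P (j + 1)) _ _ (X (j + 1)) (hP0 _) lnr hss (hX _) hjt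
def cO (n : ℕ) : ℝ := Classical.choose (om_bdd (n := n))
lemma cO_pos (n : ℕ) : 0 < cO n := (cSp (om_bdd (n := n))).1
lemma om_le (k : E n) : om k ≤ cO n := (cSp (om_bdd (n := n))).2 k
lemma av_small (hn : 0 < n) {s : Fu n} (hs : Continuous s) (hR : 0 < R) (hr1 : 0 < r1) (hτ : 0 < τ) (hC : 0 ≤ C)
    (h0 : ∀ x, ‖x‖ ≤ R → s x ≤ C)
    (hm : volume {x | x ∈ closedBall 0 R ∧ τ < s x} ≤ ofReal τ * volume (closedBall zE n R))
    (hx : ‖x‖ + r1 ≤ R) : Av om r1 s x ≤ τ + C * cO n * (τ * ((R / r1) ^ n * vB n)) := by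
  have hv := vB_pos n
  have hcO := cO_pos n
  set T : Set (E n) := {k | k ∈ closedBall 0 1 ∧ τ < s (x + r1 • k)} with hT
  have hin : ∀ k : E n, ‖k‖ ≤ 1 → ‖x + r1 • k‖ ≤ R := fun k hk => by
    have := norm_add_le x (r1 • k)
    rw [norm_smul, nnn hr1.le] at this
    nlinarith
  have hTm : MeasurableSet T := isClosed_closedBall.measurableSet.inter (isOpen_lt cco (show Continuous fun k : E n => s (x + r1 • k) by fun_prop)).measurableSet
  have hTf : volume T ≠ ⊤ := ((measure_mono fun k hk => hk.1).trans_lt (measure_closedBall_lt_top (x := zE n) (r := 1))).ne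
  have hTv : (volume T).toReal ≤ τ * ((R / r1) ^ n * vB n) := by
    refine ENNReal.toReal_le_of_le_ofReal pvt ?_
    have h1 : T ⊆ (fun k : E n => r1 • k) ⁻¹' ((fun z => x + z) ⁻¹' {x | x ∈ closedBall 0 R ∧ τ < s x}) := fun k hk =>
      ⟨by rw [mcz]; exact hin k (by simpa using hk.1), hk.2⟩
    refine (measure_mono h1).trans ?_
    rw [Measure.addHaar_preimage_smul _ hr1.ne', measure_preimage_add]
    refine (mul_le_mul_right hm _).trans (le_of_eq ?_)
    rw [vol_cball _ hR hn, ← ofReal_mul hτ.le, ← ofReal_mul (abs_nonneg _), finrank_euclideanSpace_fin, aop pvt]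
    congr 1
    rw [div_pow]; field_simp
  have hind : Integrable (T.indicator fun _ => C * cO n) := (integrable_indicator_iff hTm).2 (integrableOn_const hTf)
  calc Av om r1 s x ≤ ∫ k, (om k * τ + T.indicator (fun _ => C * cO n) k) := by
        refine integral_mono (ker_om.int fpr) ((ker_om.int cco).add hind) fun k => ?_
        have hk0 := ker_om.nonneg k
        simp only
        by_cases hk : ‖k‖ < 1
        · by_cases hks : τ < s (x + r1 • k)
          · rw [indicator_of_mem (show k ∈ T from ⟨by simpa using hk.le, hks⟩)]
            have h1 := h0 _ (hin k hk.le)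
            have h2 : om k * s (x + r1 • k) ≤ cO n * C := by
              calc om k * s (x + r1 • k) ≤ om k * C := gcg
                _ ≤ cO n * C := by gcongr; exact om_le k
            have : 0 ≤ om k * τ := pvt
            linarith
          · have : 0 ≤ T.indicator (fun _ => C * cO n) k := indicator_nonneg (fun _ _ => pvt) k
            push Not at hks
            have : om k * s (x + r1 • k) ≤ om k * τ := gcg
            linarith
        · have : 0 ≤ T.indicator (fun _ => C * cO n) k := indicator_nonneg (fun _ _ => pvt) k
          rw [ker_om.supp k (by linarith [not_lt.1 hk])]
          linarith
    _ = τ + C * cO n * (volume T).toReal := by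
        rw [integral_add (ker_om.int cco) hind, integral_indicator hTm, setIntegral_const]
        have := IB_c (n := n) τ
        simp only [IB] at this
        rw [this, Measure.real, sem]; ring
    _ ≤ _ := gcg
lemma J3 (hn : 0 < n) (hy : CD y) (hp : ∀ x, Psd (D2 y x)) (hΛ : 0 ≤ Λ)
    (hR : 0 < R) (hr1 : 0 < r1) (hr1R : r1 ≤ R / 4) (hs0 : 0 < s0) (hs0r : s0 ≤ r1)
    (hlap : ∀ x, ‖x‖ ≤ 2 * R → lap y x ≤ Λ) (hM : ∀ x, ‖x‖ ≤ R → wF s0 y x ≤ M)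
    (hτ : ∀ x, ‖x‖ + r1 ≤ R → Av om r1 (fun x => M - wF s0 y x) x ≤ τ1) (hx : ‖x‖ ≤ R / 4) :
    |y x - Av om (R / 4) (Av om r1 y) x + M * (R / 4) ^ 2| ≤ cW n / 2 * Λ * r1 ^ 2 + (τ1 + cW n / 2 * (cL n / r1 * Λ * s0)) * (R / 4) ^ 2 := by
  have hcW := cW_pos n
  have hcL := cL_one n
  have hyc := hy.continuous
  have hwc := (wF_cd hy s0).continuous
  set h := Av om r1 y with hh
  have hcd : CD h := Av_cd ker_om hy r1
  have hlh : ∀ z, lap h z = Av om r1 (lap y) z := fun z => Av_tr ker_om hy r1 z ee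
  have hl0 : ∀ z, 0 ≤ lap y z := fun z => tr_nonneg (hp z) _
  have tri : ∀ z x : E n, ‖z‖ ≤ ‖z - x‖ + ‖x‖ := fun z x => by
    have := norm_add_le (z - x) x
    rwa [sub_add_cancel] at this
  have key : ∀ x, ‖x‖ ≤ R / 2 → |cW n / 2 * lap h x - M| ≤ τ1 + cW n / 2 * (cL n / r1 * Λ * s0) := fun x hx => by
    have i1 : Av om s0 h x - h x = s0 ^ 2 * Av om r1 (wF s0 y) x := by
      rw [hh, Av_comm hyc]
      have hc := Av_cont hyc s0
      have hc' : Continuous fun k : E n => Av om s0 y (x + r1 • k) := hc.comp fpr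
      show IB om (fun k => Av om s0 y (x + r1 • k)) - IB om (fun k => y (x + r1 • k)) = s0 ^ 2 * IB om (fun k => wF s0 y (x + r1 • k))
      rw [← IB_sub ker_om hc' fpr, ← IB_mul]
      congr 1; ext k
      simp only [wF]
      field_simp
    have i2 : Av om r1 (fun x => M - wF s0 y x) x = M - Av om r1 (wF s0 y) x := by
      simp only [Av]
      rw [IB_sub ker_om fpr fpr, IB_c]
    have i3 := hτ x lnr
    have i4 : Av om r1 (wF s0 y) x ≤ M := by
      have : Av om r1 (wF s0 y) x ≤ Av om r1 (fun _ => M) x := by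
        refine IB_mono ker_om fpr fpr fun k hk => hM _ ?_
        have := norm_add_le x (r1 • k)
        rw [norm_smul, nnn hr1.le] at this
        nlinarith
      simpa [Av, IB_c] using this
    have lip : ∀ z, ‖z - x‖ ≤ s0 → |lap h z - lap h x| ≤ cL n / r1 * Λ * s0 := fun z hz => by
      rw [hlh, hlh]
      refine (avLip (cont_lap hy) hr1 lnr (M := Λ) fun u hu => ?_).trans gcg
      rw [abs_of_nonneg (hl0 u)]
      exact hlap u (by linarith [tri u x])
    have a1 := av_le hcd (x := x) (L := lap h x + cL n / r1 * Λ * s0) hs0.le fun z hz => by linarith [(abs_le.1 (lip z hz)).2]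
    have a2 := av_ge hcd (x := x) (L := lap h x - cL n / r1 * Λ * s0) hs0.le fun z hz => by linarith [(abs_le.1 (lip z hz)).1]
    have hs2 : 0 < s0 ^ 2 := pvt
    have a3 : s0 ^ 2 * Av om r1 (wF s0 y) x ≤ s0 ^ 2 * (cW n / 2 * (lap h x + cL n / r1 * Λ * s0)) := lnr
    have a4 : s0 ^ 2 * (cW n / 2 * (lap h x - cL n / r1 * Λ * s0)) ≤ s0 ^ 2 * Av om r1 (wF s0 y) x := lnr
    have a5 := le_of_mul_le_mul_left a3 hs2
    have a6 := le_of_mul_le_mul_left a4 hs2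
    have hτ1 : 0 ≤ τ1 := by rw [i2] at i3; linarith
    rw [abs_le]; constructor <;> linarith
  set ε1 := τ1 + cW n / 2 * (cL n / r1 * Λ * s0) with hε1
  have b1 := av_le hcd (x := x) (s := R / 4) (L := (M + ε1) / (cW n / 2)) pvt fun z hz => by
    rw [ldi pvt]; linarith [(abs_le.1 (key z (by linarith [tri z x]))).2]
  have b2 := av_ge hcd (x := x) (s := R / 4) (L := (M - ε1) / (cW n / 2)) pvt fun z hz => by
    rw [dli pvt]; linarith [(abs_le.1 (key z (by linarith [tri z x]))).1]
  rw [mul_div_cancel₀ _ pvt] at b1 b2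
  have b3 := Av_ge ker_om om_one hy hp x r1
  have b4 := av_le hy (x := x) (L := Λ) hr1.le fun z hz => hlap z (by linarith [tri z x])
  have e1 : (M + ε1) * (R / 4) ^ 2 = M * (R / 4) ^ 2 + ε1 * (R / 4) ^ 2 := rng
  have e2 : (M - ε1) * (R / 4) ^ 2 = M * (R / 4) ^ 2 - ε1 * (R / 4) ^ 2 := rng
  have : 0 ≤ cW n / 2 * Λ * r1 ^ 2 := pvt
  rw [abs_le]; constructor <;> linarith
lemma D2_quad (hs : Sym Q) (x : E n) : D2 (fun y => Q y y / 2) x = Q := by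
  have h1 : ∀ y, HasFDerivAt (fun y => Q y y / 2) (Q y) y := fun y => by
    have := (Q.hasFDerivAt (x := y)).clm_apply (hasFDerivAt_id y)
    have h2 := this.mul_const (1/2 : ℝ)
    refine (h2.congr_fderiv ?_).congr_of_eventuallyEq (evF fun z => ?_)
    · ext a; simp [hs a y]; ring
    · simp [div_eq_mul_inv]
  exact D2_of h1 Q.hasFDerivAt
lemma cd_quad (Q : BL n) : CD (fun y => Q y y / 2) := fpr
lemma tayl1 (hG : CD G) (hs : Sym Q) (hS : Convex ℝ S) (h0 : zE n ∈ S) (h : ∀ x ∈ S, ∀ a, Q a a - κ * ‖a‖ ^ 2 ≤ D2 G x a a) (hx : x ∈ S) :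
    G 0 + fd G 0 x + Q x x / 2 - κ / 2 * ‖x‖ ^ 2 ≤ G x := by
  have := uconv (y := fun x => G x - Q x x / 2) (l := -κ) (hG.sub (cd_quad Q)) hS (fun z hz a => by
    rw [D2_sub hG (cd_quad Q), D2_quad hs]
    simp only [sba]
    linarith [h z hz a]) h0 hx
  have hd : fd (fun x => G x - Q x x / 2) 0 = fd G 0 := by
    have h1 : HasFDerivAt (fun y => Q y y / 2) (0 : E n →L[ℝ] ℝ) 0 := by
      have := (Q.hasFDerivAt (x := zE n)).clm_apply (hasFDerivAt_id 0)
      have h2 := this.mul_const (1/2 : ℝ)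
      refine (h2.congr_fderiv ?_).congr_of_eventuallyEq (evF fun z => ?_)
      · ext a; simp
      · simp [div_eq_mul_inv]
    have h2 := (hasF hG 0).sub h1
    rw [sub_zero] at h2
    exact h2.fderiv
  rw [hd] at this
  simp at this
  linarith
lemma tayl (hG : CD G) (hs : Sym Q) (hS : Convex ℝ S) (h0 : zE n ∈ S) (h : ∀ x ∈ S, ∀ a, |D2 G x a a - Q a a| ≤ κ * ‖a‖ ^ 2) (hx : x ∈ S) :
    |G x - (G 0 + fd G 0 x + Q x x / 2)| ≤ κ / 2 * ‖x‖ ^ 2 := by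
  have h1 := tayl1 hG hs hS h0 (κ := κ) (fun z hz a => by linarith [(abs_le.1 (h z hz a)).1]) hx
  have h2 := tayl1 hG.neg (Q := -Q) (fun a b => by simp [hs a b]) hS h0 (κ := κ) (fun z hz a => by
    rw [D2_neg hG]
    simp only [_root_.neg_apply]
    linarith [(abs_le.1 (h z hz a)).2]) hx
  have hd : fd (fun x => - G x) 0 = - fd G 0 := (hasF hG 0).neg.fderiv
  rw [hd] at h2
  simp only [_root_.neg_apply] at h2
  rw [abs_le]; constructor <;> linarith
lemma Av_lo (hg : Continuous g) (hr : 0 ≤ r) (h : ∀ y, ‖y - x‖ ≤ r → c ≤ g y) : c ≤ Av om r g x := by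
  have : IB om (fun _ : E n => c) ≤ Av om r g x := by
    refine IB_mono ker_om fpr fpr fun k hk => h _ ?_
    rw [add_sub_cancel_left, norm_smul, nnn hr]
    nlinarith
  rwa [IB_c] at this
lemma Av_hi (hg : Continuous g) (hr : 0 ≤ r) (h : ∀ y, ‖y - x‖ ≤ r → g y ≤ c) : Av om r g x ≤ c := by
  have := Av_lo hg.neg (c := -c) hr (x := x) fun y hy => neg_le_neg (h y hy)
  have h2 : Av om r (-g) x = - Av om r g x := by
    simp only [Av, IB, Pi.neg_apply, mul_neg, integral_neg]
  linarith
lemma tri (z x : E n) : ‖z‖ ≤ ‖z - x‖ + ‖x‖ := by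
  have := norm_add_le (z - x) x
  rwa [sub_add_cancel] at this
lemma cont_D2a (hw : CD w) (a b : E n) : Continuous fun x => D2 w x a b := by
  have := cont_D2 hw
  fun_prop
lemma cont_tr (hw : CD w) (b : Fr n) : Continuous fun x => tr (D2 w x) b := by
  unfold tr
  exact continuous_finset_sum _ fun i _ => cont_D2a hw _ _
lemma J4 (hn : 3 ≤ n) {K : ℝ} (hϱ : 0 < ϱ) (hϱ1 : ϱ ≤ 1) (hΛ : 1 ≤ Λ) (hK : 1 ≤ K) (hCd : 0 < Cd) (hη : 0 < η) :
    ∃ θ Rm ε0 r0 : ℝ, 0 < θ ∧ θ ≤ 1 / 4 ∧ 0 < Rm ∧ 0 < ε0 ∧ 0 < r0 ∧ ∀ ε r v y g, 0 < ε → ε ≤ ε0 → 0 < r → r ≤ r0 → YD (n := n) ϱ Λ K Cd r ε v y g →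
      ∃ (R : ℝ) (A : BL n) (L : E n →L[ℝ] ℝ) (c : ℝ), Rm ≤ R ∧ R ≤ ϱ / 36 ∧ Sym A ∧ tr A ee ≤ Λ ∧ (∀ a, ((1 / 2) ^ n / (n * Λ) ^ n) * ‖a‖ ^ 2 ≤ A a a) ∧
        (∀ b, UF b → n * (1 - ε) ≤ tr A b) ∧ ∀ x, ‖x‖ ≤ θ * R → |v x - (c + L x + A x x / 2)| ≤ η * (θ * R) ^ 2 := by
  have hn0 : 0 < n := omg
  have hnR : (0 : ℝ) < n := by exact_mod_cast hn0
  have hcW := cW_pos n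
  have hcL := cL_one n
  have hcO := cO_pos n
  have hvB := vB_pos n
  obtain ⟨θ, hθ, hθ4, hθ2⟩ : ∃ θ : ℝ, 0 < θ ∧ θ ≤ 1 / 4 ∧ θ ≤ η / (8 * (cL n * n * Λ)) :=
    ⟨min (1 / 4) (η / (8 * (cL n * n * Λ))), by positivity, mll _ _, mlr _ _⟩
  obtain ⟨θ1, hθ1, hθ14, hθ12⟩ : ∃ θ1 : ℝ, 0 < θ1 ∧ θ1 ≤ 1 / 4 ∧ θ1 ≤ η * θ ^ 2 / (2 * (cW n * Λ)) :=
    ⟨min (1 / 4) (η * θ ^ 2 / (2 * (cW n * Λ))), by positivity, mll _ _, mlr _ _⟩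
  obtain ⟨C, hC⟩ := exR (cW n / 2 * Λ)
  have hC0 : 0 < C := by rw [hC]; positivity
  obtain ⟨τ, hτ, hτ2⟩ : ∃ τ : ℝ, 0 < τ ∧ τ + C * cO n * (τ * ((1 / θ1) ^ n * vB n)) ≤ 2 * (η * θ ^ 2) :=
    ⟨2 * (η * θ ^ 2) / (1 + C * cO n * ((1 / θ1) ^ n * vB n)), by positivity, le_of_eq (by field_simp)⟩
  obtain ⟨Rm, hRm, hJ⟩ := J12 hn0 hϱ hϱ1 hΛ hK hτ
  obtain ⟨s0, hs0, hs1, hs2, hs3⟩ : ∃ s0 : ℝ, 0 < s0 ∧ s0 ≤ ϱ / 4 ∧ s0 ≤ θ1 * Rm ∧ s0 ≤ θ1 * Rm * (2 * (η * θ ^ 2)) / (C * cL n) :=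
    ⟨min (ϱ / 4) (min (θ1 * Rm) (θ1 * Rm * (2 * (η * θ ^ 2)) / (C * cL n))), by positivity, mll _ _,
      (mlr _ _).trans (mll _ _), (mlr _ _).trans (mlr _ _)⟩
  obtain ⟨ε0, hε0, hJ⟩ := hJ s0 hs0 hs1
  refine ⟨θ, Rm, min ε0 (1 / 2), min 1 (η / 4 * (θ * Rm) ^ 2 / Cd), hθ, hθ4, hRm, by positivity, by positivity, ?_⟩
  intro ε r v y g hε hε' hr hr' hY
  obtain ⟨R, M, hR1, hR2, hM0, hM1, hw, hvol⟩ := hJ Cd r ε v y g hε (hε'.trans (mll _ _)) hY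
  have hε2 := hε'.trans (mlr _ _)
  have hR : 0 < R := hRm.trans_le hR1
  have hy := hY.cd
  have hyc := hy.continuous
  have hp : ∀ x, Psd (D2 y x) := fun x => psd_of_pos (hY.pos x)
  have hlap : ∀ x, ‖x‖ ≤ 2 * R → lap y x ≤ Λ := fun x hx => hY.lap x lnr
  have hr1 : 0 < θ1 * R := pvt
  have hr1R : θ1 * R ≤ R / 4 := (mmr hθ14 hR.le).trans_eq rng
  have hsr : s0 ≤ θ1 * R := hs2.trans gcg
  have J3' := fun x hx => J3 hn0 hy hp (x := x) (zero_le_one.trans hΛ) hR hr1 hr1R hs0 hsr hlap (fun x hx => (hw x hx).2)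
    (fun x hx => av_small hn0 (s := fun x => M - wF s0 y x) (continuous_const.sub (wF_cd hy s0).continuous) hR hr1 hτ hC0.le
      (fun x hx => by linarith [(hw x hx).1]) hvol hx) hx
  obtain ⟨h, hh⟩ := exF (Av om (θ1 * R) y)
  have hcd : CD h := hh ▸ Av_cd ker_om hy _
  obtain ⟨G, hG⟩ := exF (Av om (R / 4) h)
  have hGcd : CD G := hG ▸ Av_cd ker_om hcd _
  have D2h : ∀ x a b, D2 h x a b = Av om (θ1 * R) (fun y' => D2 y y' a b) x := fun x a b => by rw [hh, Av_D2 ker_om hy]; rfl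
  have D2G : ∀ x a b, D2 G x a b = Av om (R / 4) (fun y' => D2 h y' a b) x := fun x a b => by rw [hG, Av_D2 ker_om hcd]; rfl
  have trh : ∀ x b, tr (D2 h x) b = Av om (θ1 * R) (fun y' => tr (D2 y y') b) x := fun x b => by rw [hh, Av_tr ker_om hy]; rfl
  have trG : ∀ x b, tr (D2 G x) b = Av om (R / 4) (fun y' => tr (D2 h y') b) x := fun x b => by rw [hG, Av_tr ker_om hcd]; rfl
  have hR4 : 0 ≤ R / 4 := pvt
  have up : ∀ x, ‖x‖ ≤ R → ∀ a, |D2 h x a a| ≤ n * Λ * ‖a‖ ^ 2 := fun x hx a => by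
    rw [D2h, abs_le]
    constructor
    · refine le_trans ?_ (Av_lo (cont_D2a hy a a) hr1.le fun z _ => hp z a)
      have : 0 ≤ n * Λ * ‖a‖ ^ 2 := pvt
      linarith
    · refine Av_hi (cont_D2a hy a a) hr1.le fun z hz => (psd_le_tr (D2_symm hy z) (hp z) a).trans ?_
      have := hlap z (by linarith [tri z x])
      unfold lap at this
      gcongr
  have lip : ∀ x ∈ closedBall zE n (θ * R), ∀ a, |D2 G x a a - D2 G 0 a a| ≤ 4 * cL n * n * Λ * θ * ‖a‖ ^ 2 := fun x hx a => by
    rw [mcz] at hx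
    rw [D2G, D2G]
    refine (avLip (cont_D2a hcd a a) (r := R / 4) pvt (by rw [sub_zero]; linarith [mmr hθ4 hR.le]) (M := n * Λ * ‖a‖ ^ 2) fun z hz => up z (by rw [sub_zero] at hz; linarith) a).trans ?_
    rw [sub_zero]
    calc cL n / (R / 4) * (n * Λ * ‖a‖ ^ 2) * ‖x‖ ≤ cL n / (R / 4) * (n * Λ * ‖a‖ ^ 2) * (θ * R) := gcg
      _ = _ := by field_simp
  refine ⟨R, D2 G 0, fd G 0, G 0 - M * (R / 4) ^ 2, hR1, hR2, D2_symm hGcd 0, ?_, ?_, ?_, ?_⟩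
  · rw [trG]
    refine Av_hi (cont_tr hcd _) hR4 fun z hz => ?_
    rw [trh]
    refine Av_hi (cont_tr hy _) hr1.le fun z' hz' => hlap z' ?_
    rw [sub_zero] at hz
    linarith [tri z' z]
  · intro a
    rw [D2G]
    refine Av_lo (cont_D2a hcd a a) hR4 fun z hz => ?_
    rw [D2h]
    refine Av_lo (cont_D2a hy a a) hr1.le fun z' hz' => ?_
    rw [sub_zero] at hz
    refine low_eig (D2_symm hy z') (hp z') pvt ?_ (hlap z' (by linarith [tri z' z])) hΛ a
    rw [hY.det]
    have := hY.glo z'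
    gcongr
    linarith
  · intro b hb
    rw [trG]
    refine Av_lo (cont_tr hcd _) hR4 fun z hz => ?_
    rw [trh]
    refine Av_lo (cont_tr hy _) hr1.le fun z' hz' => ?_
    have h1 := amgm hn0 (D2_symm hy z') (hp z') hb (hY.gpos z').le (hY.det z').symm
    have := hY.glo z'
    exact le_trans gcg h1
  · intro x hx
    have t1 := tayl hGcd (D2_symm hGcd 0) (convex_closedBall 0 (θ * R)) (by simp; positivity) lip (x := x) (by simpa using hx)
    have hxR : ‖x‖ ≤ R / 4 := hx.trans ((mmr hθ4 hR.le).trans_eq rng)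
    have t2 := J3' x hxR
    rw [← hh, ← hG] at t2
    obtain ⟨t3, t4⟩ := hY.vy x lnr
    have e1 : 4 * cL n * n * Λ * θ / 2 * ‖x‖ ^ 2 ≤ η / 4 * (θ * R) ^ 2 := by
      have : 4 * cL n * n * Λ * θ / 2 ≤ η / 4 := by
        rw [ldi pvt] at hθ2
        linarith
      gcongr
    have e2 : Cd * r ^ 2 ≤ η / 4 * (θ * R) ^ 2 := by
      have h1 := hr'.trans (mll _ _)
      have h2 := hr'.trans (mlr _ _)
      rw [ldi hCd] at h2
      calc Cd * r ^ 2 ≤ Cd * (r * 1) := by rw [sq]; gcongr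
        _ = r * Cd := rng
        _ ≤ _ := h2
        _ ≤ _ := gcg
    have e3 : cW n / 2 * Λ * (θ1 * R) ^ 2 ≤ η / 4 * (θ * R) ^ 2 := by
      rw [ldi pvt] at hθ12
      have : cW n / 2 * Λ * θ1 ^ 2 ≤ η / 4 * θ ^ 2 := by
        have : cW n * Λ * θ1 ^ 2 ≤ cW n * Λ * (θ1 * 1) := by rw [sq]; gcongr; linarith
        linarith
      calc _ = cW n / 2 * Λ * θ1 ^ 2 * R ^ 2 := rng
        _ ≤ η / 4 * θ ^ 2 * R ^ 2 := gcg
        _ = _ := rng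
    have e4 : (τ + C * cO n * (τ * ((R / (θ1 * R)) ^ n * vB n)) + cW n / 2 * (cL n / (θ1 * R) * Λ * s0)) * (R / 4) ^ 2 ≤ η / 4 * (θ * R) ^ 2 := by
      rw [show R / (θ1 * R) = 1 / θ1 by field_simp]
      have h1 : cW n / 2 * (cL n / (θ1 * R) * Λ * s0) ≤ 2 * (η * θ ^ 2) := by
        rw [show cW n / 2 * (cL n / (θ1 * R) * Λ * s0) = C * cL n * s0 / (θ1 * R) by rw [hC]; ring, dli hr1]
        rw [ldi pvt] at hs3
        have : θ1 * Rm * (2 * (η * θ ^ 2)) ≤ θ1 * R * (2 * (η * θ ^ 2)) := gcg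
        linarith
      calc _ ≤ (2 * (η * θ ^ 2) + 2 * (η * θ ^ 2)) * (R / 4) ^ 2 := gcg
        _ = _ := rng
    rw [abs_le] at *
    constructor <;> linarith [t1.1, t1.2, t2.1, t2.2]
structure MA (Θ : ℝ) (u F : Fu n) : Prop where
  cd : CD u
  pos : ∀ x a, a ≠ 0 → 0 < D2 u x a a
  det : ∀ x, (mat (D2 u x)).det = F x ^ n
  fpos : ∀ x, 0 < F x
  err : Err F Θ
def Flat (u : Fu n) (R : ℝ) (B : Fr n) (η : ℝ) : Prop :=
  |(frM B).det| = R ^ n ∧ ∃ (p : E n) (c : ℝ), ∀ x, ‖x‖ ≤ 1 → |(R ^ 2)⁻¹ * u (LT B x) - (‖x‖ ^ 2 / 2 + inr p x + c)| ≤ η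
lemma det_ne {ρ : ℝ} (hρ : 0 < ρ) (hB : |(frM B).det| = ρ ^ n) : (frM B).det ≠ 0 := by
  intro h'; rw [h', abs_zero] at hB; exact (pow_pos hρ n).ne hB
lemma MA.lt (h : MA Θ u F) {ρ : ℝ} (hρ : 0 < ρ) (hB : |(frM B).det| = ρ ^ n) :
    MA (Θ / ρ) (fun x => (ρ ^ 2)⁻¹ * u (LT B x)) (fun x => F (LT B x)) := by
  refine ⟨contDiff_const.mul (h.cd.comp (LT B).contDiff), fun x a ha => ?_, fun x => ?_, fun x => h.fpos _, err_LT h.err hρ hB⟩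
  · rw [D2_LT h.cd]
    exact mul_pos pvt (h.pos _ _ fun h' => ha (LT_inj (det_ne hρ hB) (by rw [h', map_zero])))
  · have e : mat (D2 (fun x => (ρ^2)⁻¹ * u (LT B x)) x) = (ρ^2)⁻¹ • Matrix.of fun i j => D2 u (LT B x) (B i) (B j) := by
      ext i j; simp only [mat, of_apply, D2_LT h.cd, LT_ee, Matrix.smul_apply, sem]
    rw [e, det_smul, det_gram, card_fin, h.det, ← sq_abs (frM B).det, hB]
    have := pow_pos hρ n
    rw [← mul_assoc, inv_pow, ← pow_mul, ← pow_mul, mul_comm 2 n, imc pvt, one_mul]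
lemma LT_LT (B C : Fr n) (x : E n) : LT (fun i => LT B (C i)) x = LT B (LT C x) := by
  simp only [LT_apply _ x, map_sum, map_smul]
lemma frM_LT (B C : Fr n) : frM (fun i => LT B (C i)) = frM C * frM B := by
  ext i j
  simp [frM, LT_apply, Matrix.mul_apply]
lemma Flat.comp {ρ : ℝ} {C : Fr n} (hB : |(frM B).det| = ρ ^ n)
    (h : Flat (fun x => (ρ ^ 2)⁻¹ * u (LT B x)) r C η) : Flat u (ρ * r) (fun i => LT B (C i)) η := by
  obtain ⟨h1, p, c, h2⟩ := h
  refine ⟨by rw [frM_LT, det_mul, abs_mul, h1, hB, mul_pow, mul_comm], p, c, fun x hx => ?_⟩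
  have := h2 x hx
  rw [LT_LT, mul_pow, mul_inv, mul_comm (ρ ^ 2)⁻¹, mul_assoc]
  exact this
lemma q_frame {A : BL n} (hb : ∀ i j, A (b i) (b j) = if i = j then α else 0) (x : E n) :
    A (LT b x) (LT b x) = α * ‖x‖ ^ 2 := by
  rw [LT_apply, bl_sum, norm_sq_eq, mul_sum]
  refine sum_congr rfl fun i _ => ?_
  rw [sum_eq_single i (fun j _ hj => by rw [hb, if_neg hj.symm]; ring) smp, hb, if_pos rfl, norm_eq_abs, sq_abs]
  ring
lemma alpha_up (hn : 0 < n) {s : ℝ} (h : MA δ V F) (hδ : 0 < δ) (hδ1 : δ ≤ 1) (hα : 1 / 2 ≤ α) (hs : 0 < s)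
    (hs2 : s ≤ 1 / 2) (hη : 2 * η < α / 2 * s ^ 2) (hd : cF n 1 * δ ≤ s * vB n)
    (hq : ∀ x, ‖x‖ ≤ 1 → |V x - (α * ‖x‖ ^ 2 / 2 + inr p x + c)| ≤ η) : α ≤ 1 + 4 * s := by
  have hvB := vB_pos n
  have hα0 : 0 < α := lnr
  have hsub : MB p (α * (1 - s)) ⊆ gr V '' MB 0 1 := fun P hP => by
    obtain ⟨x, hx⟩ : ∃ x, x = α⁻¹ • (P - p) := ⟨_, rfl⟩
    have hPx : P = α • x + p := by rw [hx, smul_smul, mul_inv_cancel₀ hα0.ne', one_smul, sub_add_cancel]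
    have hxn : ‖x‖ < 1 - s := by
      rw [Metric.mem_ball, dist_eq_norm, hPx, add_sub_cancel_right, norm_smul, nnn hα0.le] at hP
      exact lt_of_mul_lt_mul_left hP hα0.le
    obtain ⟨z, hz, hz2⟩ := img_sub h.cd (p := P) (x := x) hs fun z hz => by
      have h1 := (abs_le.1 (hq x lnr)).2
      have h2 := (abs_le.1 (hq z (by linarith [tri z x]))).1
      have h3 : ‖z‖ ^ 2 = ‖x‖ ^ 2 + 2 * inr x (z - x) + s ^ 2 := by
        rw [← hz, ← norm_add_sq_real, add_sub_cancel]
      have h4 : inr P (z - x) = α * inr x (z - x) + (inr p z - inr p x) := by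
        rw [hPx, inner_add_left, inner_smul_left, inner_sub_right p]; simp
      rw [h4]
      rw [h3] at h2
      have : α * (‖x‖ ^ 2 + 2 * inr x (z - x) + s ^ 2) / 2 = α * ‖x‖ ^ 2 / 2 + α * inr x (z - x) + α / 2 * s ^ 2 := rng
      linarith
    exact ⟨z, by rw [mbz]; linarith [tri z x], hz2⟩
  have h1 := (measure_mono hsub).trans (mass_le hn h.cd h.pos h.det h.fpos h.err hδ hδ1 one_pos isOpen_ball.measurableSet subset_rfl)
  have hv1 : 0 < α * (1 - s) := mul_pos hα0 lnr
  rw [vol_ball _ hv1, vol_ball _ one_pos] at h1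
  have h2 := h1.trans (add_le_add_right (oRl hd) _)
  rw [← ofReal_add pvt pvt, ofReal_le_ofReal_iff pvt, one_pow, ← add_mul] at h2
  have h3 := le_of_mul_le_mul_right h2 hvB
  have h4 : (α * (1 - s)) ^ n ≤ (1 + s) ^ n := h3.trans (le_self_pow₀ lnr hn.ne')
  have h5 := le_of_pow_le_pow_left₀ hn.ne' lnr h4
  have : (1 + s) ≤ (1 + 4 * s) * (1 - s) := by nlinarith
  exact le_of_mul_le_mul_right (h5.trans this) lnr
lemma LT_smul (b : Fr n) (c : ℝ) (x : E n) : LT (fun i => c • b i) x = c • LT b x := by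
  simp only [LT_apply, smul_sum, smul_comm c]
lemma frM_smul (b : Fr n) (c : ℝ) : (frM (fun i => c • b i)).det = c ^ n * (frM b).det := by
  rw [show frM (fun i => c • b i) = c • frM b by ext i j; simp [frM], det_smul, card_fin]
lemma requad {A : BL n} (hα0 : 0 ≤ α) (hϱ : 0 < ϱ) (hb : ∀ i j, A (b i) (b j) = if i = j then α else 0)
    (hT : ∀ x, ‖x‖ ≤ 1 → ‖ϱ • LT b x‖ ≤ T) {L : E n →L[ℝ] ℝ} (hq : ∀ x, ‖x‖ ≤ T → |v x - (c + L x + A x x / 2)| ≤ κ) :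
    ∃ (p : E n) (c' : ℝ), ∀ x, ‖x‖ ≤ 1 → |(ϱ ^ 2)⁻¹ * v (LT (fun i => ϱ • b i) x) - (α * ‖x‖ ^ 2 / 2 + inr p x + c')| ≤ (ϱ ^ 2)⁻¹ * κ := by
  refine ⟨(InnerProductSpace.toDual ℝ (E n)).symm ((ϱ ^ 2)⁻¹ • L.comp (ϱ • LT b)), (ϱ ^ 2)⁻¹ * c, fun x hx => ?_⟩
  have := hq _ (hT x hx)
  rw [InnerProductSpace.toDual_symm_apply, LT_smul]
  have e : A (ϱ • LT b x) (ϱ • LT b x) = ϱ ^ 2 * (α * ‖x‖ ^ 2) := by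
    rw [← q_frame hb]; simp; ring
  rw [e] at this
  simp only [sma, comp_apply, sem]
  have e2 : (ϱ ^ 2)⁻¹ * v (ϱ • LT b x) - (α * ‖x‖ ^ 2 / 2 + (ϱ ^ 2)⁻¹ * L (ϱ • LT b x) + (ϱ ^ 2)⁻¹ * c) =
      (ϱ ^ 2)⁻¹ * (v (ϱ • LT b x) - (c + L (ϱ • LT b x) + ϱ ^ 2 * (α * ‖x‖ ^ 2) / 2)) := by field_simp; ring
  rw [e2, abs_mul, aop (by positivity : (0:ℝ) < (ϱ ^ 2)⁻¹)]
  gcongr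
theorem P6 (hn : 3 ≤ n) (hc1 : 0 < c1) (hc1' : c1 ≤ 1) (hC0 : 1 ≤ C0) (hη : 0 < η) :
    ∃ ϱm δ0 : ℝ, 0 < ϱm ∧ 0 < δ0 ∧ ∀ (δ : ℝ) (v f : Fu n), 0 < δ → δ ≤ δ0 → NData c1 C0 δ v f →
      ∃ ϱ B, ϱm ≤ ϱ ∧ ϱ ≤ 1 ∧ Flat v ϱ B η := by
  have hn0 : 0 < n := omg
  have hnR : (1 : ℝ) ≤ n := by exact_mod_cast hn0
  have hvB := vB_pos n
  obtain ⟨Λ, K, Cd, hΛ, hK, hCd, hP4⟩ := P4 hn hc1 hc1' hC0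
  obtain ⟨s, hs, hs4, hs3⟩ : ∃ s : ℝ, 0 < s ∧ s ≤ 1 / 4 ∧ s ≤ η / 3 := ⟨min (1 / 4) (η / 3), by positivity, mll _ _, mlr _ _⟩
  obtain ⟨l, hl⟩ := exR ((1 / 2) ^ n / (n * Λ) ^ n)
  have hl0 : 0 < l := by rw [hl]; positivity
  have hl1 : l ≤ 1 := by
    rw [hl]
    have h1 : ((1:ℝ) / 2) ^ n ≤ 1 := plo nnm nnm
    have h2 : 1 ≤ (n * Λ) ^ n := olp (by nlinarith)
    rw [div_le_one pvt]; linarith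
  obtain ⟨k, hk, hk1, hkl⟩ : ∃ k : ℝ, 0 < k ∧ 1 ≤ k ∧ k ^ 2 = Λ / l := by
    have : 1 ≤ Λ / l := by rw [ldi hl0]; linarith
    exact ⟨√(Λ / l), by positivity, by rwa [Real.one_le_sqrt], sq_sqrt pvt⟩
  obtain ⟨θ, Rm, ε0, r0, hθ, hθ4, hRm, hε0, hr0, hJ⟩ := J4 hn (ϱ := c1 / 8) pvt lnr hΛ hK hCd (η := s ^ 2 / 16 / k ^ 2) pvt
  obtain ⟨r, δ0, hr, hrr, hδ0, hP4⟩ := hP4 (min ε0 s) r0 pvt hr0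
  obtain ⟨ϱm, hϱm⟩ := exR (θ * Rm / k)
  have hϱm0 : 0 < ϱm := by rw [hϱm]; positivity
  refine ⟨ϱm, min δ0 (ϱm * min 1 (s * vB n / (|cF n 1| + 1))), hϱm0, by positivity, ?_⟩
  intro δ v f hδ hδ' hN
  obtain ⟨y, g, hY⟩ := hP4 δ v f hδ (hδ'.trans (mll _ _)) hN
  obtain ⟨R, A, L, c, hR1, hR2, hAs, hAt, hAl, hAb, hq⟩ := hJ _ r v y g pvt (mll _ _) hr hrr hY
  rw [← hl] at hAl
  have hR0 : 0 < R := hRm.trans_le hR1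
  have hAp : ∀ x, x ≠ 0 → 0 < A x x := fun x hx => lt_of_lt_of_le (by have := norm_pos_iff.2 hx; positivity) (hAl x)
  have hdet := det_pos hAs hAp
  obtain ⟨α, hα, hαd⟩ : ∃ α : ℝ, 0 < α ∧ (mat A).det = α ^ n :=
    ⟨(mat A).det ^ ((n:ℝ)⁻¹), by positivity, (rpow_inv_natCast_pow hdet.le hn0.ne').symm⟩
  obtain ⟨b, hb, hbA⟩ := frame hAs hAp hα hαd
  have hα1 : 1 - s ≤ α := by
    have h1 := hAb b hb
    rw [tr_frame hbA] at h1
    have h2 := le_of_mul_le_mul_left h1 lnr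
    linarith [mlr ε0 s]
  have hαΛ : α ≤ Λ := by
    have := amgm hn0 hAs (psd_of_pos hAp) UF_ee hα.le hαd.symm
    have h2 : 1 * α ≤ n * α := gcg
    linarith
  obtain ⟨ϱ, hϱ⟩ := exR (θ * R / k)
  have hϱ0 : 0 < ϱ := by rw [hϱ]; positivity
  have hϱϱ : ϱm ≤ ϱ := by rw [hϱ, hϱm]; gcongr
  have hT : ∀ x, ‖x‖ ≤ 1 → ‖ϱ • LT b x‖ ≤ θ * R := fun x hx => by
    have h1 := hAl (LT b x)
    rw [q_frame hbA] at h1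
    have h2 : ‖LT b x‖ ^ 2 ≤ k ^ 2 := by
      rw [hkl, ldi hl0]
      have := mul_le_mul hαΛ (plo (norm_nonneg _) hx : ‖x‖ ^ 2 ≤ 1) pvt pvt
      linarith
    have h3 := abs_le_of_sq_le_sq h2 hk.le
    rw [norm_smul, nnn hϱ0.le, hϱ, dmm, dli hk]
    gcongr
    rwa [abs_of_nonneg (norm_nonneg _)] at h3
  obtain ⟨p, c', hq'⟩ := requad hα.le hϱ0 hbA hT hq
  have hB : |(frM (fun i => ϱ • b i)).det| = ϱ ^ n := by
    have hu : |(frM b).det| = 1 := by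
      have : |(frM b).det| ^ 2 = 1 := by rw [sq_abs]; exact hb
      exact (pow_eq_one_iff_of_nonneg (abs_nonneg _) two_ne_zero).1 this
    rw [frM_smul, abs_mul, hu, mul_one, aop pvt]
  have hMA : MA δ v f := ⟨hN.cd, hN.pos, hN.det, hN.fpos, hN.err⟩
  have e : (ϱ ^ 2)⁻¹ * (s ^ 2 / 16 / k ^ 2 * (θ * R) ^ 2) = s ^ 2 / 16 := by
    rw [hϱ]; field_simp
  rw [e] at hq'
  have hδ2 : δ / ϱ ≤ min 1 (s * vB n / (|cF n 1| + 1)) := by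
    rw [dli hϱ0, mul_comm]
    exact (hδ'.trans (mlr _ _)).trans gcg
  have hα2 := alpha_up hn0 (hMA.lt hϱ0 hB) pvt (hδ2.trans (mll _ _)) lnr hs lnr (by
    have h1 : 0 < s ^ 2 := pvt
    have h2 : 3 / 8 * s ^ 2 ≤ α / 2 * s ^ 2 := mmr lnr h1.le
    linarith) (by
    have h1 := hδ2.trans (mlr _ _)
    rw [ldi pvt] at h1
    refine le_trans ?_ h1
    rw [mul_comm]
    gcongr
    linarith [le_abs_self (cF n 1)]) hq'
  refine ⟨ϱ, _, hϱϱ, ?_, hB, p, c', fun x hx => ?_⟩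
  · rw [hϱ, div_le_one hk]; exact (mul_le_one₀ lnr hR0.le lnr).trans hk1
  · have h1 := hq' x hx
    have h2 : ‖x‖ ^ 2 ≤ 1 := plo (norm_nonneg _) hx
    have h3 : |(α - 1) * ‖x‖ ^ 2 / 2| ≤ 2 * s := by
      rw [abs_div, abs_mul, abs_of_nonneg (sq_nonneg ‖x‖), aop (two_pos : (0:ℝ) < 2)]
      have : |α - 1| ≤ 4 * s := by rw [abs_le]; constructor <;> linarith
      have := mul_le_mul this h2 pvt pvt
      linarith
    have : s ^ 2 ≤ s := by rw [sq]; exact mlol hs.le lnr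
    rw [abs_le] at *
    constructor <;> linarith [h1.1, h1.2, h3.1, h3.2]
def cE (n : ℕ) : ℝ := Classical.choose (avg_err (n := n))
lemma cE_pos (n : ℕ) : 0 < cE n := (cSp (avg_err (n := n))).1
lemma av_err (hn : 0 < n) (he : Err f δ) (hδ : 0 < δ) (hr : 0 < r) (x : E n) :
    Av om r (fun y => |f y - 1|) x ≤ cE n * δ / r := (cSp (avg_err (n := n))).2 f δ x r hn he hδ hr
def Zf (v : Fu n) (x : E n) : ℝ := v x - ‖x‖ ^ 2 / 2
lemma cd_hsq : CD (fun y : E n => ‖y‖ ^ 2 / 2) := cd_nsq.div_const 2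
lemma D2_hsq (x a b : E n) : D2 (fun y : E n => ‖y‖ ^ 2 / 2) x a b = inr a b := by
  have : (fun y : E n => ‖y‖ ^ 2 / 2) = fun y => (1 / 2) * ‖y‖ ^ 2 := by ext; ring
  rw [this, D2_smul cd_nsq]
  simp only [sma, sem, D2_nsq]; ring
lemma Zf_cd (h : CD v) : CD (Zf v) := h.sub cd_hsq
lemma Zf_D2 (h : CD v) (x a b : E n) : D2 (Zf v) x a b = D2 v x a b - inr a b := by
  rw [← D2_hsq x]; exact congrArg (fun Q : BL n => Q a b) (D2_sub h cd_hsq x)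
lemma Zf_gr (h : CD v) (x : E n) : gr v x = x + gr (Zf v) x := by
  refine ext_inner_right ℝ fun y => ?_
  rw [inner_add_left, gr_inner, gr_inner]
  have h1 : HasFDerivAt (Zf v) (fd v x - (2:ℝ)⁻¹ • ((2:ℝ) • innerSL ℝ x)) x := by
    refine (hasF h x).sub (((hasF_nsq x).const_smul (2:ℝ)⁻¹).congr_of_eventuallyEq (evF fun z => ?_))
    simp; ring
  rw [h1.fderiv]
  simp
lemma MA.tr_ge (hn : 0 < n) (h : MA δ v f) (x : E n) (hb : UF b) :
    n - ∑ i, ‖b i‖ ^ 2 - n * |f x - 1| ≤ tr (D2 (Zf v) x) b := by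
  have h1 := amgm hn (D2_symm h.cd x) (psd_of_pos (h.pos x)) hb (h.fpos x).le (h.det x).symm
  have h2 : tr (D2 (Zf v) x) b = tr (D2 v x) b - ∑ i, ‖b i‖ ^ 2 := by
    simp only [tr, Zf_D2 h.cd, sum_sub_distrib, ris]
  have h3 := neg_abs_le (f x - 1)
  have : (n:ℝ) * (1 - |f x - 1|) ≤ n * f x := by gcongr; linarith
  linarith
lemma sum_ee_sq : ∑ i, ‖(ee i : E n)‖ ^ 2 = n := by simp [ee]
lemma MA.lap_ge (hn : 0 < n) (h : MA δ v f) (x : E n) : - (n * |f x - 1|) ≤ lap (Zf v) x := by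
  have := h.tr_ge hn x UF_ee
  rw [sum_ee_sq] at this
  unfold lap; linarith
lemma MA.sub (hn : 0 < n) (h : MA δ v f) (hδ : 0 < δ) (x : E n) (hr : 0 ≤ r) :
    Zf v x ≤ Av om r (Zf v) x + n * cE n * δ * r := by
  have hZ := Zf_cd h.cd
  have hfc := h.err.cont
  have hcl := cont_lap hZ
  obtain ⟨Z, hZZ⟩ := exF (Zf v)
  rw [← hZZ] at hZ hcl ⊢
  have hd : ∀ t, HasDerivAt (fun t => Av om t Z x + n * cE n * δ * t) (t * IB Wm (fun k => lap Z (x + t • k)) + n * cE n * δ * 1) t := fun t =>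
    (Av_deriv hZ x t).add ((hasDerivAt_id t).const_mul (n * cE n * δ))
  have := monotoneOn_of_deriv_nonneg (convex_Icc 0 r) (f := fun t => Av om t Z x + n * cE n * δ * t)
    (fun t _ => (hd t).continuousAt.continuousWithinAt) (fun t _ => (hd t).differentiableAt.differentiableWithinAt) (fun t ht => by
      rw [(hd t).deriv]
      rw [interior_Icc] at ht
      have h1 : IB Wm (fun k => - n * |f (x + t • k) - 1|) ≤ IB Wm (fun k => lap Z (x + t • k)) :=
        IB_mono ker_Wm fpr fpr fun k _ => by have := h.lap_ge hn (x + t • k); rw [hZZ]; linarith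
      rw [IB_mul] at h1
      have h2 := IB_Wm_le (g := fun k => |f (x + t • k) - 1|) fpr fun _ _ => abs_nonneg _
      have h3 := av_err hn h.err hδ ht.1 x
      rw [ldi ht.1] at h3
      simp only [Av] at h3
      have h4 : IB om (fun k => |f (x + t • k) - 1|) = IB om (fun k => |f (x + t • k) - 1|) := rfl
      have h5 := IB_nonneg ker_om (g := fun k => |f (x + t • k) - 1|) fun _ _ => abs_nonneg _
      have h6 := mml h1 ht.1.le
      have h7 : (n:ℝ) * t * IB Wm (fun k => |f (x + t • k) - 1|) ≤ n * t * IB om (fun k => |f (x + t • k) - 1|) := by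
        have := ht.1.le
        gcongr; linarith
      have h8 : (n:ℝ) * (IB om (fun k => |f (x + t • k) - 1|) * t) ≤ n * (cE n * δ) := gcg
      linarith)
  have h2 := this (left_mem_Icc.2 hr) (right_mem_Icc.2 hr) hr
  simp only [Av_zero] at h2
  linarith
lemma lapAv (hg : CD g) (r : ℝ) : lap (Av om r g) = Av om r (lap g) := by
  ext x; exact Av_tr ker_om hg r x ee
lemma AL (hg : Continuous g) (hh : Continuous h) (c r : ℝ) :
    Av om r (fun y => g y + c * h y) = fun x => Av om r g x + c * Av om r h x := by
  ext x; simp only [Av]; rw [IB_add ker_om fpr fpr, IB_mul]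
lemma Av_chi (g : Fu n) (hr : 0 < r) (x : E n) : r ^ n * Av om r g x = ∫ y, om (r⁻¹ • (y - x)) * g y := by
  have h1 := Measure.integral_comp_smul (volume : Measure (E n)) (fun z => om (r⁻¹ • z) * g (x + z)) r
  have h2 := integral_add_left_eq_self (μ := (volume : Measure (E n))) (fun y => om (r⁻¹ • (y - x)) * g y) x
  simp only [add_sub_cancel_left] at h2
  rw [← h2]
  simp only [smul_smul, imc hr.ne', one_smul, finrank_euclideanSpace_fin] at h1
  rw [Av, IB, h1, aop pvt, sem, mul_inv_cancel_left₀ pvt]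
lemma om_chi_int (hg : Continuous g) (hr : 0 < r) (x : E n) : Integrable fun y => om (r⁻¹ • (y - x)) * g y := by
  have h0 := (ker_om (n := n)).cont
  refine cIH fpr ?_
  refine HasCompactSupport.intro (iCB x r) fun y hy => ?_
  rw [ker_om.supp, zero_mul]
  rw [mem_closedBall, dist_eq_norm, not_le] at hy
  rw [norm_smul, norm_inv, nnn hr.le, ← div_eq_inv_mul, one_le_div hr]; exact hy.le
def c2 (n : ℕ) : ℝ := Classical.choose (om_low (n := n))
lemma c2_pos (n : ℕ) : 0 < c2 n := (cSp (om_low (n := n))).1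
lemma Av_int (hg : Continuous g) (h0 : ∀ y, 0 ≤ g y) (hr : 0 < r) (hS : MeasurableSet S)
    (hSr : ∀ y ∈ S, ‖y - x‖ ≤ r / 2) : c2 n * ∫ y in S, g y ≤ r ^ n * Av om r g x := by
  have hc := c2_pos n
  have hi := om_chi_int hg hr x
  rw [Av_chi g hr, ← integral_const_mul]
  have h2 : ∀ y, 0 ≤ om (r⁻¹ • (y - x)) * g y := fun y => mul_nonneg (ker_om.nonneg _) (h0 y)
  refine le_trans ?_ (setIntegral_le_integral hi (evF h2) (s := S))
  refine setIntegral_mono_on ?_ hi.integrableOn hS fun y hy => mmr ((cSp (om_low (n := n))).2 _ ?_) (h0 y)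
  · refine Integrable.const_mul ((hg.continuousOn.integrableOn_compact (iCB x (r/2))).mono_set fun y hy => ?_) _
    rw [mem_closedBall, dist_eq_norm]; exact hSr y hy
  · rw [norm_smul, norm_inv, nnn hr.le, ← div_eq_inv_mul, dli hr]; linarith [hSr y hy]
lemma gr_sq (w : Fu n) (x : E n) : ‖gr w x‖ ^ 2 = ∑ i, fd w x (ee i) ^ 2 := by
  rw [← ris, gr_inner]
  conv_lhs => rw [gr]
  simp [map_sum, sq]
lemma tr_av2 (hn : 0 < n) (hg : CD g) (hr : 0 < r) (hM : ∀ y, ‖y - x‖ ≤ 4 * r → |g y| ≤ M) :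
    Av om r (Av om r (lap g)) x ≤ n * ((cL n / r) ^ 2 * M) := by
  rw [← lapAv hg, ← lapAv (Av_cd ker_om hg r)]
  have : ∀ i ∈ Finset.univ, D2 (Av om r (Av om r g)) x (ee i) (ee i) ≤ (cL n / r) ^ 2 * M := fun i _ => by
    have := (abs_le.1 (av2 hg hr hM (ee i) (ee i))).2
    simpa [ee] using this
  have h := sum_le_sum this
  unfold lap tr; simpa using h
lemma energy (hn : 0 < n) : ∃ C : ℝ, 0 < C ∧ ∀ (v f : Fu n) (δ η : ℝ), MA δ v f → 0 < δ → δ ≤ η →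
    (∀ x, ‖x‖ ≤ 1 → |Zf v x| ≤ η) → ∫ y in MB 0 (1 / 16), ‖gr (Zf v) y‖ ^ 2 ≤ C * η ^ 2 := by
  have hc := c2_pos n
  have hcE := cE_pos n
  have hcL := cL_one n
  have hvB := vB_pos n
  have hnR : (0:ℝ) < n := by exact_mod_cast hn
  obtain ⟨A, hA⟩ := exR (3 * (n * (cL n / (1 / 4)) ^ 2) + 4 * n * (cE n / (1 / 4)))
  obtain ⟨q, hq⟩ := exR (c2 n / (1 / 4) ^ n)
  have hq0 : 0 < q := by rw [hq]; positivity
  refine ⟨A / (q ^ 2 * ((1 / 16) ^ n * vB n)), by rw [hA]; positivity, fun v f δ η h hδ hδη hZη => ?_⟩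
  have hη : 0 < η := hδ.trans_le hδη
  have hlg : ∀ x, - (n * |f x - 1|) ≤ lap (Zf v) x := h.lap_ge hn
  have hfc := h.err.cont
  have hZ := Zf_cd h.cd
  obtain ⟨Z, hZZ⟩ := exF (Zf v)
  simp only [← hZZ] at hZ hlg hZη ⊢
  have hZ2 : CD (fun y => Z y ^ 2) := hZ.pow 2
  obtain ⟨e, he⟩ := exF (fun y => ‖gr Z y‖ ^ 2)
  have hec : Continuous e := by have := cont_gr hZ; rw [he]; fun_prop
  have he0 : ∀ y, 0 ≤ e y := fun y => by rw [he]; positivity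
  have hsq : ∀ y, lap (fun y => Z y ^ 2) y = 2 * e y + 2 * Z y * lap Z y := fun y => by
    rw [he]
    simp only [lap, tr, gr_sq, mul_sum, ← sum_add_distrib]
    refine sum_congr rfl fun i _ => ?_
    have := D2_gcomp hZ (g := fun t => t ^ 2) (g' := fun t => 2 * t) (g'' := fun _ => 2) (fun t => by simpa using hasDerivAt_pow 2 t) (fun t => by simpa using (hasDerivAt_id t).const_mul 2) y (ee i) (ee i)
    rw [this]; ring
  have hcl := cont_lap hZ
  have hcl2 := cont_lap hZ2
  have hfa : Continuous fun y => |f y - 1| := fpr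
  have main : 0 ≤ Av om (1 / 4) (Av om (1 / 4) (fun y => ((lap (fun y => Z y ^ 2) y + (2 * η) * lap Z y) + (4 * n * η) * |f y - 1|) + (-2) * e y)) 0 := by
    refine Av_lo (Av_cont fpr _) nnm fun z hz => Av_lo fpr nnm fun y hy => ?_
    rw [sub_zero] at hz
    have h1 := hZη y (by linarith [tri y z])
    have h2 := hlg y
    rw [hsq]
    rw [abs_le] at h1
    have h3 : 0 ≤ (η + Z y) * (lap Z y + n * |f y - 1|) := mul_nonneg lnr lnr
    have h4 : 0 ≤ (η - Z y) * (n * |f y - 1|) := mul_nonneg lnr pvt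
    linarith
  rw [AL fpr hec, AL fpr hfa, AL hcl2 hcl] at main
  have c1 := Av_cont hcl (1 / 4)
  have c2' := Av_cont hcl2 (1 / 4)
  have c3 := Av_cont hfa (1 / 4)
  have c4 := Av_cont hec (1 / 4)
  rw [AL fpr c4, AL fpr c3, AL c2' c1] at main
  have t1 := tr_av2 hn hZ2 (x := 0) (r := 1 / 4) (M := η ^ 2) nnm fun y hy => by
    rw [abs_pow]
    have := hZη y (by rw [sub_zero] at hy; linarith)
    gcongr
  have t2 := tr_av2 hn hZ (x := 0) (r := 1 / 4) (M := η) nnm fun y hy => hZη y (by rw [sub_zero] at hy; linarith)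
  have t3 : Av om (1 / 4) (Av om (1 / 4) fun y => |f y - 1|) 0 ≤ cE n * δ / (1 / 4) := Av_hi c3 nnm fun y _ => av_err hn h.err hδ nnm y
  have t4 : 2 * Av om (1 / 4) (Av om (1 / 4) e) 0 ≤ A * η ^ 2 := by
    have e1 : 4 * n * η * Av om (1 / 4) (Av om (1 / 4) fun y => |f y - 1|) 0 ≤ 4 * n * η * (cE n * η / (1 / 4)) := by
      gcongr; exact t3.trans gcg
    have e2 : 2 * η * Av om (1 / 4) (Av om (1 / 4) (lap Z)) 0 ≤ 2 * η * (n * ((cL n / (1 / 4)) ^ 2 * η)) := gcg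
    have e3 : A * η ^ 2 = n * ((cL n / (1 / 4)) ^ 2 * η ^ 2) + 2 * η * (n * ((cL n / (1 / 4)) ^ 2 * η)) + 4 * n * η * (cE n * η / (1 / 4)) := by rw [hA]; ring
    linarith
  have hm : MeasurableSet (MB zE n (1 / 16)) := isOpen_ball.measurableSet
  have i0 : ∀ y, 0 ≤ Av om (1 / 4) e y := fun y => Av_lo hec nnm fun z _ => he0 z
  have i1 : ∀ z ∈ MB zE n (1 / 16), q * ∫ y in MB 0 (1 / 16), e y ≤ Av om (1 / 4) e z := fun z hz => by
    have := Av_int hec he0 (r := 1 / 4) (x := z) nnm hm fun y hy => by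
      rw [mbz] at hy hz
      linarith [norm_sub_le y z]
    rw [hq, dmm, dli pvt]; linarith
  have i2 := Av_int c4 i0 (r := 1 / 4) (x := 0) nnm hm fun y hy => by
      rw [mbz] at hy
      rw [sub_zero]; linarith
  have hfin : volume (MB zE n (1 / 16)) ≠ ⊤ := measure_ball_lt_top.ne
  have i3 : (q * ∫ y in MB 0 (1 / 16), e y) * ((1 / 16) ^ n * vB n) ≤ ∫ y in MB 0 (1 / 16), Av om (1 / 4) e y := by
    have h1 : ∫ y in MB zE n (1 / 16), (q * ∫ y in MB 0 (1 / 16), e y) ≤ _ :=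
      setIntegral_mono_on (integrableOn_const hfin) ((c4.continuousOn.integrableOn_compact (iCB 0 (1 / 16))).mono_set ball_subset_closedBall) hm i1
    rw [setIntegral_const, Measure.real, vol_ball _ nnm, toReal_ofReal pvt, sem] at h1
    linarith
  rw [dmm, ldi pvt]
  have i4 : q * ∫ y in MB 0 (1 / 16), Av om (1 / 4) e y ≤ Av om (1 / 4) (Av om (1 / 4) e) 0 := by
    rw [hq, dmm, dli pvt]; linarith
  have i5 := mml i3 hq0.le
  have i6 : 0 ≤ Av om (1 / 4) (Av om (1 / 4) e) 0 := Av_lo c4 nnm fun z _ => i0 z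
  have e4 : (∫ y in MB 0 (1 / 16), ‖gr Z y‖ ^ 2) * (q ^ 2 * ((1 / 16) ^ n * vB n)) = q * ((q * ∫ y in MB 0 (1 / 16), e y) * ((1 / 16) ^ n * vB n)) := by rw [he]; ring
  linarith
lemma om_cd2 : CD (om : Fu n) := om_cd.of_le (WithTop.coe_le_coe.2 le_top)
lemma tayl_gen (hg : CD g) (hs : HasCompactSupport g) :
    ∃ C : ℝ, 0 < C ∧ ∀ y a : E n, g (y + a) ≤ g y + fd g y a + C * ‖a‖ ^ 2 := by
  have h1 : HasCompactSupport (fd g) := hs.fderiv ℝ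
  obtain ⟨L, hL⟩ := (cd1 hg).lipschitzWith_of_hasCompactSupport h1 smp
  refine ⟨L + 1, by positivity, fun y a => ?_⟩
  have h2 := (convex_closedBall y ‖a‖).norm_image_sub_le_of_norm_fderiv_le' (fun z _ => (hasF hg z).differentiableAt)
    (fun z hz => (hL.norm_sub_le z y).trans (mml (mcB.1 hz) L.2)) (mem_closedBall_self (norm_nonneg a))
    (show y + a ∈ _ by simp)
  rw [add_sub_cancel_left] at h2
  have h3 := (le_abs_self _).trans h2
  have := sq_nonneg ‖a‖
  linarith
lemma fder_sc (hg : CD g) (r : ℝ) (x y a : E n) :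
    fd (fun y => g (r • (y - x))) y a = fd g (r • (y - x)) (r • a) := by
  have hd : HasFDerivAt (fun y => g (r • (y - x))) ((fd g (r • (y - x))).comp (r • CLi ℝ (E n))) y :=
    (hasF hg _).comp y (((hasFDerivAt_id y).sub_const x).const_smul r)
  rw [hd.fderiv]; simp
lemma cd_sc (hg : CD g) (r : ℝ) (x : E n) : ContDiff ℝ 1 (fun y => g (r • (y - x))) :=
  (hg.of_le nnm).comp ((contDiff_id.sub contDiff_const).const_smul _)
lemma mass (hn : 0 < n) : ∃ C : ℝ, 0 < C ∧ ∀ (v f : Fu n) (δ η : ℝ), MA δ v f → 0 < δ → δ ≤ η → η ≤ 1 / 8192 →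
    (∀ x, ‖x‖ ≤ 1 → |Zf v x| ≤ η) → ∀ x, ‖x‖ ≤ 1 / 64 → lap (Av om (1 / 1024) (Zf v)) x ≤ C * (η ^ 2 + δ) := by
  obtain ⟨C1, hC1, hen⟩ := energy hn
  obtain ⟨C2, hC2, hot⟩ := tayl_gen (om_cd2 (n := n)) ker_om.compactSupp
  have hcO := cO_pos n
  obtain ⟨ρ, hρe⟩ := exR (1 / 1024)
  have hρ : 0 < ρ := by rw [hρe]; norm_num
  obtain ⟨A, hA⟩ := exR (max (cO n * |cF n 1|) (C2 * (ρ⁻¹) ^ 2 * C1))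
  have hA0 : 0 < A := by rw [hA]; positivity
  have hA1 : cO n * |cF n 1| ≤ A := by rw [hA]; exact le_max_left _ _
  have hA2 : C2 * (ρ⁻¹) ^ 2 * C1 ≤ A := by rw [hA]; exact le_max_right _ _
  refine ⟨A / ρ ^ n, by positivity, fun v f δ η h hδ hδη hη hZη x hx => ?_⟩
  have hE := hen v f δ η h hδ hδη hZη
  have hZ := Zf_cd h.cd
  have hfc := h.err.cont
  have hGr := Zf_gr h.cd
  have hcv := cont_gr h.cd
  have hcG := cont_gr hZ
  have hcl := cont_lap hZ
  have hcom := (ker_om (n := n)).cont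
  rw [← hρe, lapAv hZ, dmm, ldi pvt, mul_comm, Av_chi _ hρ]
  have hB : MeasurableSet (MB zE n (1 / 16)) := isOpen_ball.measurableSet
  obtain ⟨χ, hχ⟩ := exF (fun y => om (ρ⁻¹ • (y - x)))
  have hχcd : ContDiff ℝ 1 χ := by
    rw [hχ]; exact cd_sc om_cd2 _ _
  have hχc := hχcd.continuous
  have hχ0 : ∀ y, 0 ≤ χ y := fun y => by rw [hχ]; exact ker_om.nonneg _
  have hχO : ∀ y, χ y ≤ cO n := fun y => by rw [hχ]; exact om_le _
  have hχs : ∀ y, ρ < ‖y - x‖ → χ y = 0 := fun y hy => by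
    rw [hχ]; refine ker_om.supp _ ?_
    rw [norm_smul, norm_inv, nnn hρ.le, ← div_eq_inv_mul, one_le_div hρ]; exact hy.le
  have hts : tsupport χ ⊆ closedBall x ρ := by
    refine closure_minimal (fun y hy => ?_) isClosed_closedBall
    by_contra hc
    rw [mem_closedBall, dist_eq_norm, not_le] at hc
    exact hy (hχs y hc)
  have hcs : HasCompactSupport χ := (iCB x ρ).of_isClosed_subset (isClosed_tsupport _) hts
  have hsB : ∀ y, y ∉ MB zE n (1 / 16) → y ∉ closedBall x ρ := fun y hy hc => hy (by
    rw [mem_closedBall, dist_eq_norm] at hc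
    rw [mbz]; linarith [tri y x])
  have hχB : ∀ y, y ∉ MB zE n (1 / 16) → χ y = 0 := fun y hy => image_eq_zero_of_notMem_tsupport fun h => hsB y hy (hts h)
  have hdB : ∀ y, y ∉ MB zE n (1 / 16) → fd χ y = 0 := fun y hy => by
    by_contra hc
    exact hsB y hy (hts (support_fderiv_subset ℝ hc))
  have hdc : Continuous (fd χ) := hχcd.continuous_fderiv nnm
  have him : ∀ y, y ∉ gr v '' MB zE n (1 / 16) → χ y = 0 := fun y hy => by
    by_contra hc
    have h1 : ‖y - x‖ ≤ ρ := by by_contra h2; exact hc (hχs y (not_le.1 h2))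
    have h2 : ‖y‖ ≤ 17 / 1024 := by linarith [tri y x]
    refine hy ?_
    obtain ⟨z, hz, hz'⟩ := img_sub h.cd (p := y) (x := 0) (s := 1 / 16) nnm fun z hz => by
      rw [sub_zero] at hz ⊢
      have a1 := abs_le.1 (hZη z (by rw [hz]; norm_num))
      have a2 := abs_le.1 (hZη 0 smp)
      have a3 := real_inner_le_norm y z
      have a4 : ‖y‖ * ‖z‖ ≤ 17 / 1024 * ‖z‖ := gcg
      simp only [Zf, hz, norm_zero] at a1 a2
      rw [hz] at a3 a4
      linarith [a1.1, a2.2]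
    exact ⟨z, by rw [mbz]; simpa using hz, hz'⟩
  have e1 : ∫ y, χ y = ∫ y in MB zE n (1 / 16), f y ^ n * χ (gr v y) := by
    rw [← setIntegral_eq_integral_of_forall_compl_eq_zero him,
      integral_image_eq_integral_abs_det_fderiv_smul volume hB (fun z _ => (hasF_gr h.cd z).hasFDerivWithinAt) (gr_inj h.cd h.pos).injOn]
    refine integral_congr_ae (evF fun z => ?_)
    simp only [grD_det h.cd, h.det, aop (pow_pos (h.fpos z) n), sem]
  have hint : ∀ g : Fu n, Continuous g → IntegrableOn g (MB zE n (1 / 16)) := fun g hg =>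
    (hg.continuousOn.integrableOn_compact (iCB 0 (1 / 16))).mono_set ball_subset_closedBall
  have e2 : ∫ y in MB zE n (1 / 16), |f y ^ n - 1| ≤ |cF n 1| * δ := by
    rw [← ofReal_le_ofReal_iff pvt, ofReal_integral_eq_lintegral_ofReal (hint _ fpr) (evF fun y => abs_nonneg _)]
    refine (int_fn hn h.err h.fpos hδ lnr one_pos (ball_subset_ball nnm)).trans (oRl ?_)
    gcongr; exact le_abs_self _
  have e3 : ∫ y in MB zE n (1 / 16), f y ^ n * χ (gr v y) ≤ ∫ y in MB zE n (1 / 16),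
      (cO n * |f y ^ n - 1| + χ y + fd χ y (gr (Zf v) y) + C2 * (ρ⁻¹) ^ 2 * ‖gr (Zf v) y‖ ^ 2) := by
    refine setIntegral_mono_on (hint _ fpr) (hint _ ?_) hB fun y _ => ?_
    · have : Continuous fun y => fd χ y (gr (Zf v) y) := hdc.clm_apply hcG
      fun_prop
    have t1 : (f y ^ n - 1) * χ (gr v y) ≤ cO n * |f y ^ n - 1| := by
      have := mul_le_mul (le_abs_self (f y ^ n - 1)) (hχO (gr v y)) (hχ0 _) (abs_nonneg _)
      linarith
    have t2 := hot (ρ⁻¹ • (y - x)) (ρ⁻¹ • gr (Zf v) y)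
    have t3 : fd χ y (gr (Zf v) y) = fd om (ρ⁻¹ • (y - x)) (ρ⁻¹ • gr (Zf v) y) := by
      rw [hχ]; exact fder_sc om_cd2 _ _ _ _
    have t4 : χ (gr v y) = om (ρ⁻¹ • (y - x) + ρ⁻¹ • gr (Zf v) y) := by
      have : ρ⁻¹ • (y - x) + ρ⁻¹ • gr (Zf v) y = ρ⁻¹ • (gr v y - x) := by rw [hGr, ← smul_add]; congr 1; abel
      rw [this, hχ]
    have t5 : χ y = om (ρ⁻¹ • (y - x)) := by rw [hχ]
    rw [norm_smul, mul_pow, norm_eq_abs, sq_abs] at t2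
    rw [t3, t5]
    rw [t4] at t1 ⊢
    linarith
  have hdG : Continuous fun y => fd χ y (gr (Zf v) y) := hdc.clm_apply hcG
  rw [integral_add (hint _ fpr) (hint _ fpr), integral_add (hint _ fpr) (hint _ fpr),
    integral_add (hint _ fpr) (hint _ fpr), integral_const_mul, integral_const_mul,
    setIntegral_eq_integral_of_forall_compl_eq_zero hχB,
    setIntegral_eq_integral_of_forall_compl_eq_zero (f := fun y => fd χ y (gr (Zf v) y)) (fun y hy => by rw [hdB y hy]; rfl)] at e3
  have e4 : ∫ y, fd χ y (gr (Zf v) y) = - ∫ y, χ y * lap (Zf v) y := by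
    have c1 : ∀ i : Fin n, ContDiff ℝ 1 fun y => fd (Zf v) y (ee i) := fun i => (hZ.fderiv_right nnm).clm_apply contDiff_const
    have ii : ∀ i : Fin n, Integrable fun y => fd χ y (ee i) * fd (Zf v) y (ee i) := fun i => by
      have := (c1 i).continuous
      refine cIH fpr ?_
      exact HasCompactSupport.mul_right (hcs.fderiv_apply ℝ (ee i))
    have ij : ∀ i : Fin n, Integrable fun y => χ y * D2 (Zf v) y (ee i) (ee i) := fun i => by
      have := cont_D2a hZ (ee i) (ee i)
      exact cIH fpr hcs.mul_right
    have : (fun y => fd χ y (gr (Zf v) y)) = fun y => ∑ i, fd χ y (ee i) * fd (Zf v) y (ee i) := by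
      ext y; rw [gr]; simp [map_sum, mul_comm]
    rw [this, integral_finset_sum _ fun i _ => ii i]
    have : (fun y => χ y * lap (Zf v) y) = fun y => ∑ i, χ y * D2 (Zf v) y (ee i) (ee i) := by
      ext y; rw [lap, tr, mul_sum]
    rw [this, integral_finset_sum _ fun i _ => ij i, ← sum_neg_distrib]
    refine sum_congr rfl fun i _ => ?_
    have := ibp hχcd hcs (c1 i) (ee i)
    have e : ∀ y, fd (fun y => fd (Zf v) y (ee i)) y (ee i) = D2 (Zf v) y (ee i) (ee i) := fun y => by
      have := ((hasFF hZ y).clm_apply (hasFDerivAt_const (ee i) y)).fderiv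
      rw [this]; simp
    simp only [e] at this
    linarith
  have e5 : (fun y => om (ρ⁻¹ • (y - x)) * lap (Zf v) y) = fun y => χ y * lap (Zf v) y := by rw [hχ]
  rw [e5]
  have e6 := mml e2 hcO.le
  have e7 : C2 * (ρ⁻¹) ^ 2 * ∫ y in MB zE n (1 / 16), ‖gr (Zf v) y‖ ^ 2 ≤ C2 * (ρ⁻¹) ^ 2 * (C1 * η ^ 2) := gcg
  have e8 := mmr hA1 hδ.le
  have e9 := mmr hA2 (sq_nonneg η)
  linarith
lemma UF_sq (hn : 0 < n) (hb : UF b) : (n:ℝ) ≤ ∑ i, ‖b i‖ ^ 2 := by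
  have hm : mat (D2 (fun y : E n => ‖y‖ ^ 2 / 2) 0) = 1 := by
    ext i j
    simp [mat, D2_hsq, ee, Matrix.one_apply, inner_single_left, Pi.single_apply]
  have := amgm hn (D2_symm cd_hsq 0) (fun x => by rw [D2_hsq]; exact real_inner_self_nonneg) hb zero_le_one (by rw [hm]; simp)
  simpa [tr, D2_hsq] using this
lemma abpZ (hn : 0 < n) (h : MA δ v f) (hδ : 0 < δ) (hη : 0 < η) (hκ : 0 < κ) (hr : 0 < r)
    (hr4 : r ≤ 1 / 4) (hx1 : ‖x1‖ ≤ 1 / 2) (hHc : CD H) (hM : 0 < M)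
    (hH : ∀ x, ‖x - x1‖ ≤ r → ∀ a, |D2 H x a a| ≤ M * η * ‖a‖ ^ 2) (hHZ : ∀ x, ‖x - x1‖ ≤ r → H x - Zf v x ≤ 2 * η)
    (h1 : κ * η ≤ H x1 - Zf v x1) (hs : (M + 8 / r ^ 2) * η ≤ 1 / 2) :
    (κ * η / 2 / (2 * r)) ^ n * vB n ≤ 2 ^ n * ((2 * n * (M + 8 / r ^ 2) * η) ^ n * (volume ({x | κ * η / 2 < H x - Zf v x} ∩ closedBall x1 r)).toReal
      + ((1 + 2 ^ n * ((2 * n : ℝ) ^ n + 0 ^ n * (1 ^ n * vB n))) * δ) ^ n) := by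
  have hvB := vB_pos n
  have hZ := Zf_cd h.cd
  have hnR : (0:ℝ) < n := by exact_mod_cast hn
  have hq : CD fun x : E n => ‖x + -x1‖ ^ 2 := cd_nsq.comp (contDiff_id.add contDiff_const)
  have hqD : ∀ x a : E n, D2 (fun x : E n => ‖x + -x1‖ ^ 2) x a a = 2 * ‖a‖ ^ 2 := fun x a => by
    rw [D2_shift cd_nsq, D2_nsq, ris]
  obtain ⟨k, hk⟩ := exR (4 * η / r ^ 2)
  have hk0 : 0 < k := by rw [hk]; positivity
  have hkr : k * r ^ 2 = 4 * η := by rw [hk]; field_simp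
  have hk8 : 8 / r ^ 2 * η = 2 * k := by rw [hk]; ring
  have hYc : CD fun x => (H x - Zf v x) - (k * ‖x + -x1‖ ^ 2 - -(κ * η / 2)) := (hHc.sub hZ).sub ((contDiff_const.mul hq).sub contDiff_const)
  obtain ⟨Y, hY⟩ := exF (fun x => (H x - Zf v x) - (k * ‖x + -x1‖ ^ 2 - -(κ * η / 2)))
  have hYD : ∀ x a, D2 Y x a a = D2 H x a a - (D2 v x a a - ‖a‖ ^ 2) - 2 * k * ‖a‖ ^ 2 := fun x a => by
    rw [hY, D2_sub (hHc.sub hZ) ((contDiff_const.mul hq).sub contDiff_const), D2_sub hHc hZ, D2_sub (contDiff_const.mul hq) contDiff_const, D2_smul hq, D2_const]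
    simp only [sba, sma, _root_.zero_apply, hqD, Zf_D2 h.cd, ris, sem]
    ring
  rw [← hY] at hYc
  have hSm : MeasurableSet {x | κ * η / 2 < H x - Zf v x} := (isOpen_lt cco (hHc.continuous.sub hZ.continuous)).measurableSet
  refine abp hn hYc (iCB x1 r) (mem_closedBall_self hr.le) pvt hr ?_ (fun x hx => mcB.1 hx) ?_ hSm
    (e := fun x => 2 * n * |f x - 1| + 0 * δ) pvt pvt (fun x _ => pvt) ?_ ?_
  · rw [hY]; simp; linarith
  · intro x hx hxY
    rw [interior_closedBall _ hr.ne']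
    rw [mcB] at hx
    rw [mem_ball_iff_norm]
    refine lt_of_le_of_ne hx fun he => ?_
    have := hHZ x hx
    rw [hY] at hxY
    simp only [← sub_eq_add_neg, he, hkr] at hxY
    have : 0 < κ * η := pvt
    linarith
  · exact err_lint hn h.err pvt le_rfl hδ one_pos fun x hx => by
      rw [mcB] at hx
      rw [mbz]; linarith [tri x x1]
  · rintro x ⟨hxK, hxm, -, hx2⟩
    rw [mcB] at hxK
    obtain ⟨b, hb, hbQ⟩ := frame (D2_symm h.cd x) (h.pos x) (h.fpos x) (h.det x)
    refine ⟨b, hb, ?_⟩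
    have hxS : x ∈ {x | κ * η / 2 < H x - Zf v x} := by
      rw [hY] at hxm
      have : 0 < κ * η := pvt
      have : 0 ≤ k * ‖x + -x1‖ ^ 2 := pvt
      simp only [mem_setOf_eq]; linarith
    rw [indicator_of_mem hxS]
    have hbi : ∀ i, D2 v x (b i) (b i) = f x := fun i => by rw [hbQ]; simp
    have hb2 : ∀ i, ‖b i‖ ^ 2 ≤ 2 * f x := fun i => by
      have t1 := hx2 (b i)
      rw [hYD, hbi] at t1
      have t2 := (abs_le.1 (hH x hxK (b i))).1
      have t3 := mmr hs (sq_nonneg ‖b i‖)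
      rw [add_mul, hk8] at t3
      linarith
    have e1 : tr (D2 Y x) b = ∑ i, D2 H x (b i) (b i) - (n * f x - ∑ i, ‖b i‖ ^ 2) - 2 * k * ∑ i, ‖b i‖ ^ 2 := by
      simp only [tr, hYD, hbi, sum_sub_distrib, mul_sum, sum_const, card_univ, card_fin, nsmul_eq_mul]
    have e2 : - (M * η * ∑ i, ‖b i‖ ^ 2) ≤ ∑ i, D2 H x (b i) (b i) := by
      rw [mul_sum, ← sum_neg_distrib]
      exact sum_le_sum fun i _ => (abs_le.1 (hH x hxK (b i))).1
    have e3 := UF_sq hn hb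
    have e4 : ∑ i, ‖b i‖ ^ 2 ≤ n * (2 * f x) := by
      simpa using sum_le_sum fun i (_ : i ∈ Finset.univ) => hb2 i
    have e5 := le_abs_self (f x - 1)
    have e6 : (M + 8 / r ^ 2) * η * ∑ i, ‖b i‖ ^ 2 ≤ (M + 8 / r ^ 2) * η * (n * (2 * (1 + |f x - 1|))) := by
      gcongr; exact e4.trans (by gcongr; linarith)
    have e7 : (M + 8 / r ^ 2) * η * (2 * n * |f x - 1|) ≤ 1 / 2 * (2 * n * |f x - 1|) := gcg
    have e8 : (M + 8 / r ^ 2) * η * ∑ i, ‖b i‖ ^ 2 = M * η * ∑ i, ‖b i‖ ^ 2 + 2 * k * ∑ i, ‖b i‖ ^ 2 := by rw [add_mul, hk8, add_mul]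
    have e9 : (n:ℝ) * (f x - 1) ≤ n * |f x - 1| := gcg
    rw [e1]
    linarith
lemma Av_le (hg : Continuous g) (hh : Continuous h) (hr : 0 ≤ r) (H : ∀ y, ‖y - x‖ ≤ r → g y ≤ h y + c) :
    Av om r g x ≤ Av om r h x + c := by
  have := Av_hi (g := fun y => g y + (-1) * h y) (c := c) fpr hr (x := x) fun y hy => by linarith [H y hy]
  rw [AL hg hh] at this
  linarith
lemma Av_abs (hg : Continuous g) (hr : 0 ≤ r) (H : ∀ y, ‖y - x‖ ≤ r → |g y| ≤ c) : |Av om r g x| ≤ c :=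
  abs_le.2 ⟨Av_lo hg hr fun y hy => (abs_le.1 (H y hy)).1, Av_hi hg hr fun y hy => (abs_le.1 (H y hy)).2⟩
def H3 (v : Fu n) : Fu n := Av om (1 / 1024) (Av om (1 / 1024) (Av om (1 / 1024) (Zf v)))
lemma K4 (hn : 0 < n) (hκ : 0 < κ) : ∃ γ η0 : ℝ, 0 < γ ∧ γ ≤ 1 ∧ 0 < η0 ∧ η0 ≤ 1 / 8192 ∧ ∀ (v f : Fu n) (δ η : ℝ), MA δ v f → 0 < δ →
    δ ≤ γ * η → 0 < η → η ≤ η0 → (∀ x, ‖x‖ ≤ 1 → |Zf v x| ≤ η) → ∀ x, ‖x‖ ≤ 1 / 1024 → |Zf v x - H3 v x| ≤ κ * η := by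
  obtain ⟨Cm, hCm, hmass⟩ := mass hn
  have hvB := vB_pos n
  have hc2 := c2_pos n
  have hcE := cE_pos n
  have hcL := cL_one n
  have hcW := cW_pos n
  have hnR : (0:ℝ) < n := by exact_mod_cast hn
  obtain ⟨ρ, hρe⟩ := exR (1 / 1024)
  have hρ : 0 < ρ := by rw [hρe]; norm_num
  obtain ⟨r, hre⟩ := exR (ρ / 4)
  have hr : 0 < r := by rw [hre]; positivity
  obtain ⟨M, hMe⟩ := exR ((cL n / ρ) ^ 2)
  have hM : 0 < M := by rw [hMe]; positivity
  obtain ⟨D, hD⟩ := exR (3 * (cW n / 2 * Cm * ρ ^ 2) + 3 * (n * cE n * ρ))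
  have hD0 : 0 < D := by rw [hD]; positivity
  obtain ⟨W, hW⟩ := exR (ρ ^ n * D / (c2 n * (κ / 2)))
  have hW0 : 0 < W := by rw [hW]; positivity
  obtain ⟨C1, hC1⟩ := exR (2 * n * (M + 8 / r ^ 2))
  have hC10 : 0 < C1 := by rw [hC1]; positivity
  obtain ⟨Ce, hCe⟩ := exR (1 + 2 ^ n * ((2 * n : ℝ) ^ n + 0 ^ n * (1 ^ n * vB n)))
  have hCe0 : 0 < Ce := by rw [hCe]; positivity
  obtain ⟨T, hT⟩ := exR ((κ / 2 / (2 * r)) ^ n * vB n)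
  have hT0 : 0 < T := by rw [hT]; positivity
  obtain ⟨q, hq⟩ := exR (2 ^ n * C1 ^ n * W)
  have hq0 : 0 < q := by rw [hq]; positivity
  obtain ⟨d0, hd0, hd⟩ := small_pow hn (A := 2 * Ce) (c := T / 4) pvt pvt
  refine ⟨min (min 1 (κ / (3 * (n * cE n * ρ)))) (min d0 (T / (8 * q))), min (1 / 8192) (min (1 / 2 / (M + 8 / r ^ 2)) (T / (8 * q))), by positivity, (mll _ _).trans (mll _ _), by positivity, mll _ _, ?_⟩
  intro v f δ η h hδ hδγ hη hη0 hZη x1 hx1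
  obtain ⟨γ, hγ⟩ := exR (min (min 1 (κ / (3 * (n * cE n * ρ)))) (min d0 (T / (8 * q))))
  have hγ0 : 0 < γ := by rw [hγ]; positivity
  rw [← hγ] at hδγ
  have hγ' := hγ.le
  simp only [le_min_iff] at hγ' hη0
  obtain ⟨⟨g1, g2⟩, g3, g4⟩ := hγ'
  obtain ⟨k1, k2, k3⟩ := hη0
  have hδη : δ ≤ η := hδγ.trans (mlol hη.le g1)
  have hm := hmass v f δ η h hδ hδη k1 hZη
  have hsub := fun x => h.sub hn hδ x hρ.le
  have hZ := Zf_cd h.cd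
  rw [H3]
  rw [← hρe] at hm hx1 ⊢
  obtain ⟨m, hme⟩ := exR (Cm * (η ^ 2 + δ))
  rw [← hme] at hm
  have hA1 := Av_cd ker_om hZ ρ
  have hA2 := Av_cd ker_om hA1 ρ
  have hA3 := Av_cd ker_om hA2 ρ
  have hA4 := Av_cd ker_om hA3 ρ
  obtain ⟨H, hH⟩ := exF (Av om ρ (Av om ρ (Av om ρ (Zf v))))
  obtain ⟨c, hc⟩ := exR (cW n / 2 * m * ρ ^ 2)
  obtain ⟨d, hde⟩ := exR (n * cE n * δ * ρ)
  rw [← hde] at hsub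
  have hd0' : 0 < d := by rw [hde]; positivity
  have u1 : ∀ x, ‖x‖ ≤ 1 / 64 - ρ → Av om ρ (Av om ρ (Zf v)) x ≤ Av om ρ (Zf v) x + c := fun x hx => by
    rw [hc]; exact av_le hA1 hρ.le fun y hy => hm y (by linarith [tri y x])
  have u2 : ∀ x, ‖x‖ ≤ 1 / 64 - 2 * ρ → Av om ρ (Av om ρ (Av om ρ (Zf v))) x ≤ Av om ρ (Av om ρ (Zf v)) x + c := fun x hx =>
    Av_le hA2.continuous hA1.continuous hρ.le fun y hy => u1 y (by linarith [tri y x])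
  have u3 : Av om ρ H x1 ≤ Av om ρ (Av om ρ (Av om ρ (Zf v))) x1 + c := by
    rw [hH]; exact Av_le hA3.continuous hA2.continuous hρ.le fun y hy => u2 y (by linarith [tri y x1])
  have u4 := u1 x1 lnr
  have u5 := u2 x1 lnr
  have w2 : ∀ x, Av om ρ (Zf v) x ≤ Av om ρ (Av om ρ (Zf v)) x + d := fun x => Av_le hZ.continuous hA1.continuous hρ.le fun y _ => hsub y
  have w3 : ∀ x, Av om ρ (Av om ρ (Zf v)) x ≤ Av om ρ (Av om ρ (Av om ρ (Zf v))) x + d := fun x => Av_le hA1.continuous hA2.continuous hρ.le fun y _ => w2 y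
  have w4 : ∀ x, Zf v x ≤ H x + 3 * d := fun x => by rw [hH]; linarith [hsub x, w2 x, w3 x]
  have z1 : ∀ x, ‖x‖ ≤ 1 - ρ → |Av om ρ (Zf v) x| ≤ η := fun x hx => Av_abs hZ.continuous hρ.le fun y hy => hZη y (by linarith [tri y x])
  have z2 : ∀ x, ‖x‖ ≤ 1 - 2 * ρ → |Av om ρ (Av om ρ (Zf v)) x| ≤ η := fun x hx => Av_abs hA1.continuous hρ.le fun y hy => z1 y (by linarith [tri y x])
  have z3 : ∀ x, ‖x‖ ≤ 1 - 3 * ρ → |H x| ≤ η := fun x hx => by rw [hH]; exact Av_abs hA2.continuous hρ.le fun y hy => z2 y (by linarith [tri y x])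
  have zD : ∀ x, ‖x‖ ≤ 1 - 5 * ρ → ∀ a, |D2 H x a a| ≤ M * η * ‖a‖ ^ 2 := fun x hx a => by
    rw [hH, hMe, sq ‖a‖, ← mul_assoc]; exact av2 hA1 hρ (fun y hy => z1 y (by linarith [tri y x])) a a
  rw [← hH] at u3 u5 hA3 hA4 ⊢
  have hd3 : 3 * d ≤ κ * η := by
    rw [ldi pvt] at g2
    have := mmr g2 hη.le
    have := mml hδγ (show 0 ≤ 3 * (n * cE n * ρ) by positivity)
    rw [hde]; linarith
  rw [abs_le]
  refine ⟨?_, by linarith [w4 x1]⟩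
  by_contra hcon
  obtain ⟨S, hS⟩ : ∃ S : Set (E n), S = {x | κ * η / 2 < H x - Zf v x} ∩ closedBall x1 r := ⟨_, rfl⟩
  have hSm : MeasurableSet S := by
    rw [hS]; exact (isOpen_lt cco (hA3.continuous.sub hZ.continuous)).measurableSet.inter isClosed_closedBall.measurableSet
  have hSf : volume S ≠ ⊤ := ((measure_mono (by rw [hS]; exact inter_subset_right)).trans_lt measure_closedBall_lt_top).ne
  have hgc : Continuous fun x => H x + (-1) * (Zf v x + -3 * d) := by have := hA3.continuous; have := hZ.continuous; fun_prop
  have p1 := Av_int hgc (fun y => by linarith [w4 y]) hρ (x := x1) hSm fun y hy => by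
    rw [hS] at hy
    have := mcB.1 hy.2
    linarith
  have p2 : κ * η / 2 * (volume S).toReal ≤ ∫ y in S, (H y + (-1) * (Zf v y + -3 * d)) := by
    have := setIntegral_mono_on (f := fun _ => κ * η / 2) (integrableOn_const hSf) ((hgc.continuousOn.integrableOn_compact (iCB x1 r)).mono_set (by rw [hS]; exact inter_subset_right)) hSm fun y hy => by
      rw [hS] at hy
      have : κ * η / 2 < H y - Zf v y := hy.1
      linarith
    rw [setIntegral_const, sem, Measure.real] at this
    linarith
  have p3 : Av om ρ (fun x => H x + (-1) * (Zf v x + -3 * d)) x1 ≤ 3 * c + 3 * d := by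
    have := Av_le (g := fun x => H x + (-1) * (Zf v x + -3 * d)) (h := fun x => H x + (-1) * Zf v x) (c := 3 * d) hgc (by have := hA3.continuous; have := hZ.continuous; fun_prop) hρ.le (x := x1) fun y _ => lnr
    rw [AL hA3.continuous hZ.continuous] at this
    beta_reduce at this
    linarith
  have p4 : 3 * c + 3 * d ≤ D * (η ^ 2 + δ) := by
    have : 0 ≤ 3 * (n * cE n * ρ) * η ^ 2 := pvt
    rw [hc, hde, hD, hme]; linarith
  have p5 : (volume S).toReal ≤ W * (η + γ) := by
    rw [hW, dmm, ldi pvt]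
    have q1 := mml p2 hc2.le
    have q2 : ρ ^ n * Av om ρ (fun x => H x + (-1) * (Zf v x + -3 * d)) x1 ≤ ρ ^ n * (D * (η ^ 2 + γ * η)) := by
      gcongr; exact p3.trans (p4.trans gcg)
    refine le_of_mul_le_mul_right ?_ hη
    linarith
  have fin := abpZ hn h hδ hη hκ hr (by rw [hre, hρe]; norm_num) (hx1.trans (by rw [hρe]; norm_num)) hA3 hM (fun x hx a => zD x (by linarith [tri x x1]) a)
    (fun x hx => by
      have a1 := abs_le.1 (z3 x (by linarith [tri x x1]))
      have a2 := abs_le.1 (hZη x (by linarith [tri x x1]))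
      linarith [a1.2, a2.1]) lnr (by rwa [ldi pvt, mul_comm] at k2)
  rw [← hS, ← hC1, ← hCe] at fin
  have f1 : (C1 * η) ^ n * (volume S).toReal ≤ (C1 * η) ^ n * (W * (η + γ)) := gcg
  have f2 : (Ce * δ) ^ n ≤ (Ce * (γ * η)) ^ n := gcg
  have f3 := hd γ hγ0 g3
  have f4 : T * η ^ n ≤ η ^ n * (q * (η + γ) + (2 * Ce * γ) ^ n) := by
    have e1 : T * η ^ n = (κ * η / 2 / (2 * r)) ^ n * vB n := by rw [hT, show κ * η / 2 / (2 * r) = κ / 2 / (2 * r) * η by ring, mul_pow]; ring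
    have e2 : η ^ n * (q * (η + γ) + (2 * Ce * γ) ^ n) = 2 ^ n * ((C1 * η) ^ n * (W * (η + γ)) + (Ce * (γ * η)) ^ n) := by
      rw [hq]; simp only [mul_pow]; ring
    rw [e1, e2]
    exact fin.trans gcg
  have f5 : T ≤ q * (η + γ) + (2 * Ce * γ) ^ n := le_of_mul_le_mul_right lnr (pow_pos hη n)
  rw [ldi pvt] at g4 k3
  linarith
lemma trAv (hg : CD g) (r : ℝ) (b : Fr n) :
    (fun x => tr (D2 (Av om r g) x) b) = Av om r (fun x => tr (D2 g x) b) := by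
  ext x; exact Av_tr ker_om hg r x b
lemma K5 (hn : 0 < n) : ∃ θ γ η0 : ℝ, 0 < θ ∧ θ ≤ 1 / 4 ∧ 0 < γ ∧ 0 < η0 ∧ η0 ≤ 1 / 8 ∧ ∀ (v f : Fu n) (δ η : ℝ), MA δ v f → 0 < δ →
    δ ≤ γ * η → 0 < η → η ≤ η0 → (∀ x, ‖x‖ ≤ 1 → |Zf v x| ≤ η) → ∃ B, Flat v θ B (η / 2) := by
  obtain ⟨Cm, hCm, hmass⟩ := mass hn
  have hcE := cE_pos n
  have hcL := cL_one n
  have hnR : (1:ℝ) ≤ n := by exact_mod_cast hn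
  obtain ⟨ρ, hρe⟩ := exR (1 / 1024)
  have hρ : 0 < ρ := by rw [hρe]; norm_num
  obtain ⟨M, hMe⟩ := exR ((cL n / ρ) ^ 2)
  have hM : 0 < M := by rw [hMe]; positivity
  obtain ⟨N, hNe⟩ := exR ((cL n / ρ) ^ 3)
  have hN : 0 < N := by rw [hNe]; positivity
  obtain ⟨C, hC⟩ := exR (Cm + cE n / ρ)
  have hC0 : 0 < C := by rw [hC]; positivity
  obtain ⟨θ, hθ⟩ := exR (min (ρ / 2) (1 / (32 * N)))
  have hθ0 : 0 < θ := by rw [hθ]; positivity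
  have hθ1 : θ ≤ ρ / 2 := by rw [hθ]; exact mll _ _
  have hθ2 : θ * (32 * N) ≤ 1 := by rw [← ldi pvt, hθ]; exact mlr _ _
  obtain ⟨γ1, η1, hγ1, hγ11, hη1, hη11, hK⟩ := K4 hn (κ := θ ^ 2 / 8) pvt
  refine ⟨θ, min γ1 (1 / (8 * C)), min η1 (min (1 / (8 * C)) (1 / (2 * M))), hθ0, by linarith, by positivity, by positivity,
    (mll _ _).trans lnr, fun v f δ η h hδ hδγ hη hη0 hZη => ?_⟩
  obtain ⟨γ, hγ⟩ := exR (min γ1 (1 / (8 * C)))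
  rw [← hγ] at hδγ
  have hγ' := hγ.le
  rw [le_min_iff] at hγ'
  simp only [le_min_iff] at hη0
  obtain ⟨k1, k2, k3⟩ := hη0
  have hδγ1 : δ ≤ γ1 * η := hδγ.trans (by gcongr; exact hγ'.1)
  have hδη : δ ≤ η := hδγ1.trans (mlol hη.le hγ11)
  have hKK := hK v f δ η h hδ hδγ1 hη k1 hZη
  have hm := hmass v f δ η h hδ hδη lnr hZη
  have hZ := Zf_cd h.cd
  rw [H3, ← hρe] at hKK
  rw [← hρe] at hm
  rw [ldi pvt] at k2 k3
  have k4 : C * (η ^ 2 + δ) ≤ η / 4 := by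
    have := (ldi pvt).1 hγ'.2
    have e1 := mmr this hη.le
    have e2 := mmr k2 hη.le
    have e3 := mml hδγ hC0.le
    linarith
  have hA1 := Av_cd ker_om hZ ρ
  have hA2 := Av_cd ker_om hA1 ρ
  have hA3 := Av_cd ker_om hA2 ρ
  obtain ⟨H, hH⟩ := exF (Av om ρ (Av om ρ (Av om ρ (Zf v))))
  have z1 : ∀ x, ‖x‖ ≤ 1 - ρ → |Av om ρ (Zf v) x| ≤ η := fun x hx => Av_abs hZ.continuous hρ.le fun y hy => hZη y (by linarith [tri y x])
  have zD : ∀ a, |D2 H 0 a a| ≤ M * η * ‖a‖ ^ 2 := fun a => by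
    rw [hH, hMe, sq ‖a‖, ← mul_assoc]; exact av2 hA1 hρ (fun y hy => z1 y (by rw [sub_zero] at hy; linarith)) a a
  have zT : ∀ x, ‖x‖ ≤ 2 * θ → ∀ a, |D2 H x a a - D2 H 0 a a| ≤ N * η * (2 * θ) * ‖a‖ ^ 2 := fun x hx a => by
    have := av3 hZ hρ (x := 0) (x' := x) (M := η) (by rw [sub_zero]; linarith) (fun y hy => hZη y (by rw [sub_zero] at hy; linarith)) a a
    rw [← hH, sub_zero, ← hNe] at this
    have e : N * η * ‖a‖ * ‖a‖ * ‖x‖ ≤ N * η * ‖a‖ * ‖a‖ * (2 * θ) := gcg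
    linarith
  have zL : lap H 0 ≤ Cm * (η ^ 2 + δ) := by
    rw [hH, lapAv hA2, lapAv hA1]
    have c1 := cont_lap hA1
    refine Av_hi (Av_cont c1 _) hρ.le fun y hy => Av_hi c1 hρ.le fun z hz => hm z ?_
    rw [sub_zero] at hy; linarith [tri z y]
  have zB : ∀ b : Fr n, UF b → n - ∑ i, ‖b i‖ ^ 2 - n * (cE n / ρ * δ) ≤ tr (D2 H 0) b := fun b hb => by
    have e1 : tr (D2 H 0) b = Av om ρ (Av om ρ (Av om ρ fun x => tr (D2 (Zf v) x) b)) 0 := by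
      rw [← trAv hZ, ← trAv hA1, ← trAv hA2, hH]
    have c0 := cont_tr hZ b
    have hfc := h.err.cont
    rw [e1]
    refine Av_lo (Av_cont (Av_cont c0 _) _) hρ.le fun y _ => Av_lo (Av_cont c0 _) hρ.le fun z _ => ?_
    have := Av_lo (g := fun x => tr (D2 (Zf v) x) b + n * |f x - 1|) (c := n - ∑ i, ‖b i‖ ^ 2) fpr hρ.le (x := z) fun y _ => by linarith [h.tr_ge hn y hb]
    rw [AL c0 fpr] at this
    have e2 := mml (av_err hn h.err hδ hρ z) (show (0:ℝ) ≤ n by linarith)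
    rw [show cE n / ρ * δ = cE n * δ / ρ by ring]
    linarith
  rw [← hH] at hKK hA3
  obtain ⟨G, hG⟩ := exF (fun y => H y + ‖y‖ ^ 2 / 2)
  have hGc : CD G := by rw [hG]; exact hA3.add cd_hsq
  have hGD : ∀ x a, D2 G x a a = D2 H x a a + ‖a‖ ^ 2 := fun x a => by
    rw [hG, D2_add hA3 cd_hsq, _root_.add_apply, _root_.add_apply, D2_hsq, ris]
  have hGt : ∀ b : Fr n, tr (D2 G 0) b = tr (D2 H 0) b + ∑ i, ‖b i‖ ^ 2 := fun b => by simp only [tr, hGD, sum_add_distrib]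
  have hlow : ∀ a, 1 / 2 * ‖a‖ ^ 2 ≤ D2 G 0 a a := fun a => by
    have e1 := (abs_le.1 (zD a)).1
    have e2 := mmr (show M * η ≤ 1 / 2 by linarith) (sq_nonneg ‖a‖)
    rw [hGD]; linarith
  have hpos : ∀ a, a ≠ 0 → 0 < D2 G 0 a a := fun a ha => lt_of_lt_of_le (by have := norm_pos_iff.2 ha; positivity) (hlow a)
  have hsym := D2_symm hGc 0
  have hdet := det_pos hsym hpos
  obtain ⟨α, hα0, hα⟩ : ∃ α : ℝ, 0 < α ∧ (mat (D2 G 0)).det = α ^ n :=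
    ⟨(mat (D2 G 0)).det ^ ((n:ℝ)⁻¹), by positivity, (rpow_inv_natCast_pow hdet.le hn.ne').symm⟩
  obtain ⟨b, hb, hbQ⟩ := frame hsym hpos hα0 hα
  have hα1 : |α - 1| ≤ η / 4 := by
    have e1 := tr_frame hbQ
    have e2 := zB b hb
    have e3 := amgm hn hsym (psd_of_pos hpos) UF_ee hα0.le hα.symm
    rw [hGt] at e1 e3
    rw [sum_ee_sq] at e3
    have e4 : tr (D2 H 0) ee = lap H 0 := rfl
    have q1 : 0 ≤ Cm * (η ^ 2 + δ) := pvt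
    have q2 : 0 ≤ cE n / ρ * η ^ 2 := pvt
    have q3 : 0 ≤ cE n / ρ * δ := pvt
    rw [hC] at k4
    refine abs_le.2 ⟨?_, ?_⟩
    · have : (n:ℝ) * (1 - cE n / ρ * δ) ≤ n * α := lnr
      have := le_of_mul_le_mul_left this lnr
      linarith
    · have : (n:ℝ) * (α - 1) ≤ n * (Cm * (η ^ 2 + δ)) := by
        have h1n : (1:ℝ) ≤ n := by exact_mod_cast hn
        linarith [le_mul_of_one_le_left q1 h1n]
      have := le_of_mul_le_mul_left this lnr
      linarith
  have hα2 := abs_le.1 hα1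
  have hLT : ∀ x, ‖x‖ ≤ 1 → ‖θ • LT b x‖ ≤ 2 * θ := fun x hx => by
    rw [norm_smul, nnn hθ0.le]
    have e1 := hlow (LT b x)
    rw [q_frame hbQ] at e1
    have e2 : ‖x‖ ^ 2 ≤ 1 := plo (norm_nonneg _) hx
    have : ‖LT b x‖ ≤ 2 := by
      refine le_of_pow_le_pow_left₀ two_ne_zero nnm ?_
      have : α * ‖x‖ ^ 2 ≤ 2 * 1 := by gcongr; linarith
      linarith
    exact (mml this hθ0.le).trans_eq (mul_comm _ _)
  obtain ⟨p, c, hpc⟩ := requad (v := v) (κ := θ ^ 2 / 8 * η + N * η * (2 * θ) / 2 * (2 * θ) ^ 2) hα0.le hθ0 hbQ hLT (L := fd G 0) (c := G 0) fun x hx => by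
    have e1 := tayl hGc hsym (convex_closedBall 0 (2 * θ)) (mem_closedBall_self pvt) (κ := N * η * (2 * θ)) (fun z hz a => by
      rw [hGD, hGD, add_sub_add_right_eq_sub]; exact zT z (mem_closedBall_zero_iff.1 hz) a) (mem_closedBall_zero_iff.2 hx)
    have e2 := hKK x lnr
    have e3 : N * η * (2 * θ) / 2 * ‖x‖ ^ 2 ≤ N * η * (2 * θ) / 2 * (2 * θ) ^ 2 := gcg
    have e4 : Zf v x - H x = v x - G x := by rw [hG, Zf]; ring
    rw [e4] at e2
    rw [abs_le] at e1 e2 ⊢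
    constructor <;> linarith [e1.1, e1.2, e2.1, e2.2]
  refine ⟨fun i => θ • b i, ?_, p, c, fun x hx => ?_⟩
  · rw [frM_smul, abs_mul, aop pvt]
    have : |(frM b).det| = 1 := by
      rw [← sq_eq_sq₀ (abs_nonneg _) zero_le_one, sq_abs, one_pow]; exact hb
    rw [this, mul_one]
  · have e1 := hpc x hx
    have e2 : (θ ^ 2)⁻¹ * (θ ^ 2 / 8 * η + N * η * (2 * θ) / 2 * (2 * θ) ^ 2) = η / 8 + θ * (4 * N) * η := by field_simp; ring
    have e3 := mmr hθ2 hη.le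
    have e4 : |(α - 1) * ‖x‖ ^ 2| ≤ η / 4 * 1 := by
      rw [abs_mul, abs_of_nonneg (sq_nonneg ‖x‖)]
      gcongr; exact plo (norm_nonneg _) hx
    rw [e2] at e1
    rw [abs_le] at e1 e4 ⊢
    constructor <;> linarith [e1.1, e1.2, e4.1, e4.2]
lemma D2_aff (hv : CD v) (p : E n) (c : ℝ) (x : E n) : D2 (fun y => v y - (inr p y + c)) x = D2 v x := by
  exact D2_of (fun y => (hasF hv y).sub (((innerSL ℝ p).hasFDerivAt).add_const c)) ((hasFF hv x).sub_const _)
lemma P7 (hn : 0 < n) : ∃ θ γ η0 : ℝ, 0 < θ ∧ θ ≤ 1 / 4 ∧ 0 < γ ∧ 0 < η0 ∧ η0 ≤ 1 / 8 ∧ ∀ (v f : Fu n) (δ η R : ℝ) (B : Fr n), MA δ v f → 0 < δ → 0 < R →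
    δ / R ≤ γ * η → 0 < η → η ≤ η0 → Flat v R B η → ∃ B, Flat v (R * θ) B (η / 2) := by
  obtain ⟨θ, γ, η0, h1, h2, h3, h4, h5, hK⟩ := K5 hn
  refine ⟨θ, γ, η0, h1, h2, h3, h4, h5, fun v f δ η R B h hδ hR hδγ hη hη0 ⟨hB, p, c, hpc⟩ => ?_⟩
  have hw := h.lt hR hB
  obtain ⟨w, hwe⟩ := exF (fun x => (R ^ 2)⁻¹ * v (LT B x))
  rw [← hwe] at hw
  have hD := D2_aff hw.cd p c
  obtain ⟨C, hC, p', c', hC'⟩ := hK (fun y => w y - (inr p y + c)) (fun x => f (LT B x)) (δ / R) η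
    ⟨hw.cd.sub (((innerSL ℝ p).contDiff).add contDiff_const), fun x a ha => by rw [hD]; exact hw.pos x a ha, fun x => by rw [hD]; exact hw.det x, hw.fpos, hw.err⟩
    pvt hδγ hη hη0 fun x hx => by
      have := hpc x hx
      rw [Zf, hwe]
      convert this using 2; ring
  refine ⟨_, Flat.comp hB (C := C) (r := θ) ⟨hC, p' + (InnerProductSpace.toDual ℝ (E n)).symm ((θ ^ 2)⁻¹ • (innerSL ℝ p).comp (LT C)), c' + (θ ^ 2)⁻¹ * c, fun x hx => ?_⟩⟩
  have := hC' x hx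
  rw [inner_add_left, InnerProductSpace.toDual_symm_apply]
  simp only [hwe] at this
  simp only [sma, comp_apply, innerSL_apply_apply, sem]
  convert this using 2; ring
lemma LT_one (x : E n) : LT ee x = x := by rw [LT_apply, sum_ee]
lemma inv_fr {S : Fr n} (hS : (frM S).det ≠ 0) : ∃ D : Fr n, (∀ x, LT D (LT S x) = x) ∧ (∀ x, LT S (LT D x) = x) ∧ (frM D).det * (frM S).det = 1 := by
  choose D hD using fun i => LT_surj hS (ee i)
  have hD' : (fun i => LT S (D i)) = ee := funext hD
  have h1 : ∀ x, LT S (LT D x) = x := fun x => by rw [← LT_LT, hD', LT_one]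
  refine ⟨D, fun x => LT_inj hS (h1 _), h1, ?_⟩
  rw [← det_mul, ← frM_LT, hD', frM_ee, det_one]
lemma Flat.mono (h : Flat u R B η) (hη : η ≤ η') : Flat u R B η' := by
  obtain ⟨h1, p, c, h2⟩ := h
  exact ⟨h1, p, c, fun x hx => (h2 x hx).trans hη⟩
lemma Flat.restrict (hR : 0 < R') (hR' : R' ≤ R) (h : Flat u R B η) :
    Flat u R' (fun i => (R' / R) • B i) (η * (R / R') ^ 2) := by
  obtain ⟨h1, p, c, h2⟩ := h
  have hR0 : 0 < R := hR.trans_le hR'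
  have hk : 0 < R' / R := pvt
  have hk1 : R' / R ≤ 1 := (div_le_one hR0).2 hR'
  refine ⟨?_, (R / R') • p, (R / R') ^ 2 * c, fun x hx => ?_⟩
  · rw [frM_smul, abs_mul, h1, aop pvt, ← mul_pow, div_mul_cancel₀ _ hR0.ne']
  · have h3 := h2 ((R' / R) • x) (by
      rw [norm_smul, nnn hk.le]; exact mul_le_one₀ hk1 (norm_nonneg _) hx)
    rw [map_smul, norm_smul, nnn hk.le, inner_smul_right] at h3
    rw [LT_smul, inner_smul_left]
    have e : (R' ^ 2)⁻¹ * u ((R' / R) • LT B x) - (‖x‖ ^ 2 / 2 + (starRingEnd ℝ) (R / R') * inr p x + (R / R') ^ 2 * c) =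
        ((R ^ 2)⁻¹ * u ((R' / R) • LT B x) - ((R' / R * ‖x‖) ^ 2 / 2 + R' / R * inr p x + c)) * (R / R') ^ 2 := by
      simp only [conj_trivial]; field_simp
    rw [e, abs_mul, abs_of_pos (a := (R / R') ^ 2) pvt]
    gcongr
lemma Ent.ma (h : Ent Θ u F) : MA Θ u F := ⟨h.cd, h.pos, h.det, h.fpos, h.err⟩
lemma flat_decay (hn : 3 ≤ n) (hΘ : 0 < Θ) (h : Ent Θ u F) :
    ∃ t η0 : ℝ, 4 ≤ t ∧ 0 < η0 ∧ η0 ≤ 1 / 8 ∧ ∃ m0 : ℕ, ∀ m, m0 ≤ m → ∃ B, Flat u (t ^ m) B (η0 / 2 ^ m) := by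
  have hn0 : 0 < n := omg
  obtain ⟨θ, γ, η0, hθ, hθ4, hγ, hη0, hη8, h7⟩ := P7 hn0
  obtain ⟨c1, C0, hc1, hc1', hC0, hnorm⟩ := norm_exists hn0
  obtain ⟨η1, hη1⟩ := exR (η0 * θ ^ 2)
  have hη1p : 0 < η1 := by rw [hη1]; positivity
  have hη10 : η1 ≤ η0 := by rw [hη1]; exact mul_le_of_le_one_right hη0.le (plo hθ.le lnr)
  obtain ⟨ϱm, δ0, hϱm, hδ0, h6⟩ := P6 hn hc1 hc1' hC0 hη1p
  have key : ∀ R, 0 < R → Θ / R ≤ γ * η1 → Θ ≤ R / ϱm → Θ / (R / ϱm) ≤ δ0 → ∃ B, Flat u R B η0 := by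
    intro R hR k1 k2 k3
    obtain ⟨B, hB, hN⟩ := hnorm Θ u F hΘ h _ k2
    obtain ⟨ϱ, C, hϱ1, hϱ2, hf⟩ := h6 _ _ _ pvt k3 hN
    have hf' := Flat.comp hB hf
    obtain ⟨r, hr⟩ := exR (R / ϱm * ϱ)
    rw [← hr] at hf'
    have hrR : R ≤ r := by
      rw [hr, dmm, ldi hϱm]; gcongr
    have hr0 : 0 < r := hR.trans_le hrR
    obtain ⟨j, hj1, hj2⟩ := exists_nat_pow_near_of_lt_one (x := R / r) pvt ((div_le_one hr0).2 hrR) hθ lnr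
    have ind : ∀ k, k ≤ j → ∃ B, Flat u (r * θ ^ k) B η1 := by
      intro k
      induction k with
      | zero => intro _; rw [pow_zero, mul_one]; exact ⟨_, hf'⟩
      | succ k ih =>
        intro hk
        obtain ⟨B, hB⟩ := ih omg
        have h1 : R ≤ r * θ ^ k := by
          have : θ ^ j ≤ θ ^ k := pow_le_pow_of_le_one hθ.le lnr omg
          have h2 := hj2.trans this
          rwa [dli hr0, mul_comm] at h2
        obtain ⟨B', hB'⟩ := h7 u F Θ η1 (r * θ ^ k) B h.ma hΘ pvt (le_trans gcg k1) hη1p hη10 hB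
        rw [pow_succ, ← mul_assoc]
        exact ⟨B', hB'.mono lnr⟩
    obtain ⟨B, hB⟩ := ind j le_rfl
    have h1 : R ≤ r * θ ^ j := by rwa [dli hr0, mul_comm] at hj2
    refine ⟨_, (hB.restrict hR h1).mono ?_⟩
    have h2 : r * θ ^ j * θ ≤ R := by
      rw [lt_div_iff₀ hr0] at hj1
      calc r * θ ^ j * θ = θ ^ (j + 1) * r := rng
        _ ≤ R := hj1.le
    have h3 : r * θ ^ j * θ / R ≤ 1 := (div_le_one hR).2 h2
    calc η1 * (r * θ ^ j / R) ^ 2 = η0 * (r * θ ^ j * θ / R) ^ 2 := by rw [hη1]; ring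
      _ ≤ η0 * 1 := by gcongr; exact plo pvt h3
      _ = η0 := mul_one _
  obtain ⟨R0, hR0, hkey⟩ : ∃ R0 : ℝ, 0 < R0 ∧ ∀ R, R0 ≤ R → ∃ B, Flat u R B η0 := by
    refine ⟨max (Θ / (γ * η1)) (max (Θ * ϱm) (Θ * ϱm / δ0)), by positivity, fun R hR => ?_⟩
    have h1 := (le_max_left _ _).trans hR
    have h2 := ((le_max_left _ _).trans (le_max_right _ _)).trans hR
    have h3 := ((le_max_right _ _).trans (le_max_right _ _)).trans hR
    have hR : 0 < R := lt_of_lt_of_le pvt h1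
    rw [dli pvt] at h1 h3
    refine key R hR ?_ ?_ ?_
    · rw [dli hR]; linarith
    · rwa [ldi hϱm]
    · rw [div_div_eq_mul_div, dli hR]; linarith
  obtain ⟨m0, hm0⟩ := pow_unbounded_of_one_lt (max R0 (Θ / (γ * η0))) (y := (2:ℝ)) nnm
  have ht : 4 ≤ θ⁻¹ := by rw [le_inv_comm₀ nnm hθ]; linarith
  refine ⟨θ⁻¹, η0, ht, hη0, hη8, m0, fun m hm => ?_⟩
  have h2m : max R0 (Θ / (γ * η0)) ≤ 2 ^ m := hm0.le.trans (ppr nnm hm)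
  have h4m : (2:ℝ) ^ m * 2 ^ m ≤ θ⁻¹ ^ m := by
    rw [← mul_pow]; exact ppl nnm lnr m
  have h1m : (1:ℝ) ≤ 2 ^ m := olp nnm
  have ind : ∀ k, k ≤ m → ∃ B, Flat u (θ⁻¹ ^ (2 * m - k)) B (η0 / 2 ^ k) := by
    intro k
    induction k with
    | zero =>
      intro _
      rw [pow_zero, div_one]
      apply hkey
      refine ((le_max_left _ _).trans h2m).trans ?_
      calc (2:ℝ) ^ m ≤ θ⁻¹ ^ m := ppl nnm lnr m
        _ ≤ _ := ppr lnr omg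
    | succ k ih =>
      intro hk
      obtain ⟨B, hB⟩ := ih omg
      have h1 : θ⁻¹ ^ m ≤ θ⁻¹ ^ (2 * m - k) := ppr lnr omg
      have h2 : (2:ℝ) ^ k ≤ 2 ^ m := ppr nnm omg
      obtain ⟨B', hB'⟩ := h7 u F Θ (η0 / 2 ^ k) _ B h.ma hΘ pvt (by
        have h3 := (le_max_right _ _).trans h2m
        rw [dli pvt] at h3
        rw [dli pvt, mul_div_assoc', dmm, ldi pvt]
        calc Θ * 2 ^ k ≤ 2 ^ m * (γ * η0) * 2 ^ m := gcg
          _ = γ * η0 * (2 ^ m * 2 ^ m) := rng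
          _ ≤ γ * η0 * θ⁻¹ ^ (2 * m - k) := by gcongr; exact h4m.trans h1) pvt
        (div_le_self hη0.le (olp nnm)) hB
      refine ⟨B', ?_⟩
      have e : θ⁻¹ ^ (2 * m - k) * θ = θ⁻¹ ^ (2 * m - (k + 1)) := by
        rw [show 2 * m - k = (2 * m - (k + 1)) + 1 by omega, pow_succ, mul_assoc, imc hθ.ne', mul_one]
      rw [e] at hB'
      rwa [pow_succ, ← div_div]
  have := ind m le_rfl
  rwa [show 2 * m - m = m by omega] at this
lemma flat_pure (hu0 : u 0 = 0) (hu : ∀ x, 0 ≤ u x) (hε : 0 < ε) (hε8 : ε ≤ 1 / 8)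
    (h : Flat u R B ε) (x : E n) (hx : ‖x‖ ≤ 1) : |(R ^ 2)⁻¹ * u (LT B x) - ‖x‖ ^ 2 / 2| ≤ 4 * √ε := by
  obtain ⟨-, p, c, hp⟩ := h
  have hc := hp 0 smp
  simp only [map_zero, hu0, norm_zero, inner_zero_right] at hc
  have hc' : |c| ≤ ε := by rw [← abs_neg]; convert hc using 2; ring
  rw [abs_le] at hc'
  have hlow : ∀ x : E n, ‖x‖ ≤ 1 → 0 ≤ ‖x‖ ^ 2 / 2 + inr p x + 2 * ε := fun x hx => by
    have h1 := (abs_le.1 (hp x hx)).2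
    have h2 : 0 ≤ (R ^ 2)⁻¹ * u (LT B x) := mul_nonneg pvt (hu _)
    linarith
  have hsq := sq_sqrt hε.le
  have hp2 : ‖p‖ ≤ 2 * √ε := by
    by_cases h1 : ‖p‖ ≤ 1
    · have := hlow (-p) (by rwa [norm_neg])
      rw [norm_neg, inner_neg_right, ris] at this
      exact le_of_sq_le_sq (by rw [mul_pow, hsq]; linarith) pvt
    · push Not at h1
      have hp0 : 0 < ‖p‖ := lnr
      have := hlow (-(‖p‖⁻¹ • p)) (by rw [norm_neg, norm_smul, norm_inv, norm_norm, imc hp0.ne'])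
      rw [norm_neg, norm_smul, norm_inv, norm_norm, imc hp0.ne', inner_neg_right, inner_smul_right, ris, sq ‖p‖, inv_mul_cancel_left₀ hp0.ne'] at this
      linarith
  have h1 := abs_le.1 (hp x hx)
  have h2 := abs_le.1 ((abs_real_inner_le_norm p x).trans (mul_le_of_le_one_right (norm_nonneg p) hx))
  have h3 : ε ≤ √ε := by
    have : √ε ≤ 1 := Real.sqrt_le_one.2 lnr
    nlinarith [sqrt_nonneg ε]
  rw [abs_le]
  constructor <;> linarith [h1.1, h1.2, h2.1, h2.2, hc'.1, hc'.2]
lemma flat_inv (hR : 0 < R) (hu0 : u 0 = 0) (hu : ∀ x, 0 ≤ u x) (hε : 0 < ε) (hε8 : ε ≤ 1 / 8)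
    (h : Flat u R B ε) : ∃ D : Fr n, |(frM D).det| = 1 ∧ ∀ y, ‖LT D y‖ ≤ R → |u y - ‖LT D y‖ ^ 2 / 2| ≤ 4 * √ε * R ^ 2 := by
  have hS : |(frM (fun i => R⁻¹ • B i)).det| = 1 := by
    rw [frM_smul, abs_mul, h.1, aop pvt, ← mul_pow, imc hR.ne', one_pow]
  obtain ⟨D, -, h2, h3⟩ := inv_fr (S := fun i => R⁻¹ • B i) (fun h' => by rw [h', abs_zero] at hS; exact zero_ne_one hS)
  refine ⟨D, ?_, fun y hy => ?_⟩
  · have := congrArg abs h3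
    rwa [abs_mul, hS, mul_one, abs_one] at this
  · have h4 := flat_pure hu0 hu hε hε8 h (R⁻¹ • LT D y) (by
      rw [norm_smul, nnn pvt, iml hR, mul_one]; exact hy)
    have h5 := h2 y
    rw [LT_smul] at h5
    rw [map_smul, h5, norm_smul, nnn pvt] at h4
    have e : u y - ‖LT D y‖ ^ 2 / 2 = ((R ^ 2)⁻¹ * u y - (R⁻¹ * ‖LT D y‖) ^ 2 / 2) * R ^ 2 := by field_simp
    rw [e, abs_mul, abs_of_pos (a := R ^ 2) pvt]
    gcongr
lemma q_step {e : ℝ} {D D' : Fr n} (hR : 0 < R) (ht : 4 ≤ t) (he : e ≤ 1 / 4) (he' : e' ≤ e) (hDd : |(frM D).det| = 1)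
    (hD : ∀ y, ‖LT D y‖ ≤ R → |u y - ‖LT D y‖ ^ 2 / 2| ≤ e * R ^ 2)
    (hD' : ∀ y, ‖LT D' y‖ ≤ R * t → |u y - ‖LT D' y‖ ^ 2 / 2| ≤ e' * (R * t) ^ 2) (y : E n) :
    |‖LT D' y‖ ^ 2 - ‖LT D y‖ ^ 2| ≤ 2 * (1 + t ^ 2) * e * ‖LT D y‖ ^ 2 := by
  have claim : ∀ y, ‖LT D y‖ = R → |‖LT D' y‖ ^ 2 - ‖LT D y‖ ^ 2| ≤ 2 * (1 + t ^ 2) * e * R ^ 2 := by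
    intro y hy
    have hR2 : 0 < R ^ 2 := pvt
    have ha : ‖LT D' y‖ ≤ R * t := by
      by_contra ha
      push Not at ha
      have ha0 : 0 < ‖LT D' y‖ := lt_trans pvt ha
      obtain ⟨l, hl⟩ := exR (R * t / ‖LT D' y‖)
      have hl0 : 0 < l := by rw [hl]; positivity
      have hl1 : l ≤ 1 := by rw [hl, div_le_one ha0]; exact ha.le
      have h1 : ‖LT D' (l • y)‖ = R * t := by
        rw [map_smul, norm_smul, nnn hl0.le, hl, div_mul_cancel₀ _ ha0.ne']
      have h2 : ‖LT D (l • y)‖ ≤ R := by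
        rw [map_smul, norm_smul, nnn hl0.le, hy]; exact mlol hR.le hl1
      have h3 := (abs_le.1 (hD' _ h1.le)).1
      have h4 := (abs_le.1 (hD _ h2)).2
      rw [h1] at h3
      have h5 : ‖LT D (l • y)‖ ^ 2 ≤ R ^ 2 := gcg
      have h6 : e' * (R * t) ^ 2 ≤ 1 / 4 * (R * t) ^ 2 := by gcongr; linarith
      have h7 : e * R ^ 2 ≤ 1 / 4 * R ^ 2 := gcg
      have h8 : R ^ 2 * 16 ≤ (R * t) ^ 2 := by rw [mul_pow]; gcongr; nlinarith
      linarith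
    have h1 := abs_le.1 (hD y hy.le)
    have h2 := abs_le.1 (hD' y ha)
    rw [hy] at h1 ⊢
    have h3 : e' * (R * t) ^ 2 ≤ e * (R * t) ^ 2 := gcg
    have h4 : 2 * (1 + t ^ 2) * e * R ^ 2 = 2 * (e * R ^ 2) + 2 * (e * (R * t) ^ 2) := rng
    rw [abs_le]
    constructor <;> linarith [h1.1, h1.2, h2.1, h2.2]
  by_cases h0 : LT D y = 0
  · have : y = 0 := LT_inj (b := D) (fun h' => by rw [h', abs_zero] at hDd; exact zero_ne_one hDd) (by rw [h0, map_zero])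
    rw [this]; simp
  · have hs : 0 < ‖LT D y‖ := norm_pos_iff.2 h0
    obtain ⟨k, hk⟩ := exR (R / ‖LT D y‖)
    have hk0 : 0 < k := by rw [hk]; positivity
    have hkR : k * ‖LT D y‖ = R := by rw [hk, div_mul_cancel₀ _ hs.ne']
    have h1 := claim (k • y) (by rw [map_smul, norm_smul, nnn hk0.le, hkR])
    rw [map_smul, map_smul, norm_smul, norm_smul, nnn hk0.le, mul_pow, mul_pow, ← mul_sub, abs_mul, abs_of_pos (a := k ^ 2) pvt, ← hkR] at h1
    refine le_of_mul_le_mul_left (a := k ^ 2) (h1.trans_eq rng) pvt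
lemma limit_frame {D : ℕ → Fr n} (hκ : 0 ≤ κ) (hσ : 0 < σ) (hσ1 : σ < 1) (hdet : ∀ m, |(frM (D m)).det| = 1)
    (hstep : ∀ m y, |‖LT (D (m + 1)) y‖ ^ 2 - ‖LT (D m) y‖ ^ 2| ≤ κ * σ ^ m * ‖LT (D m) y‖ ^ 2) :
    ∃ (P : Fr n) (K M : ℝ), |(frM P).det| = 1 ∧ 0 < K ∧ 0 < M ∧ (∀ m y, |‖LT (D m) y‖ ^ 2 - ‖LT P y‖ ^ 2| ≤ K * σ ^ m * ‖y‖ ^ 2) ∧ ∀ m y, ‖LT (D m) y‖ ^ 2 ≤ M * ‖y‖ ^ 2 := by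
  have hs : 0 < 1 - σ := lnr
  have hσm : ∀ m, 0 < σ ^ m := fun m => pow_pos hσ m
  have hex : ∀ m y, ‖LT (D m) y‖ ^ 2 ≤ exp (κ * (1 - σ ^ m) / (1 - σ)) * ‖LT (D 0) y‖ ^ 2 := by
    intro m y
    induction m with
    | zero => simp
    | succ m ih =>
      have h1 := (abs_le.1 (hstep m y)).2
      have h2 := add_one_le_exp (κ * σ ^ m)
      have e : κ * (1 - σ ^ (m + 1)) / (1 - σ) = κ * σ ^ m + κ * (1 - σ ^ m) / (1 - σ) := by field_simp; ring
      rw [e, Real.exp_add, mul_assoc]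
      calc ‖LT (D (m + 1)) y‖ ^ 2 ≤ (κ * σ ^ m + 1) * ‖LT (D m) y‖ ^ 2 := lnr
        _ ≤ _ := gcg
  obtain ⟨M, hM⟩ := exR (exp (κ / (1 - σ)) * ‖LT (D 0)‖ ^ 2 + 1)
  have hM0 : 0 < M := by rw [hM]; positivity
  have hMb : ∀ m y, ‖LT (D m) y‖ ^ 2 ≤ M * ‖y‖ ^ 2 := fun m y => by
    have h1 : κ * (1 - σ ^ m) / (1 - σ) ≤ κ / (1 - σ) := by
      gcongr; exact mul_le_of_le_one_right hκ (by linarith [hσm m])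
    have h2 : ‖LT (D 0) y‖ ^ 2 ≤ (‖LT (D 0)‖ * ‖y‖) ^ 2 := by gcongr; exact (LT (D 0)).le_opNorm y
    calc _ ≤ _ := hex m y
      _ ≤ exp (κ / (1 - σ)) * (‖LT (D 0)‖ * ‖y‖) ^ 2 := gcg
      _ ≤ M * ‖y‖ ^ 2 := by rw [hM]; nlinarith [sq_nonneg ‖y‖]
  have hsum : ∀ m k y, |‖LT (D (m + k)) y‖ ^ 2 - ‖LT (D m) y‖ ^ 2| ≤ κ * M / (1 - σ) * (σ ^ m - σ ^ (m + k)) * ‖y‖ ^ 2 := by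
    intro m k y
    induction k with
    | zero => simp
    | succ k ih =>
      have h1 := hstep (m + k) y
      have h2 : κ * σ ^ (m + k) * ‖LT (D (m + k)) y‖ ^ 2 ≤ κ * σ ^ (m + k) * (M * ‖y‖ ^ 2) := by
        have := hσm (m + k); gcongr; exact hMb _ _
      have e : κ * M / (1 - σ) * (σ ^ m - σ ^ (m + (k + 1))) * ‖y‖ ^ 2 = κ * M / (1 - σ) * (σ ^ m - σ ^ (m + k)) * ‖y‖ ^ 2 + κ * σ ^ (m + k) * (M * ‖y‖ ^ 2) := by
        field_simp; ring
      rw [e]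
      rw [abs_le] at h1 ih ⊢
      rw [← add_assoc]
      constructor <;> linarith [h1.1, h1.2, ih.1, ih.2]
  have hcl : ∀ m, D m ∈ closedBall (0 : Fr n) √M := fun m => by
    rw [mcz, pi_norm_le_iff_of_nonneg (sqrt_nonneg _)]
    intro i
    have := hMb m (ee i)
    rw [LT_ee] at this
    apply Real.le_sqrt_of_sq_le
    simpa [ee] using this
  obtain ⟨P, -, φ, hφ, hlim⟩ := tendsto_subseq_of_bounded isBounded_closedBall hcl
  have hc1 : Continuous fun b : Fr n => |(frM b).det| := by
    apply Continuous.abs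
    apply Continuous.matrix_det
    unfold frM
    fun_prop
  have hc2 : ∀ y, Continuous fun b : Fr n => ‖LT b y‖ ^ 2 := fun y => by
    simp only [LT_apply]; fun_prop
  refine ⟨P, κ * M / (1 - σ) + 1, M, ?_, by positivity, hM0, fun m y => ?_, hMb⟩
  · have h1 := (hc1.tendsto P).comp hlim
    refine tendsto_nhds_unique h1 ?_
    have : ((fun b : Fr n => |(frM b).det|) ∘ (D ∘ φ)) = fun _ => 1 := funext fun k => hdet _
    rw [this]; exact tendsto_const_nhds
  · have h1 := ((tendsto_const_nhds (x := ‖LT (D m) y‖ ^ 2)).sub (((hc2 y).tendsto P).comp hlim)).abs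
    refine le_of_tendsto h1 ?_
    filter_upwards [eventually_ge_atTop m] with k hk
    have h2 : m ≤ φ k := hk.trans (hφ.id_le k)
    obtain ⟨j, hj⟩ := Nat.exists_eq_add_of_le h2
    have h3 := hsum m j y
    rw [← hj, abs_sub_comm] at h3
    refine h3.trans ?_
    have := hσm m
    have := hσm (φ k)
    have : κ * M / (1 - σ) * (σ ^ m - σ ^ φ k) ≤ (κ * M / (1 - σ) + 1) * σ ^ m := by
      have : 0 ≤ κ * M / (1 - σ) := pvt
      nlinarith
    gcongr
lemma asym (hn : 3 ≤ n) (hΘ : 0 < Θ) (h : Ent Θ u F) :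
    ∃ (S : Fr n) (C ε : ℝ), |(frM S).det| = 1 ∧ 0 < C ∧ 0 < ε ∧ ∀ x, 1 ≤ ‖x‖ → |u (LT S x) - ‖x‖ ^ 2 / 2| ≤ C * ‖x‖ ^ ((2 : ℝ) - ε) := by
  obtain ⟨t, η0, ht, hη0, hη8, m0, hfl⟩ := flat_decay hn hΘ h
  have ht0 : 0 < t := lnr
  obtain ⟨σ, hσe⟩ := exR (√(1 / 2 : ℝ))
  have hσ : 0 < σ := by rw [hσe]; positivity
  have hσ2 : σ ^ 2 = 1 / 2 := by rw [hσe]; exact sq_sqrt nnm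
  have hσ1 : σ < 1 := by nlinarith
  obtain ⟨m1, hm01, hm1⟩ : ∃ m1, m0 ≤ m1 ∧ 4 * √η0 * σ ^ m1 ≤ 1 / 4 := by
    have h1 := ((tendsto_pow_atTop_nhds_zero_of_lt_one hσ.le hσ1).const_mul (4 * √η0))
    rw [mul_zero] at h1
    obtain ⟨m, hm⟩ := ((h1.eventually_le_const (by norm_num : (0:ℝ) < 1 / 4)).and (eventually_ge_atTop m0)).exists
    exact ⟨m, hm.2, hm.1⟩
  obtain ⟨A, hA⟩ := exR (4 * √η0 * σ ^ m1)
  rw [← hA] at hm1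
  have hA0 : 0 < A := by rw [hA]; positivity
  have hD : ∀ k : ℕ, ∃ D : Fr n, |(frM D).det| = 1 ∧ ∀ y, ‖LT D y‖ ≤ t ^ (m1 + k) → |u y - ‖LT D y‖ ^ 2 / 2| ≤ A * σ ^ k * (t ^ (m1 + k)) ^ 2 := by
    intro k
    obtain ⟨B, hB⟩ := hfl (m1 + k) omg
    have e : 4 * √(η0 / 2 ^ (m1 + k)) = A * σ ^ k := by
      have : √(η0 / 2 ^ (m1 + k)) = √η0 * σ ^ (m1 + k) := by
        rw [Real.sqrt_eq_iff_mul_self_eq pvt pvt]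
        have h2 : σ ^ (m1 + k) * σ ^ (m1 + k) = 1 / 2 ^ (m1 + k) := by
          rw [← mul_pow, ← sq, hσ2, one_div_pow]
        symm
        calc √η0 * σ ^ (m1 + k) * (√η0 * σ ^ (m1 + k)) = (√η0 * √η0) * (σ ^ (m1 + k) * σ ^ (m1 + k)) := rng
          _ = _ := by rw [h2, mul_self_sqrt hη0.le]; ring
      rw [this, hA, pow_add]; ring
    obtain ⟨D, h1, h2⟩ := flat_inv (R := t ^ (m1 + k)) pvt h.u0 h.nonneg pvt ((div_le_self hη0.le (olp nnm)).trans hη8) hB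
    rw [e] at h2
    exact ⟨D, h1, h2⟩
  choose D hdet hDb using hD
  have hσk : ∀ k, σ ^ k ≤ 1 := fun k => plo hσ.le hσ1.le
  obtain ⟨P, K, M, hP, hK, hM, hKb, hMb⟩ := limit_frame (κ := 2 * (1 + t ^ 2) * A) pvt hσ hσ1 hdet fun m y => by
    have := q_step (u := u) (R := t ^ (m1 + m)) (e := A * σ ^ m) (e' := A * σ ^ (m + 1)) (t := t) pvt ht
      ((mul_le_of_le_one_right hA0.le (hσk m)).trans hm1)
      (by rw [pow_succ]; gcongr; exact mul_le_of_le_one_right pvt hσ1.le) (hdet m) (hDb m) (D' := D (m + 1)) (by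
        have := hDb (m + 1)
        rwa [← add_assoc, pow_succ] at this) y
    rwa [mul_assoc (2 * (1 + t ^ 2)) A]
  obtain ⟨S, hS1, -, hSd⟩ := inv_fr (S := P) (fun h' => by rw [h', abs_zero] at hP; exact zero_ne_one hP)
  have hS2 : |(frM S).det| = 1 := by
    have := congrArg abs hSd
    rwa [abs_mul, hP, mul_one, abs_one] at this
  have hPS : ∀ x, LT P (LT S x) = x := fun x => by
    obtain ⟨z, rfl⟩ := LT_surj (b := P) (fun h' => by rw [h', abs_zero] at hP; exact zero_ne_one hP) x
    rw [hS1]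
  obtain ⟨L, hL⟩ := exR (‖LT S‖)
  have hL0 : 0 ≤ L := by rw [hL]; positivity
  have hLb : ∀ x, ‖LT S x‖ ^ 2 ≤ L ^ 2 * ‖x‖ ^ 2 := fun x => by
    rw [← mul_pow, hL]; gcongr; exact (LT S).le_opNorm x
  obtain ⟨N, hN⟩ := exR (M * L ^ 2 + 1)
  have hN1 : 1 ≤ N := by rw [hN]; linarith [show 0 ≤ M * L ^ 2 by positivity]
  have hN2 : M * L ^ 2 ≤ N ^ 2 := by
    have : N ≤ N ^ 2 := le_self_pow₀ hN1 two_ne_zero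
    linarith
  have ht1 : 0 < log t := Real.log_pos lnr
  obtain ⟨α, hα⟩ := exR (-log σ / log t)
  have hα0 : 0 < α := by rw [hα]; exact div_pos (neg_pos.2 (Real.log_neg hσ hσ1)) ht1
  have hαt : t ^ (-α) = σ := by
    rw [Real.rpow_def_of_pos ht0, hα]
    rw [show log t * -(-log σ / log t) = log σ by field_simp, Real.exp_log hσ]
  obtain ⟨C2, hC2⟩ := (iCB zE n (t ^ m1)).exists_bound_of_continuousOn (f := fun x => u (LT S x) - ‖x‖ ^ 2 / 2)
    ((h.cd.continuous.comp (LT S).continuous).sub fpr).continuousOn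
  obtain ⟨C1, hC1⟩ := exR ((A * (t * N) ^ 2 + K * L ^ 2) / σ ^ m1)
  have hC10 : 0 ≤ C1 := by rw [hC1]; positivity
  refine ⟨S, C1 + |C2| + 1, min α 2, hS2, by positivity, by positivity, fun x hx => ?_⟩
  have hx0 : 0 < ‖x‖ := lnr
  have hmin : ‖x‖ ^ (2 - α) ≤ ‖x‖ ^ (2 - min α 2) := Real.rpow_le_rpow_of_exponent_le hx (by linarith [mll α 2])
  have hone : 1 ≤ ‖x‖ ^ (2 - min α 2) := Real.one_le_rpow hx (by linarith [mlr α 2])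
  by_cases hxs : ‖x‖ ≤ t ^ m1
  · have h1 := hC2 x (by rwa [mcz])
    rw [norm_eq_abs] at h1
    calc _ ≤ C2 := h1
      _ ≤ (C1 + |C2| + 1) * 1 := by linarith [le_abs_self C2]
      _ ≤ _ := gcg
  · push Not at hxs
    obtain ⟨m, hm1', hm2⟩ := exists_nat_pow_near (x := N * ‖x‖) (y := t) (one_le_mul_of_one_le_of_one_le hN1 hx) lnr
    have hNx : ‖x‖ ≤ N * ‖x‖ := le_mul_of_one_le_left hx0.le hN1
    have hmm : m1 < m + 1 := by
      by_contra hc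
      push Not at hc
      have h1 : t ^ (m + 1) ≤ t ^ m1 := ppr lnr hc
      linarith
    obtain ⟨k, hk⟩ := Nat.exists_eq_add_of_le hmm.le
    have hq : ‖LT (D k) (LT S x)‖ ≤ N * ‖x‖ := by
      refine le_of_sq_le_sq ?_ pvt
      calc _ ≤ M * ‖LT S x‖ ^ 2 := hMb k _
        _ ≤ M * (L ^ 2 * ‖x‖ ^ 2) := by gcongr; exact hLb x
        _ = M * L ^ 2 * ‖x‖ ^ 2 := rng
        _ ≤ N ^ 2 * ‖x‖ ^ 2 := gcg
        _ = _ := rng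
    have h1 := hDb k (LT S x) (by rw [← hk]; exact hq.trans hm2.le)
    have h2 := hKb k (LT S x)
    rw [hPS] at h2
    rw [← hk] at h1
    have hR : t ^ (m + 1) ≤ t * (N * ‖x‖) := by rw [pow_succ, mul_comm]; gcongr
    have hσk0 : 0 < σ ^ k := pow_pos hσ k
    have h3 : A * σ ^ k * (t ^ (m + 1)) ^ 2 ≤ A * σ ^ k * (t * (N * ‖x‖)) ^ 2 := gcg
    have h4 : K * σ ^ k * ‖LT S x‖ ^ 2 ≤ K * σ ^ k * (L ^ 2 * ‖x‖ ^ 2) := by gcongr; exact hLb x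
    have h5 : |u (LT S x) - ‖x‖ ^ 2 / 2| ≤ σ ^ k * (A * (t * N) ^ 2 + K * L ^ 2) * ‖x‖ ^ 2 := by
      have e : σ ^ k * (A * (t * N) ^ 2 + K * L ^ 2) * ‖x‖ ^ 2 = A * σ ^ k * (t * (N * ‖x‖)) ^ 2 + K * σ ^ k * (L ^ 2 * ‖x‖ ^ 2) := rng
      rw [e]
      have : 0 ≤ K * σ ^ k * (L ^ 2 * ‖x‖ ^ 2) := pvt
      rw [abs_le] at h1 h2 ⊢
      constructor <;> linarith [h1.1, h1.2, h2.1, h2.2]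
    have h6 : σ ^ (m + 1) ≤ ‖x‖ ^ (-α) := by
      rw [← hαt, ← rpow_natCast, ← rpow_mul ht0.le, mul_comm, rpow_mul ht0.le, rpow_natCast]
      exact Real.rpow_le_rpow_of_nonpos hx0 (hNx.trans hm2.le) lnr
    have h7 : σ ^ k = σ ^ (m + 1) / σ ^ m1 := by rw [hk, pow_add]; field_simp
    have h8 : ‖x‖ ^ (2 - α) = ‖x‖ ^ (-α) * ‖x‖ ^ 2 := by
      rw [← Real.rpow_two, ← Real.rpow_add hx0]; congr 1; ring
    calc _ ≤ _ := h5
      _ = σ ^ (m + 1) * C1 * ‖x‖ ^ 2 := by rw [h7, hC1]; ring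
      _ ≤ ‖x‖ ^ (-α) * C1 * ‖x‖ ^ 2 := gcg
      _ = C1 * ‖x‖ ^ (2 - α) := by rw [h8]; ring
      _ ≤ (C1 + |C2| + 1) * ‖x‖ ^ (2 - min α 2) := by
        gcongr; linarith [abs_nonneg C2]
lemma asym' (hn : 3 ≤ n) (hΘ : 0 < Θ) (h : Ent Θ u F) :
    ∃ (S : Fr n) (C ε : ℝ), (frM S).det = 1 ∧ 0 < C ∧ 0 < ε ∧ ∀ x, 1 ≤ ‖x‖ → |u (LT S x) - ‖x‖ ^ 2 / 2| ≤ C * ‖x‖ ^ ((2 : ℝ) - ε) := by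
  obtain ⟨S, C, ε, h1, h2, h3, h4⟩ := asym hn hΘ h
  rcases eq_or_eq_neg_of_abs_eq h1 with h5 | h5
  · exact ⟨S, C, ε, h5, h2, h3, h4⟩
  · obtain ⟨τ, hτ⟩ : ∃ τ : Equiv.Perm (Fin n), τ = Equiv.swap ⟨0, by omega⟩ ⟨1, by omega⟩ := ⟨_, rfl⟩
    have hs : Equiv.Perm.sign τ = -1 := by rw [hτ]; exact Equiv.Perm.sign_swap smp
    refine ⟨fun i => S (τ i), C, ε, ?_, h2, h3, fun x hx => ?_⟩
    · have := Matrix.det_permute τ (frM S)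
      rw [hs, h5] at this
      rw [show frM (fun i => S (τ i)) = (frM S).submatrix τ id from rfl, this]; simp
    · have h6 := h4 (WithLp.toLp 2 fun i => x (τ.symm i))
      have e1 : ‖(WithLp.toLp 2 fun i => x (τ.symm i) : E n)‖ = ‖x‖ := by
        rw [norm_eq, norm_eq]
        congr 1
        exact Equiv.sum_comp τ.symm (fun i => ‖x i‖ ^ 2)
      have e2 : LT S (WithLp.toLp 2 fun i => x (τ.symm i)) = LT (fun i => S (τ i)) x := by
        rw [LT_apply, LT_apply, ← Equiv.sum_comp τ]
        simp
      rw [e1, e2] at h6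
      exact h6 hx
end
end MAR

theorem MongeAmpere_rough_asymptotics
    (n : ℕ) (hn : 3 ≤ n)
    (u : EuclideanSpace ℝ (Fin n) → ℝ) (hu : ContDiff ℝ 2 u)
    (hconvex : ConvexOn ℝ Set.univ u)
    (hu0 : u 0 = 0) (humin : ∀ x, 0 ≤ u x)
    (ψ : EuclideanSpace ℝ (Fin n) → ℝ)
    (hψcont : Continuous ψ) (hψpos : ∀ x, 0 < ψ x)
    (hψL : Integrable (fun x : EuclideanSpace ℝ (Fin n) =>
      |ψ x ^ ((1 : ℝ) / n) - 1| ^ (n : ℕ)) volume)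
    (hMA : ∀ x, (hess u x).det = ψ x) :
    ∃ (T : EuclideanSpace ℝ (Fin n) ≃ₗ[ℝ] EuclideanSpace ℝ (Fin n)) (C ε : ℝ),
      LinearMap.det (T : EuclideanSpace ℝ (Fin n) →ₗ[ℝ] EuclideanSpace ℝ (Fin n)) = 1 ∧
      0 < C ∧ 0 < ε ∧
      ∀ x : EuclideanSpace ℝ (Fin n), 1 ≤ ‖x‖ →
        |u (T x) - ‖x‖ ^ 2 / 2| ≤ C * ‖x‖ ^ ((2 : ℝ) - ε) := by
  have hn0 : n ≠ 0 := by omega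
  obtain ⟨I, hI⟩ : ∃ I : ℝ, I = ∫ x : EuclideanSpace ℝ (Fin n), |ψ x ^ ((1 : ℝ) / n) - 1| ^ n := ⟨_, rfl⟩
  have hI0 : 0 ≤ I := by rw [hI]; exact integral_nonneg fun x => by positivity
  have hdet : ∀ x, (MAR.mat (MAR.D2 u x)).det = ψ x := fun x => by rw [MAR.mat_D2]; exact hMA x
  have hE : MAR.Ent (I + 1) u (fun x => ψ x ^ ((1 : ℝ) / n)) := by
    refine ⟨hu, fun x a ha => ?_, hu0, humin, fun x => ?_, fun x => Real.rpow_pos_of_pos (hψpos x) _, ?_, hψL, ?_⟩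
    · exact MAR.pos_of_det (MAR.D2_symm hu x) (MAR.psd_of_convex hu hconvex x) (by rw [hdet]; exact (hψpos x).ne') a ha
    · rw [hdet, one_div, Real.rpow_inv_natCast_pow (hψpos x).le hn0]
    · exact hψcont.rpow_const fun x => Or.inl (hψpos x).ne'
    · rw [← hI]
      exact (by linarith : I ≤ I + 1).trans (le_self_pow₀ (by linarith) hn0)
  obtain ⟨S, C, ε, h1, h2, h3, h4⟩ := MAR.asym' hn (by linarith) hE
  have hd : LinearMap.det (MAR.LT S : MAR.E n →ₗ[ℝ] MAR.E n) = 1 := by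
    have := MAR.LT_det S
    rw [ContinuousLinearMap.det, h1] at this
    exact this
  refine ⟨LinearMap.equivOfDetNeZero _ (hd.trans_ne one_ne_zero), C, ε, ?_, h2, h3, fun x hx => h4 x hx⟩
  exact hd
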